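/- Let F = (X_n, K_n, π_n)_{n≥1} be a family of irreducible birth and death chains on X_n = {0,1,...,n} and F_c the family of associated continuous-time chains. Suppose that, in total variation, F_c^L has a cutoff with cutoff time t_n but no subsequence of F_c^R has a cutoff. For a sequence of states M_n ∈ X_n, set R = limsup_n E_n τ̃^{(n)}_{M_n} / t_n. Then the following are equivalent: (1) F_c has a maximum total variation cutoff (in which case t_n is a cutoff time); (2) R = 0 for some sequence (M_n) with inf_n π_n([0,M_n]) > 0 and inf_n π_n([M_n,n]) > 0; (3) R = 0 for every sequence (M_n) with inf_n π_n([0,M_n]) > 0 and inf_n π_n([M_n,n]) > 0. The same equivalence holds for the discrete-time families (with τ^{(n)} in place of τ̃^{(n)}) provided inf_{n,i} K_n(i,i) > 0. -/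

import Mathlib

open scoped BigOperators
open Filter Matrix Polynomial MeasureTheory

noncomputable section

/-- An irreducible birth and death chain on `{0,1,...,n}`, together with its
(unique) stationary distribution. -/
structure BDChain (n : ℕ) where
  K : Matrix (Fin (n + 1)) (Fin (n + 1)) ℝ
  pi : Fin (n + 1) → ℝ
  K_nonneg : ∀ i j, 0 ≤ K i j
  K_rowSum : ∀ i, ∑ j, K i j = 1
  K_tridiag : ∀ i j : Fin (n + 1), 1 < |(i : ℤ) - (j : ℤ)| → K i j = 0
  K_irred : ∀ i : ℕ, ∀ h : i < n,
    0 < K ⟨i, by omega⟩ ⟨i + 1, by omega⟩ ∧ 0 < K ⟨i + 1, by omega⟩ ⟨i, by omega⟩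
  pi_pos : ∀ i, 0 < pi i
  pi_sum : ∑ i, pi i = 1
  pi_stat : ∀ j, ∑ i, pi i * K i j = pi j

namespace BDChain

variable {n : ℕ}

/-- `π([0,M])` -/
def piLow (c : BDChain n) (M : Fin (n + 1)) : ℝ :=
  ∑ ℓ : Fin (n + 1), if ℓ ≤ M then c.pi ℓ else 0

/-- `π([M,n])` -/
def piHigh (c : BDChain n) (M : Fin (n + 1)) : ℝ :=
  ∑ ℓ : Fin (n + 1), if M ≤ ℓ then c.pi ℓ else 0

/-- `π([a,b])` -/
def piInt (c : BDChain n) (a b : Fin (n + 1)) : ℝ :=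
  ∑ ℓ : Fin (n + 1), if a ≤ ℓ ∧ ℓ ≤ b then c.pi ℓ else 0

/-- The substochastic matrix of the chain killed at state `i`. -/
def killed (c : BDChain n) (i : Fin (n + 1)) : Matrix (Fin (n + 1)) (Fin (n + 1)) ℝ :=
  Matrix.of fun x y => if x = i ∨ y = i then 0 else c.K x y

/-- `P_j(τ_i > m)`, where `τ_i` is the discrete-time hitting time of state `i`. -/
def hitSurv (c : BDChain n) (i j : Fin (n + 1)) (m : ℕ) : ℝ :=
  if j = i then 0 else ∑ y, (c.killed i ^ m) j y

/-- `P_j(τ̃_i > t)`, where `τ̃_i` is the continuous-time hitting time of state `i`. -/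
def hitSurvC (c : BDChain n) (i j : Fin (n + 1)) (t : ℝ) : ℝ :=
  ∑' m : ℕ, (Real.exp (-t) * t ^ m / m.factorial) * c.hitSurv i j m

/-- `E_j τ_i` -/
def hitMean (c : BDChain n) (i j : Fin (n + 1)) : ℝ :=
  ∑' m : ℕ, c.hitSurv i j m

/-- `Var_j τ_i` -/
def hitVar (c : BDChain n) (i j : Fin (n + 1)) : ℝ :=
  (∑' m : ℕ, (2 * (m : ℝ) + 1) * c.hitSurv i j m) - (c.hitMean i j) ^ 2

/-- `E_j τ̃_i` -/
def hitMeanC (c : BDChain n) (i j : Fin (n + 1)) : ℝ :=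
  ∫ t in Set.Ioi (0 : ℝ), c.hitSurvC i j t

/-- `Var_j τ̃_i` -/
def hitVarC (c : BDChain n) (i j : Fin (n + 1)) : ℝ :=
  (∫ t in Set.Ioi (0 : ℝ), 2 * t * c.hitSurvC i j t) - (c.hitMeanC i j) ^ 2

/-- The substochastic matrix of the chain killed at states `i` and `k`. -/
def killed2 (c : BDChain n) (i k : Fin (n + 1)) : Matrix (Fin (n + 1)) (Fin (n + 1)) ℝ :=
  Matrix.of fun x y => if x = i ∨ x = k ∨ y = i ∨ y = k then 0 else c.K x y

/-- `P_j(min{τ_i, τ_k} > m)` -/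
def hitSurv2 (c : BDChain n) (i k j : Fin (n + 1)) (m : ℕ) : ℝ :=
  if j = i ∨ j = k then 0 else ∑ y, (c.killed2 i k ^ m) j y

/-- `E_j min{τ_i, τ_k}` -/
def hitMean2 (c : BDChain n) (i k j : Fin (n + 1)) : ℝ :=
  ∑' m : ℕ, c.hitSurv2 i k j m

/-- `E_j min{τ̃_i, τ̃_k}` -/
def hitMean2C (c : BDChain n) (i k j : Fin (n + 1)) : ℝ :=
  ∫ t in Set.Ioi (0 : ℝ),
    ∑' m : ℕ, (Real.exp (-t) * t ^ m / m.factorial) * c.hitSurv2 i k j m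

/-- The continuous-time kernel `H_t(x,y) = e^{-t(I-K)}(x,y)`. -/
def Ht (c : BDChain n) (t : ℝ) (x y : Fin (n + 1)) : ℝ :=
  ∑' m : ℕ, (Real.exp (-t) * t ^ m / m.factorial) * (c.K ^ m) x y

/-- Discrete-time total variation distance from starting state `x` at time `m`. -/
def dTV (c : BDChain n) (x : Fin (n + 1)) (m : ℕ) : ℝ :=
  ⨆ A : Finset (Fin (n + 1)), (∑ y ∈ A, (c.K ^ m) x y - ∑ y ∈ A, c.pi y)

/-- Continuous-time total variation distance from starting state `x` at time `t`. -/
def dTVC (c : BDChain n) (x : Fin (n + 1)) (t : ℝ) : ℝ :=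
  ⨆ A : Finset (Fin (n + 1)), (∑ y ∈ A, c.Ht t x y - ∑ y ∈ A, c.pi y)

/-- Maximum (over starting states) discrete-time total variation distance. -/
def dTVMax (c : BDChain n) (m : ℕ) : ℝ := ⨆ x, c.dTV x m

/-- Maximum (over starting states) continuous-time total variation distance. -/
def dTVMaxC (c : BDChain n) (t : ℝ) : ℝ := ⨆ x, c.dTVC x t

/-- Discrete-time separation from starting state `x` at time `m`. -/
def sep (c : BDChain n) (x : Fin (n + 1)) (m : ℕ) : ℝ :=
  ⨆ y, (1 - (c.K ^ m) x y / c.pi y)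

/-- Continuous-time separation from starting state `x` at time `t`. -/
def sepC (c : BDChain n) (x : Fin (n + 1)) (t : ℝ) : ℝ :=
  ⨆ y, (1 - c.Ht t x y / c.pi y)

end BDChain

/-- Discrete-time `ε`-mixing time for a distance profile `d`. -/
def mixD (d : ℕ → ℝ) (ε : ℝ) : ℕ := sInf {m : ℕ | d m ≤ ε}

/-- Continuous-time `ε`-mixing time for a distance profile `d`. -/
def mixC (d : ℝ → ℝ) (ε : ℝ) : ℝ := sInf {t : ℝ | 0 ≤ t ∧ d t ≤ ε}

/-- The set of (real) eigenvalues of a square matrix. -/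
def eigSet {ι : Type*} [Fintype ι] (M : Matrix ι ι ℝ) : Set ℝ :=
  {x | ∃ v : ι → ℝ, v ≠ 0 ∧ M.mulVec v = x • v}

/-- `l` is the smallest non-zero eigenvalue of `M`. -/
def IsSmallestNonzeroEig {ι : Type*} [Fintype ι] (M : Matrix ι ι ℝ) (l : ℝ) : Prop :=
  l ∈ eigSet M ∧ l ≠ 0 ∧ ∀ x ∈ eigSet M, x ≠ 0 → l ≤ x

/-- `l` is the smallest eigenvalue of `M`. -/
def IsSmallestEig {ι : Type*} [Fintype ι] (M : Matrix ι ι ℝ) (l : ℝ) : Prop :=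
  l ∈ eigSet M ∧ ∀ x ∈ eigSet M, l ≤ x

/-- The principal submatrix of `I - K` indexed by the states `0, 1, ..., M-1`. -/
def BDChain.subIK {n : ℕ} (c : BDChain n) (M : Fin (n + 1)) :
    Matrix (Fin (M : ℕ)) (Fin (M : ℕ)) ℝ :=
  Matrix.of fun a b =>
    (1 - c.K) (Fin.castLE M.isLt.le a) (Fin.castLE M.isLt.le b)

/-- A family of chains, with `ε ↦ n ↦ T ε n` the mixing time profile, presents a cutoff
with cutoff time `t`. -/
def cutoffWith (T : ℝ → ℕ → ℝ) (t : ℕ → ℝ) : Prop :=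
  ∀ ε ∈ Set.Ioo (0 : ℝ) 1, Filter.Tendsto (fun n => T ε n / t n) Filter.atTop (nhds 1)

/-- A family of chains presents a cutoff. -/
def hasCutoff (T : ℝ → ℕ → ℝ) : Prop :=
  ∃ t : ℕ → ℝ, (∀ n, 0 < t n) ∧ cutoffWith T t

/-- A family of chains presents a `(t_n, b_n)` cutoff. -/
def cutoffWindow (T : ℝ → ℕ → ℝ) (t b : ℕ → ℝ) : Prop :=
  (∀ᶠ n in Filter.atTop, 0 < t n) ∧ (∀ᶠ n in Filter.atTop, 0 < b n) ∧
  Filter.Tendsto (fun n => b n / t n) Filter.atTop (nhds 0) ∧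
  ∀ ε ∈ Set.Ioo (0 : ℝ) 1, ∃ C : ℝ, ∀ᶠ n in Filter.atTop, |T ε n - t n| ≤ C * b n

/-- Probability weights on `ℕ`. -/
def IsWt (w : ℕ → ℝ) : Prop := (∀ m, 0 ≤ w m) ∧ HasSum w 1

/-- The average of `a` under the weights `w`. -/
def wavg (w a : ℕ → ℝ) : ℝ := ∑' m, w m * a m

/-- Convolution of weights. -/
def wconv (w v : ℕ → ℝ) (m : ℕ) : ℝ := ∑ p ∈ Finset.HasAntidiagonal.antidiagonal m, w p.1 * v p.2

lemma IsWt.summable {w a : ℕ → ℝ} (hw : IsWt w) {C : ℝ} (ha : ∀ m, |a m| ≤ C) :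
    Summable (fun m => w m * a m) := by
  refine Summable.of_norm_bounded (hw.2.summable.mul_right C) fun m => ?_
  rw [Real.norm_eq_abs, abs_mul, abs_of_nonneg (hw.1 m)]
  exact mul_le_mul_of_nonneg_left (ha m) (hw.1 m)

lemma IsWt.wavg_const {w : ℕ → ℝ} (hw : IsWt w) (C : ℝ) : wavg w (fun _ => C) = C := by
  simp [wavg, tsum_mul_right, hw.2.tsum_eq]

lemma IsWt.wavg_mono {w a b : ℕ → ℝ} (hw : IsWt w) {C C' : ℝ} (ha : ∀ m, |a m| ≤ C)
    (hb : ∀ m, |b m| ≤ C') (h : ∀ m, a m ≤ b m) : wavg w a ≤ wavg w b :=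
  (hw.summable ha).tsum_le_tsum (fun m => mul_le_mul_of_nonneg_left (h m) (hw.1 m))
    (hw.summable hb)

lemma IsWt.wavg_add {w a b : ℕ → ℝ} (hw : IsWt w) {C C' : ℝ} (ha : ∀ m, |a m| ≤ C)
    (hb : ∀ m, |b m| ≤ C') : wavg w (fun m => a m + b m) = wavg w a + wavg w b := by
  simp only [wavg, mul_add]
  exact (hw.summable ha).tsum_add (hw.summable hb)

lemma wavg_mul_left (w a : ℕ → ℝ) (c : ℝ) : wavg w (fun m => c * a m) = c * wavg w a := by
  simp only [wavg, ← tsum_mul_left]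
  exact tsum_congr fun m => by ring

lemma IsWt.wavg_sub {w a b : ℕ → ℝ} (hw : IsWt w) {C C' : ℝ} (ha : ∀ m, |a m| ≤ C)
    (hb : ∀ m, |b m| ≤ C') : wavg w (fun m => a m - b m) = wavg w a - wavg w b := by
  simp only [wavg, mul_sub]
  exact (hw.summable ha).tsum_sub (hw.summable hb)

lemma IsWt.wavg_sum {ι : Type*} {w : ℕ → ℝ} (hw : IsWt w) (s : Finset ι) {a : ι → ℕ → ℝ}
    {C : ι → ℝ} (ha : ∀ i m, |a i m| ≤ C i) :
    wavg w (fun m => ∑ i ∈ s, a i m) = ∑ i ∈ s, wavg w (a i) := by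
  simp only [wavg, Finset.mul_sum]
  exact Summable.tsum_finsetSum fun i _ => hw.summable (ha i)

lemma IsWt.wavg_nonneg {w a : ℕ → ℝ} (hw : IsWt w) (ha : ∀ m, 0 ≤ a m) : 0 ≤ wavg w a :=
  tsum_nonneg fun m => mul_nonneg (hw.1 m) (ha m)

lemma IsWt.wavg_le {w a : ℕ → ℝ} (hw : IsWt w) {C C' : ℝ} (ha : ∀ m, |a m| ≤ C)
    (h : ∀ m, a m ≤ C') : wavg w a ≤ C' := by
  rw [← hw.wavg_const C']
  exact hw.wavg_mono ha (fun _ => le_rfl) h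

lemma IsWt.le_wavg {w a : ℕ → ℝ} (hw : IsWt w) {C C' : ℝ} (ha : ∀ m, |a m| ≤ C)
    (h : ∀ m, C' ≤ a m) : C' ≤ wavg w a := by
  rw [← hw.wavg_const C']
  exact hw.wavg_mono (fun _ => le_rfl) ha h

lemma IsWt.abs_wavg_le {w a : ℕ → ℝ} (hw : IsWt w) {C : ℝ} (ha : ∀ m, |a m| ≤ C) :
    |wavg w a| ≤ C :=
  abs_le.2 ⟨hw.le_wavg ha fun m => (abs_le.1 (ha m)).1, hw.wavg_le ha fun m => (abs_le.1 (ha m)).2⟩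

lemma IsWt.summable_prod {w v : ℕ → ℝ} (hw : IsWt w) (hv : IsWt v) {a : ℕ × ℕ → ℝ} {C : ℝ}
    (ha : ∀ m, |a m| ≤ C) : Summable (fun p : ℕ × ℕ => w p.1 * v p.2 * a p) := by
  refine Summable.of_norm_bounded
    ((hw.2.summable.mul_of_nonneg hv.2.summable hw.1 hv.1).mul_right C) fun p => ?_
  have := mul_nonneg (hw.1 p.1) (hv.1 p.2)
  rw [Real.norm_eq_abs, abs_mul, abs_of_nonneg this]
  exact mul_le_mul_of_nonneg_left (ha p) this

lemma IsWt.wavg_wconv {w v a : ℕ → ℝ} (hw : IsWt w) (hv : IsWt v) {C : ℝ}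
    (ha : ∀ m, |a m| ≤ C) :
    wavg (wconv w v) a = wavg w (fun i => wavg v (fun j => a (i + j))) := by
  have hs := hw.summable_prod hv (a := fun p => a (p.1 + p.2)) (fun p => ha _)
  have h1 : ∑' p : ℕ × ℕ, w p.1 * v p.2 * a (p.1 + p.2)
      = wavg w (fun i => wavg v (fun j => a (i + j))) := by
    rw [hs.tsum_prod]
    simp only [wavg, ← tsum_mul_left, mul_assoc]
  rw [← h1, ← Finset.HasAntidiagonal.sigmaAntidiagonalEquivProd.tsum_eq, Summable.tsum_sigma']
  · refine tsum_congr fun m => ?_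
    rw [tsum_fintype, wconv, Finset.sum_mul, ← Finset.sum_coe_sort]
    refine Finset.sum_congr rfl fun p _ => ?_
    have := Finset.HasAntidiagonal.mem_antidiagonal.1 p.2
    simp [Finset.HasAntidiagonal.sigmaAntidiagonalEquivProd, this]
  · intro b; exact (hasSum_fintype _).summable
  · exact (Finset.HasAntidiagonal.sigmaAntidiagonalEquivProd.summable_iff (f := fun p : ℕ × ℕ =>
      w p.1 * v p.2 * a (p.1 + p.2))).2 hs

lemma IsWt.conv {w v : ℕ → ℝ} (hw : IsWt w) (hv : IsWt v) : IsWt (wconv w v) := by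
  refine ⟨fun m => Finset.sum_nonneg fun p _ => mul_nonneg (hw.1 _) (hv.1 _), ?_⟩
  have h := hw.wavg_wconv hv (a := fun _ => 1) (C := 1) (by simp)
  rw [show (fun i : ℕ => wavg v (fun j => (1:ℝ))) = fun _ => 1 from
    funext fun _ => hv.wavg_const 1, hw.wavg_const] at h
  have hs : Summable (wconv w v) := by
    have hs := hw.summable_prod hv (a := fun p => 1) (C := 1) (by simp)
    simp only [mul_one] at hs
    unfold wconv
    exact summable_sum_mul_antidiagonal_of_summable_mul hs
  have h2 : ∑' m, wconv w v m = 1 := by simpa [wavg] using h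
  exact h2 ▸ hs.hasSum

lemma isWt_single (k : ℕ) : IsWt (Pi.single k 1) := by
  refine ⟨fun m => ?_, hasSum_pi_single k 1⟩
  by_cases h : m = k
  · subst h; simp
  · simp [h]

lemma wavg_single (k : ℕ) (a : ℕ → ℝ) : wavg (Pi.single k (1 : ℝ)) a = a k := by
  unfold wavg
  rw [tsum_eq_single k (fun m h => by simp [h])]
  simp

lemma wconv_single (j k : ℕ) :
    wconv (Pi.single j 1) (Pi.single k 1) = Pi.single (j + k) 1 := by
  funext m
  unfold wconv
  by_cases h : m = j + k
  · subst h
    rw [Finset.sum_eq_single (j, k)]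
    · simp
    · rintro ⟨a, b⟩ hab hne
      simp only
      by_cases ha : a = j
      · by_cases hb : b = k
        · exact absurd (by rw [ha, hb]) hne
        · simp [hb]
      · simp [ha]
    · simp
  · rw [Pi.single_eq_of_ne h]
    refine Finset.sum_eq_zero ?_
    rintro ⟨a, b⟩ hab
    have := Finset.HasAntidiagonal.mem_antidiagonal.1 hab
    simp only at this ⊢
    by_cases ha : a = j
    · by_cases hb : b = k
      · exact absurd (by omega) h
      · simp [hb]
    · simp [ha]

/-- Substochastic matrices. -/
structure SubSt {ι : Type*} [Fintype ι] (A : Matrix ι ι ℝ) : Prop where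
  nonneg : ∀ i j, 0 ≤ A i j
  row : ∀ i, ∑ j, A i j ≤ 1

section SubSt
variable {ι : Type*} [Fintype ι]

lemma SubSt.mulVec_mono {A : Matrix ι ι ℝ} (hA : SubSt A) {f g : ι → ℝ} (h : ∀ x, f x ≤ g x)
    (x : ι) : (A *ᵥ f) x ≤ (A *ᵥ g) x :=
  Finset.sum_le_sum fun y _ => mul_le_mul_of_nonneg_left (h y) (hA.nonneg x y)

lemma SubSt.mulVec_nonneg {A : Matrix ι ι ℝ} (hA : SubSt A) {f : ι → ℝ} (h : ∀ x, 0 ≤ f x)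
    (x : ι) : 0 ≤ (A *ᵥ f) x :=
  Finset.sum_nonneg fun y _ => mul_nonneg (hA.nonneg x y) (h y)

lemma SubSt.abs_mulVec_le {A : Matrix ι ι ℝ} (hA : SubSt A) {f : ι → ℝ} {C : ℝ}
    (h : ∀ x, |f x| ≤ C) (x : ι) : |(A *ᵥ f) x| ≤ C := by
  have hC : 0 ≤ C := (abs_nonneg _).trans (h x)
  calc |(A *ᵥ f) x| ≤ ∑ y, |A x y * f y| := Finset.abs_sum_le_sum_abs _ _
    _ ≤ ∑ y, A x y * C := Finset.sum_le_sum fun y _ => by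
        rw [abs_mul, abs_of_nonneg (hA.nonneg x y)]
        exact mul_le_mul_of_nonneg_left (h y) (hA.nonneg x y)
    _ = (∑ y, A x y) * C := by rw [Finset.sum_mul]
    _ ≤ 1 * C := mul_le_mul_of_nonneg_right (hA.row x) hC
    _ = C := one_mul C

lemma exists_abs_bound (f : ι → ℝ) : ∃ C, ∀ x, |f x| ≤ C :=
  ⟨∑ x, |f x|, fun x => Finset.single_le_sum (f := fun x => |f x|)
    (fun _ _ => abs_nonneg _) (Finset.mem_univ x)⟩

variable [DecidableEq ι]

lemma SubSt.pow {A : Matrix ι ι ℝ} (hA : SubSt A) (m : ℕ) : SubSt (A ^ m) := by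
  induction m with
  | zero =>
    refine ⟨fun i j => ?_, fun i => ?_⟩
    · rw [pow_zero, Matrix.one_apply]; split_ifs <;> norm_num
    · simp [Matrix.one_apply]
  | succ m ih =>
    refine ⟨fun i j => ?_, fun i => ?_⟩
    · rw [pow_succ, Matrix.mul_apply]
      exact Finset.sum_nonneg fun k _ => mul_nonneg (ih.nonneg _ _) (hA.nonneg _ _)
    · simp only [pow_succ, Matrix.mul_apply]
      rw [Finset.sum_comm]
      simp only [← Finset.mul_sum]
      exact (Finset.sum_le_sum fun k _ => mul_le_of_le_one_right (ih.nonneg i k) (hA.row k)).trans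
        (ih.row i)

lemma pow_mulVec_one {A : Matrix ι ι ℝ} (hA : ∀ i, ∑ j, A i j = 1) (m : ℕ) (C : ℝ) (x : ι) :
    ((A ^ m) *ᵥ fun _ => C) x = C := by
  induction m generalizing x with
  | zero => simp
  | succ m ih =>
    rw [pow_succ', ← Matrix.mulVec_mulVec, show (A ^ m *ᵥ fun _ => C) = fun _ => C from funext ih]
    simp [Matrix.mulVec, dotProduct, ← Finset.sum_mul, hA]

/-- The weighted average of the powers of `A`, as an operator on functions. -/
def avgOp (A : Matrix ι ι ℝ) (w : ℕ → ℝ) (f : ι → ℝ) (x : ι) : ℝ :=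
  wavg w (fun m => ((A ^ m) *ᵥ f) x)

lemma SubSt.exists_pow_bound {A : Matrix ι ι ℝ} (hA : SubSt A) (f : ι → ℝ) :
    ∃ C, ∀ x m, |((A ^ m) *ᵥ f) x| ≤ C := by
  obtain ⟨C, hC⟩ := exists_abs_bound f
  exact ⟨C, fun x m => (hA.pow m).abs_mulVec_le hC x⟩

lemma avgOp_mono {A : Matrix ι ι ℝ} (hA : SubSt A) {w : ℕ → ℝ} (hw : IsWt w) {f g : ι → ℝ}
    (h : ∀ x, f x ≤ g x) (x : ι) : avgOp A w f x ≤ avgOp A w g x := by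
  obtain ⟨C, hC⟩ := hA.exists_pow_bound f
  obtain ⟨C', hC'⟩ := hA.exists_pow_bound g
  exact hw.wavg_mono (hC x) (hC' x) fun m => (hA.pow m).mulVec_mono h x

lemma avgOp_const {A : Matrix ι ι ℝ} (hA : ∀ i, ∑ j, A i j = 1) {w : ℕ → ℝ} (hw : IsWt w)
    (C : ℝ) (x : ι) : avgOp A w (fun _ => C) x = C := by
  unfold avgOp
  simp only [pow_mulVec_one hA]
  exact hw.wavg_const C

lemma avgOp_nonneg {A : Matrix ι ι ℝ} (hA : SubSt A) {w : ℕ → ℝ} (hw : IsWt w) {f : ι → ℝ}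
    (h : ∀ x, 0 ≤ f x) (x : ι) : 0 ≤ avgOp A w f x :=
  hw.wavg_nonneg fun m => (hA.pow m).mulVec_nonneg h x

lemma avgOp_add {A : Matrix ι ι ℝ} (hA : SubSt A) {w : ℕ → ℝ} (hw : IsWt w) (f g : ι → ℝ)
    (x : ι) : avgOp A w (fun y => f y + g y) x = avgOp A w f x + avgOp A w g x := by
  obtain ⟨C, hC⟩ := hA.exists_pow_bound f
  obtain ⟨C', hC'⟩ := hA.exists_pow_bound g
  unfold avgOp
  rw [← hw.wavg_add (hC x) (hC' x)]
  congr 1; funext m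
  rw [show (fun y => f y + g y) = f + g from rfl, Matrix.mulVec_add]; rfl

lemma avgOp_smul (A : Matrix ι ι ℝ) (w : ℕ → ℝ) (c : ℝ) (f : ι → ℝ)
    (x : ι) : avgOp A w (fun y => c * f y) x = c * avgOp A w f x := by
  unfold avgOp
  rw [← wavg_mul_left]
  congr 1; funext m
  rw [show (fun y => c * f y) = c • f from rfl, Matrix.mulVec_smul]; rfl

lemma avgOp_sub {A : Matrix ι ι ℝ} (hA : SubSt A) {w : ℕ → ℝ} (hw : IsWt w) (f g : ι → ℝ)
    (x : ι) : avgOp A w (fun y => f y - g y) x = avgOp A w f x - avgOp A w g x := by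
  have h := avgOp_add hA hw f (fun y => (-1) * g y) x
  rw [avgOp_smul] at h
  rw [show (fun y => f y - g y) = fun y => f y + (-1) * g y from funext fun y => by ring, h]
  ring

lemma mulVec_avgOp {A B : Matrix ι ι ℝ} (hA : SubSt A) {w : ℕ → ℝ} (hw : IsWt w) (f : ι → ℝ)
    (x : ι) : (B *ᵥ avgOp A w f) x = wavg w (fun m => ((B * A ^ m) *ᵥ f) x) := by
  obtain ⟨C, hC⟩ := hA.exists_pow_bound f
  have : ∀ m, ((B * A ^ m) *ᵥ f) x = ∑ y, B x y * ((A ^ m) *ᵥ f) y := fun m => by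
    rw [← Matrix.mulVec_mulVec]; rfl
  simp only [this]
  rw [hw.wavg_sum Finset.univ (C := fun y => |B x y| * C) (fun y m => by
    rw [abs_mul]; exact mul_le_mul_of_nonneg_left (hC y m) (abs_nonneg _))]
  simp only [wavg_mul_left]
  rfl

lemma avgOp_wconv {A : Matrix ι ι ℝ} (hA : SubSt A) {w v : ℕ → ℝ} (hw : IsWt w) (hv : IsWt v)
    (f : ι → ℝ) (x : ι) : avgOp A (wconv w v) f x = avgOp A w (avgOp A v f) x := by
  obtain ⟨C, hC⟩ := hA.exists_pow_bound f
  rw [avgOp, hw.wavg_wconv hv (hC x), avgOp]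
  congr 1; funext i
  rw [mulVec_avgOp hA hv]
  simp only [pow_add]

lemma mulVec_avgOp_comm {A : Matrix ι ι ℝ} (hA : SubSt A) {w : ℕ → ℝ} (hw : IsWt w) (f : ι → ℝ)
    (x : ι) : (A *ᵥ avgOp A w f) x = avgOp A w (A *ᵥ f) x := by
  rw [mulVec_avgOp hA hw, avgOp]
  congr 1; funext m
  rw [Matrix.mulVec_mulVec, ← pow_succ, ← pow_succ']

end SubSt

namespace BDChain
variable {n : ℕ} (c : BDChain n)

lemma subSt : SubSt c.K := ⟨c.K_nonneg, fun i => (c.K_rowSum i).le⟩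

/-- The expectation under the stationary distribution. -/
def ev (f : Fin (n + 1) → ℝ) : ℝ := ∑ x, c.pi x * f x

lemma ev_mono {f g : Fin (n + 1) → ℝ} (h : ∀ x, f x ≤ g x) : c.ev f ≤ c.ev g :=
  Finset.sum_le_sum fun x _ => mul_le_mul_of_nonneg_left (h x) (c.pi_pos x).le

lemma ev_const (C : ℝ) : c.ev (fun _ => C) = C := by
  simp [ev, ← Finset.sum_mul, c.pi_sum]

lemma ev_add (f g : Fin (n + 1) → ℝ) : c.ev (fun x => f x + g x) = c.ev f + c.ev g := by
  simp [ev, mul_add, Finset.sum_add_distrib]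

lemma ev_sub (f g : Fin (n + 1) → ℝ) : c.ev (fun x => f x - g x) = c.ev f - c.ev g := by
  simp [ev, mul_sub, Finset.sum_sub_distrib]

lemma ev_smul (a : ℝ) (f : Fin (n + 1) → ℝ) : c.ev (fun x => a * f x) = a * c.ev f := by
  simp only [ev, Finset.mul_sum]
  exact Finset.sum_congr rfl fun _ _ => by ring

lemma ev_nonneg {f : Fin (n + 1) → ℝ} (h : ∀ x, 0 ≤ f x) : 0 ≤ c.ev f :=
  Finset.sum_nonneg fun x _ => mul_nonneg (c.pi_pos x).le (h x)

lemma ev_mulVec (f : Fin (n + 1) → ℝ) : c.ev (c.K *ᵥ f) = c.ev f := by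
  simp only [ev, Matrix.mulVec, dotProduct, Finset.mul_sum]
  rw [Finset.sum_comm]
  refine Finset.sum_congr rfl fun y _ => ?_
  rw [← c.pi_stat y, Finset.sum_mul]
  exact Finset.sum_congr rfl fun _ _ => by ring

lemma ev_pow (f : Fin (n + 1) → ℝ) (m : ℕ) : c.ev ((c.K ^ m) *ᵥ f) = c.ev f := by
  induction m with
  | zero => simp
  | succ m ih => rw [pow_succ', ← Matrix.mulVec_mulVec, ev_mulVec, ih]

lemma ev_avgOp {w : ℕ → ℝ} (hw : IsWt w) (f : Fin (n + 1) → ℝ) :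
    c.ev (avgOp c.K w f) = c.ev f := by
  obtain ⟨C, hC⟩ := c.subSt.exists_pow_bound f
  unfold ev avgOp
  simp only [← wavg_mul_left]
  rw [← hw.wavg_sum Finset.univ (C := fun x => c.pi x * C) (fun x m => by
    rw [abs_mul, abs_of_pos (c.pi_pos x)]
    exact mul_le_mul_of_nonneg_left (hC x m) (c.pi_pos x).le)]
  have : (fun m => ∑ i, c.pi i * ((c.K ^ m) *ᵥ f) i) = fun _ => c.ev f :=
    funext fun m => c.ev_pow f m
  rw [this, hw.wavg_const]
  rfl

/-- Total variation distance from `π` of the chain run for a `w`-distributed number of steps. -/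
def tvw (w : ℕ → ℝ) (x : Fin (n + 1)) : ℝ :=
  ⨆ A : Finset (Fin (n + 1)),
    (∑ y ∈ A, wavg w (fun m => (c.K ^ m) x y) - ∑ y ∈ A, c.pi y)

lemma pow_entry_bound (x y : Fin (n + 1)) (m : ℕ) : |(c.K ^ m) x y| ≤ 1 := by
  have h := c.subSt.pow m
  rw [abs_of_nonneg (h.nonneg _ _)]
  exact (Finset.single_le_sum (f := fun y => (c.K ^ m) x y) (fun y _ => h.nonneg x y)
    (Finset.mem_univ y)).trans (h.row x)

lemma avgOp_eq_sum {w : ℕ → ℝ} (hw : IsWt w) (f : Fin (n + 1) → ℝ) (x : Fin (n + 1)) :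
    avgOp c.K w f x = ∑ y, wavg w (fun m => (c.K ^ m) x y) * f y := by
  unfold avgOp
  simp only [Matrix.mulVec, dotProduct]
  rw [hw.wavg_sum Finset.univ (C := fun y => |f y|) (fun y m => by
    rw [abs_mul]; exact mul_le_of_le_one_left (abs_nonneg _) (c.pow_entry_bound x y m))]
  refine Finset.sum_congr rfl fun y _ => ?_
  rw [mul_comm, ← wavg_mul_left]
  simp only [mul_comm]

lemma tvw_term {w : ℕ → ℝ} (hw : IsWt w) (x : Fin (n + 1)) (A : Finset (Fin (n + 1))) :
    ∑ y ∈ A, wavg w (fun m => (c.K ^ m) x y) - ∑ y ∈ A, c.pi y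
      = avgOp c.K w (fun y => if y ∈ A then 1 else 0) x
        - c.ev (fun y => if y ∈ A then 1 else 0) := by
  rw [avgOp_eq_sum _ hw, ev]
  simp [Finset.sum_ite_mem]

lemma tvw_le {w : ℕ → ℝ} (hw : IsWt w) {x : Fin (n + 1)} {B : ℝ}
    (h : ∀ f : Fin (n + 1) → ℝ, (∀ y, 0 ≤ f y) → (∀ y, f y ≤ 1) →
      avgOp c.K w f x - c.ev f ≤ B) : c.tvw w x ≤ B := by
  refine ciSup_le fun A => ?_
  rw [c.tvw_term hw]
  refine h _ (fun y => ?_) (fun y => ?_) <;> · split_ifs <;> norm_num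

lemma le_tvw {w : ℕ → ℝ} (hw : IsWt w) (x : Fin (n + 1)) {f : Fin (n + 1) → ℝ}
    (h0 : ∀ y, 0 ≤ f y) (h1 : ∀ y, f y ≤ 1) : avgOp c.K w f x - c.ev f ≤ c.tvw w x := by
  classical
  have h := le_ciSup (f := fun A : Finset (Fin (n + 1)) =>
    (∑ y ∈ A, wavg w (fun m => (c.K ^ m) x y) - ∑ y ∈ A, c.pi y)) (Set.finite_range _).bddAbove
    (Finset.univ.filter fun y => c.pi y ≤ wavg w (fun m => (c.K ^ m) x y))
  refine le_trans ?_ h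
  rw [avgOp_eq_sum _ hw, ev, ← Finset.sum_sub_distrib, ← Finset.sum_sub_distrib,
    Finset.sum_filter]
  refine Finset.sum_le_sum fun y _ => ?_
  have := h0 y; have := h1 y
  split_ifs with hy
  · nlinarith
  · push Not at hy; nlinarith

lemma tvw_nonneg (w : ℕ → ℝ) (x : Fin (n + 1)) : 0 ≤ c.tvw w x := by
  have h := le_ciSup (f := fun A : Finset (Fin (n + 1)) =>
    (∑ y ∈ A, wavg w (fun m => (c.K ^ m) x y) - ∑ y ∈ A, c.pi y)) (Set.finite_range _).bddAbove ∅
  unfold tvw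
  simpa using h

lemma avgOp_le_one {w : ℕ → ℝ} (hw : IsWt w) {f : Fin (n + 1) → ℝ}
    (h1 : ∀ y, f y ≤ 1) (x : Fin (n + 1)) : avgOp c.K w f x ≤ 1 :=
  (avgOp_mono c.subSt hw h1 x).trans_eq (avgOp_const c.K_rowSum hw 1 x)

lemma tvw_le_one {w : ℕ → ℝ} (hw : IsWt w) (x : Fin (n + 1)) : c.tvw w x ≤ 1 :=
  c.tvw_le hw fun f h0 h1 => by
    have := c.avgOp_le_one hw h1 x
    have := c.ev_nonneg h0
    linarith

lemma tvw_wconv_le {w v : ℕ → ℝ} (hw : IsWt w) (hv : IsWt v) (x : Fin (n + 1)) :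
    c.tvw (wconv w v) x ≤ c.tvw w x :=
  c.tvw_le (hw.conv hv) fun f h0 h1 => by
    rw [avgOp_wconv c.subSt hw hv, ← c.ev_avgOp hv f]
    exact c.le_tvw hw x (avgOp_nonneg c.subSt hv h0) (c.avgOp_le_one hv h1)

end BDChain

/-- The probability that two chains moving alternately have not met after `s` rounds, where the
lower one moves first; positions are compared through the height `h`. -/
def crossU {ι : Type*} [Fintype ι] (K : Matrix ι ι ℝ) (h : ι → ℤ) : ℕ → ι → ι → ℝ
  | 0 => fun x y => if h x < h y then 1 else 0
  | s + 1 => fun x y => if h x < h y then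
      ∑ x', K x x' * (if h x' < h y then ∑ y', K y y' * crossU K h s x' y' else 0) else 0

section Cross
variable {ι : Type*} [Fintype ι] {K : Matrix ι ι ℝ} {h : ι → ℤ}

lemma sum_mul_le_one (hK : SubSt K) (x : ι) {g : ι → ℝ} (hg : ∀ y, g y ≤ 1) :
    ∑ y, K x y * g y ≤ 1 :=
  (Finset.sum_le_sum fun y _ => mul_le_of_le_one_right (hK.nonneg x y) (hg y)).trans (hK.row x)

lemma crossU_nonneg (hK : SubSt K) (s : ℕ) (x y : ι) : 0 ≤ crossU K h s x y := by
  induction s generalizing x y with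
  | zero => simp only [crossU]; split_ifs <;> norm_num
  | succ s ih =>
    simp only [crossU]
    split_ifs
    · refine Finset.sum_nonneg fun x' _ => mul_nonneg (hK.nonneg _ _) ?_
      split_ifs
      · exact Finset.sum_nonneg fun y' _ => mul_nonneg (hK.nonneg _ _) (ih _ _)
      · exact le_rfl
    · exact le_rfl

lemma crossU_le (hK : SubSt K) (s : ℕ) (x y : ι) :
    crossU K h s x y ≤ if h x < h y then 1 else 0 := by
  induction s generalizing x y with
  | zero => simp only [crossU]; exact le_rfl
  | succ s ih =>
    simp only [crossU]
    split_ifs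
    · refine sum_mul_le_one hK x fun x' => ?_
      split_ifs
      · exact sum_mul_le_one hK y fun y' => (ih _ _).trans (by split_ifs <;> norm_num)
      · exact zero_le_one
    · exact le_rfl

variable [DecidableEq ι]

lemma mulVec_pow_sub_le (hK : SubSt K) {ψ : ι → ℝ} {ω : ℝ}
    (hω : ∀ x, |(K *ᵥ ψ) x - ψ x| ≤ ω) (s : ℕ) (x : ι) :
    ((K ^ s) *ᵥ ψ) x - ((K ^ (s + 1)) *ᵥ ψ) x ≤ ω := by
  have h1 := (hK.pow s).abs_mulVec_le (f := ψ - K *ᵥ ψ) (C := ω)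
    (fun y => by rw [Pi.sub_apply, abs_sub_comm]; exact hω y) x
  rw [Matrix.mulVec_sub, Matrix.mulVec_mulVec, ← pow_succ] at h1
  exact (le_abs_self _).trans h1

lemma pow_sub_le_crossU (hK : SubSt K) (hrow : ∀ x, ∑ y, K x y = 1)
    (hinj : Function.Injective h) (hskip : ∀ x y, K x y ≠ 0 → |h x - h y| ≤ 1)
    {ψ : ι → ℝ} {ω : ℝ} (h0 : ∀ y, 0 ≤ ψ y) (h1 : ∀ y, ψ y ≤ 1)
    (hω : ∀ x, |(K *ᵥ ψ) x - ψ x| ≤ ω) (s : ℕ) (x y : ι) (hxy : h x ≤ h y) :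
    ((K ^ s) *ᵥ ψ) x - ((K ^ s) *ᵥ ψ) y ≤ crossU K h s x y + ω := by
  have hω0 : 0 ≤ ω := (abs_nonneg _).trans (hω x)
  induction s generalizing x y with
  | zero =>
    rcases hxy.lt_or_eq with hlt | heq
    · simp only [crossU, if_pos hlt, pow_zero, Matrix.one_mulVec]
      linarith [h1 x, h0 y]
    · rw [hinj heq]
      have := crossU_nonneg (h := h) hK 0 y y
      linarith
  | succ s ih =>
    rcases hxy.lt_or_eq with hlt | heq
    · simp only [crossU, if_pos hlt]
      have e : ∀ (z : ι), ((K ^ (s + 1)) *ᵥ ψ) z = ∑ z', K z z' * ((K ^ s) *ᵥ ψ) z' := fun z => by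
        rw [pow_succ', ← Matrix.mulVec_mulVec]; rfl
      have key : ∀ x', K x x' * (((K ^ s) *ᵥ ψ) x' - ((K ^ (s + 1)) *ᵥ ψ) y) ≤
          K x x' * ((if h x' < h y then ∑ y', K y y' * crossU K h s x' y' else 0) + ω) := by
        intro x'
        by_cases hx' : K x x' = 0
        · simp [hx']
        refine mul_le_mul_of_nonneg_left ?_ (hK.nonneg _ _)
        have hd := abs_le.1 (hskip x x' hx')
        rcases lt_or_ge (h x') (h y) with hl | hg
        · rw [if_pos hl, e y]
          have : ((K ^ s) *ᵥ ψ) x' = ∑ y', K y y' * ((K ^ s) *ᵥ ψ) x' := by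
            rw [← Finset.sum_mul, hrow, one_mul]
          have hw : ω = ∑ y', K y y' * ω := by rw [← Finset.sum_mul, hrow, one_mul]
          rw [this, ← Finset.sum_sub_distrib]
          conv_rhs => rw [hw]
          rw [← Finset.sum_add_distrib]
          refine Finset.sum_le_sum fun y' _ => ?_
          by_cases hy' : K y y' = 0
          · simp [hy']
          have hd' := abs_le.1 (hskip y y' hy')
          rw [← mul_sub, ← mul_add]
          exact mul_le_mul_of_nonneg_left (ih x' y' (by omega)) (hK.nonneg _ _)
        · have : x' = y := hinj (by omega)
          rw [if_neg (by omega), this, zero_add]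
          exact mulVec_pow_sub_le hK hω s y
      have e1 : ((K ^ (s + 1)) *ᵥ ψ) x - ((K ^ (s + 1)) *ᵥ ψ) y =
          ∑ x', K x x' * (((K ^ s) *ᵥ ψ) x' - ((K ^ (s + 1)) *ᵥ ψ) y) := by
        simp only [mul_sub, Finset.sum_sub_distrib, ← Finset.sum_mul, hrow, one_mul, e x]
      rw [e1]
      refine (Finset.sum_le_sum fun x' _ => key x').trans_eq ?_
      simp only [mul_add, Finset.sum_add_distrib, ← Finset.sum_mul, hrow, one_mul]
    · rw [hinj heq]
      have := crossU_nonneg (h := h) hK (s + 1) y y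
      linarith

/-- Survival probabilities of the chain killed at `M`. -/
structure IsSurv (K : Matrix ι ι ℝ) (M : ι) (S : ℕ → ι → ℝ) : Prop where
  zero : ∀ x, x ≠ M → S 0 x = 1
  self : ∀ m, S m M = 0
  succ : ∀ m x, x ≠ M → S (m + 1) x = ∑ y, K x y * S m y

lemma sum_crossU_le (hK : SubSt K) (hrow : ∀ x, ∑ y, K x y = 1)
    (hinj : Function.Injective h) (hskip : ∀ x y, K x y ≠ 0 → |h x - h y| ≤ 1)
    {M : ι} {S : ℕ → ι → ℝ} (hS : IsSurv K M S) {B : ℝ} (s : ℕ) (x : ι) (hx : h x ≤ h M)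
    (μ : ι → ℝ) (hμ : ∀ y, 0 ≤ μ y) (hμ1 : ∑ y, μ y ≤ 1)
    (hB : ∀ k, ∑ y, (μ ᵥ* (K ^ k)) y * (if h M < h y then 1 else 0) ≤ B) :
    ∑ y, μ y * crossU K h s x y ≤ S s x + (1 - S s x) * B := by
  have base : ∀ (s : ℕ) (μ : ι → ℝ), (∀ y, 0 ≤ μ y) →
      (∀ k, ∑ y, (μ ᵥ* (K ^ k)) y * (if h M < h y then 1 else 0) ≤ B) →
      ∑ y, μ y * crossU K h s M y ≤ S s M + (1 - S s M) * B := by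
    intro s μ hμ hB
    rw [hS.self, sub_zero, one_mul, zero_add]
    refine le_trans ?_ (hB 0)
    rw [pow_zero, Matrix.vecMul_one]
    exact Finset.sum_le_sum fun y _ => mul_le_mul_of_nonneg_left (crossU_le hK s M y) (hμ y)
  induction s generalizing x μ with
  | zero =>
    by_cases hxM : x = M
    · subst hxM; exact base 0 μ hμ hB
    · rw [hS.zero x hxM, sub_self, zero_mul, add_zero]
      refine le_trans (Finset.sum_le_sum fun y _ => mul_le_of_le_one_right (hμ y) ?_) hμ1
      exact (crossU_le hK 0 x y).trans (by split_ifs <;> norm_num)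
  | succ s ih =>
    by_cases hxM : x = M
    · subst hxM; exact base (s + 1) μ hμ hB
    have hlt : h x < h M := lt_of_le_of_ne hx fun e => hxM (hinj e)
    have h1 : ∑ y, μ y * crossU K h (s + 1) x y ≤
        ∑ y, μ y * ∑ x', K x x' * ∑ y', K y y' * crossU K h s x' y' := by
      have nn : ∀ x' y, 0 ≤ ∑ y', K y y' * crossU K h s x' y' := fun x' y =>
        Finset.sum_nonneg fun y' _ => mul_nonneg (hK.nonneg _ _) (crossU_nonneg hK _ _ _)
      refine Finset.sum_le_sum fun y _ => mul_le_mul_of_nonneg_left ?_ (hμ y)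
      simp only [crossU]
      split_ifs
      · refine Finset.sum_le_sum fun x' _ => mul_le_mul_of_nonneg_left ?_ (hK.nonneg _ _)
        split_ifs
        · exact le_rfl
        · exact nn _ _
      · exact Finset.sum_nonneg fun x' _ => mul_nonneg (hK.nonneg _ _) (nn _ _)
    have h2 : ∑ y, μ y * ∑ x', K x x' * ∑ y', K y y' * crossU K h s x' y' =
        ∑ x', K x x' * ∑ y', (μ ᵥ* K) y' * crossU K h s x' y' := by
      simp only [Matrix.vecMul, dotProduct, Finset.mul_sum, Finset.sum_mul]
      rw [Finset.sum_comm]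
      refine Finset.sum_congr rfl fun x' _ => ?_
      rw [Finset.sum_comm]
      exact Finset.sum_congr rfl fun y' _ => Finset.sum_congr rfl fun y _ => by ring
    have hμ' : ∀ y, 0 ≤ (μ ᵥ* K) y := fun y =>
      Finset.sum_nonneg fun z _ => mul_nonneg (hμ z) (hK.nonneg _ _)
    have hμ1' : ∑ y, (μ ᵥ* K) y ≤ 1 := by
      simp only [Matrix.vecMul, dotProduct]
      rw [Finset.sum_comm]
      simp only [← Finset.mul_sum, hrow, mul_one]
      exact hμ1
    have hB' : ∀ k, ∑ y, ((μ ᵥ* K) ᵥ* (K ^ k)) y * (if h M < h y then 1 else 0) ≤ B := fun k => by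
      rw [Matrix.vecMul_vecMul, ← pow_succ']; exact hB (k + 1)
    refine (h1.trans_eq h2).trans ?_
    have h3 : ∀ x', K x x' * ∑ y', (μ ᵥ* K) y' * crossU K h s x' y' ≤
        K x x' * (S s x' + (1 - S s x') * B) := by
      intro x'
      by_cases hx' : K x x' = 0
      · simp [hx']
      have hd := abs_le.1 (hskip x x' hx')
      exact mul_le_mul_of_nonneg_left (ih x' (by omega) _ hμ' hμ1' hB') (hK.nonneg _ _)
    refine (Finset.sum_le_sum fun x' _ => h3 x').trans_eq ?_
    rw [hS.succ s x hxM]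
    simp only [mul_add, sub_mul, one_mul, mul_sub, Finset.sum_add_distrib, Finset.sum_sub_distrib,
      ← Finset.sum_mul, hrow, ← mul_assoc]

/-- Comparison of two starting distributions of a skip-free chain. -/
lemma crossing_bound (hK : SubSt K) (hrow : ∀ x, ∑ y, K x y = 1)
    (hinj : Function.Injective h) (hskip : ∀ x y, K x y ≠ 0 → |h x - h y| ≤ 1)
    {M : ι} {S : ℕ → ι → ℝ} (hS : IsSurv K M S) {B : ℝ} (x : ι) (hx : h x ≤ h M)
    (μ : ι → ℝ) (hμ : ∀ y, 0 ≤ μ y) (hμ1 : ∑ y, μ y = 1) (hsupp : ∀ y, μ y ≠ 0 → h x ≤ h y)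
    (hB : ∀ k, ∑ y, (μ ᵥ* (K ^ k)) y * (if h M < h y then 1 else 0) ≤ B)
    {ψ : ι → ℝ} {ω : ℝ} (h0 : ∀ y, 0 ≤ ψ y) (h1 : ∀ y, ψ y ≤ 1)
    (hω : ∀ x, |(K *ᵥ ψ) x - ψ x| ≤ ω) (s : ℕ) :
    ((K ^ s) *ᵥ ψ) x - ∑ y, μ y * ((K ^ s) *ᵥ ψ) y ≤ S s x + (1 - S s x) * B + ω := by
  have e : ((K ^ s) *ᵥ ψ) x - ∑ y, μ y * ((K ^ s) *ᵥ ψ) y =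
      ∑ y, μ y * (((K ^ s) *ᵥ ψ) x - ((K ^ s) *ᵥ ψ) y) := by
    simp only [mul_sub, Finset.sum_sub_distrib, ← Finset.sum_mul, hμ1, one_mul]
  rw [e]
  have : ∀ y, μ y * (((K ^ s) *ᵥ ψ) x - ((K ^ s) *ᵥ ψ) y) ≤ μ y * (crossU K h s x y + ω) := by
    intro y
    by_cases hy : μ y = 0
    · simp [hy]
    · exact mul_le_mul_of_nonneg_left
        (pow_sub_le_crossU hK hrow hinj hskip h0 h1 hω s x y (hsupp y hy)) (hμ y)
  refine (Finset.sum_le_sum fun y _ => this y).trans ?_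
  simp only [mul_add, Finset.sum_add_distrib, ← Finset.sum_mul, hμ1, one_mul]
  have := sum_crossU_le hK hrow hinj hskip hS s x hx μ hμ hμ1.le hB
  linarith

end Cross

section Surv
variable {ι : Type*} [Fintype ι] {K : Matrix ι ι ℝ} {h : ι → ℤ} {M : ι} {S : ℕ → ι → ℝ}

lemma IsSurv.nonneg (hK : SubSt K) (hS : IsSurv K M S) (m : ℕ) (x : ι) : 0 ≤ S m x := by
  induction m generalizing x with
  | zero =>
    by_cases hx : x = M
    · rw [hx, hS.self]
    · rw [hS.zero x hx]; exact zero_le_one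
  | succ m ih =>
    by_cases hx : x = M
    · rw [hx, hS.self]
    · rw [hS.succ m x hx]
      exact Finset.sum_nonneg fun y _ => mul_nonneg (hK.nonneg _ _) (ih y)

lemma IsSurv.succ_le (hK : SubSt K) (hS : IsSurv K M S) (m : ℕ) (x : ι) :
    S (m + 1) x ≤ S m x := by
  induction m generalizing x with
  | zero =>
    by_cases hx : x = M
    · rw [hx, hS.self, hS.self]
    · rw [hS.succ _ x hx, hS.zero x hx]
      refine sum_mul_le_one hK x fun y => ?_
      by_cases hy : y = M
      · rw [hy, hS.self]; exact zero_le_one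
      · rw [hS.zero y hy]
  | succ m ih =>
    by_cases hx : x = M
    · rw [hx, hS.self, hS.self]
    · rw [hS.succ (m + 1) x hx, hS.succ m x hx]
      exact Finset.sum_le_sum fun y _ => mul_le_mul_of_nonneg_left (ih y) (hK.nonneg _ _)

lemma IsSurv.anti (hK : SubSt K) (hS : IsSurv K M S) (x : ι) : Antitone (fun m => S m x) :=
  antitone_nat_of_succ_le fun m => hS.succ_le hK m x

lemma IsSurv.le_one (hK : SubSt K) (hS : IsSurv K M S) (m : ℕ) (x : ι) : S m x ≤ 1 := by
  refine (hS.anti hK x (Nat.zero_le m)).trans ?_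
  by_cases hx : x = M
  · simp only [hx, hS.self]; exact zero_le_one
  · simp only [hS.zero x hx]; exact le_rfl

lemma IsSurv.abs_le (hK : SubSt K) (hS : IsSurv K M S) (m : ℕ) (x : ι) : |S m x| ≤ 1 := by
  rw [abs_of_nonneg (hS.nonneg hK m x)]; exact hS.le_one hK m x

/-- Monotonicity of survival in the starting point. -/
lemma IsSurv.mono_start (hK : SubSt K) (hrow : ∀ x, ∑ y, K x y = 1)
    (hinj : Function.Injective h) (hskip : ∀ x y, K x y ≠ 0 → |h x - h y| ≤ 1)
    (hS : IsSurv K M S) {y y' : ι} (hyy : h y ≤ h y') (hy : h y' ≤ h M) (m : ℕ) :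
    S m y' ≤ S m y := by
  suffices H : ∀ k ≤ m, ∀ z, h z ≤ h y' → S m y' ≤ S k z from H m le_rfl y hyy
  intro k
  induction k with
  | zero =>
    intro _ z hz
    by_cases hzM : z = M
    · have : y' = M := hinj (by rw [hzM] at hz; omega)
      rw [this, hzM, hS.self, hS.self]
    · rw [hS.zero z hzM]; exact hS.le_one hK m y'
  | succ k ih =>
    intro hk z hz
    rcases hz.lt_or_eq with hlt | heq
    · have hzM : z ≠ M := fun e => by rw [e] at hlt; omega
      rw [hS.succ k z hzM]
      calc S m y' = ∑ y, K z y * S m y' := by rw [← Finset.sum_mul, hrow, one_mul]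
        _ ≤ _ := Finset.sum_le_sum fun w _ => by
          by_cases hw : K z w = 0
          · simp [hw]
          have := _root_.abs_le.1 (hskip z w hw)
          exact mul_le_mul_of_nonneg_left (ih (by omega) w (by omega)) (hK.nonneg _ _)
    · rw [hinj heq]; exact hS.anti hK y' hk

/-- Survival past an intermediate point. -/
lemma IsSurv.mul_le (hK : SubSt K) (hrow : ∀ x, ∑ y, K x y = 1)
    (hinj : Function.Injective h) (hskip : ∀ x y, K x y ≠ 0 → |h x - h y| ≤ 1)
    (hS : IsSurv K M S) {a : ι} {S' : ℕ → ι → ℝ} (hS' : IsSurv K a S') (ha : h a ≤ h M)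
    (i j : ℕ) {x : ι} (hx : h x ≤ h a) : S' i x * S j a ≤ S (i + j) x := by
  induction i generalizing x with
  | zero =>
    by_cases hxa : x = a
    · rw [hxa, hS'.self, zero_mul]; exact hS.nonneg hK _ _
    · rw [hS'.zero x hxa, one_mul, zero_add]
      exact hS.mono_start hK hrow hinj hskip hx ha j
  | succ i ih =>
    by_cases hxa : x = a
    · rw [hxa, hS'.self, zero_mul]; exact hS.nonneg hK _ _
    · have hlt : h x < h a := lt_of_le_of_ne hx fun e => hxa (hinj e)
      have hxM : x ≠ M := fun e => by rw [e] at hlt; omega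
      rw [hS'.succ i x hxa, add_right_comm, hS.succ _ x hxM, Finset.sum_mul]
      refine Finset.sum_le_sum fun y _ => ?_
      by_cases hy : K x y = 0
      · simp [hy]
      have := _root_.abs_le.1 (hskip x y hy)
      rw [mul_assoc]
      exact mul_le_mul_of_nonneg_left (ih (by omega)) (hK.nonneg _ _)

variable [DecidableEq ι]

lemma pow_succ_mulVec (A : Matrix ι ι ℝ) (m : ℕ) (f : ι → ℝ) (x : ι) :
    ((A ^ (m + 1)) *ᵥ f) x = ∑ y, A x y * ((A ^ m) *ᵥ f) y := by
  rw [pow_succ', ← Matrix.mulVec_mulVec]; rfl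

/-- Survival from the low side keeps the chain below the target. -/
lemma IsSurv.le_pow_ind (hK : SubSt K)
    (hinj : Function.Injective h) (hskip : ∀ x y, K x y ≠ 0 → |h x - h y| ≤ 1)
    (hS : IsSurv K M S) (m : ℕ) {x : ι} (hx : h x ≤ h M) :
    S m x ≤ ((K ^ m) *ᵥ fun y => if h y < h M then 1 else 0) x := by
  have nn : ∀ m x, 0 ≤ ((K ^ m) *ᵥ fun y => if h y < h M then (1 : ℝ) else 0) x := fun m x =>
    (hK.pow m).mulVec_nonneg (fun z => by split_ifs <;> norm_num) x
  induction m generalizing x with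
  | zero =>
    by_cases hxM : x = M
    · rw [hxM, hS.self]; exact nn 0 M
    · rw [hS.zero x hxM, pow_zero, Matrix.one_mulVec,
        if_pos (lt_of_le_of_ne hx fun e => hxM (hinj e))]
  | succ m ih =>
    by_cases hxM : x = M
    · rw [hxM, hS.self]; exact nn _ M
    · have hlt : h x < h M := lt_of_le_of_ne hx fun e => hxM (hinj e)
      rw [hS.succ _ x hxM, pow_succ_mulVec]
      refine Finset.sum_le_sum fun y _ => ?_
      by_cases hy : K x y = 0
      · simp [hy]
      have := _root_.abs_le.1 (hskip x y hy)
      exact mul_le_mul_of_nonneg_left (ih (by omega)) (hK.nonneg _ _)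

lemma IsSurv.add_le (hK : SubSt K) (hrow : ∀ x, ∑ y, K x y = 1)
    (hinj : Function.Injective h) (hskip : ∀ x y, K x y ≠ 0 → |h x - h y| ≤ 1)
    (hS : IsSurv K M S) {a : ι} (i j : ℕ) {x : ι} (hx : h x ≤ h M) :
    S (i + j) x ≤ S j a * S i x + ((K ^ i) *ᵥ fun y => if h y < h a then 1 else 0) x := by
  have nn : ∀ m x, 0 ≤ ((K ^ m) *ᵥ fun y => if h y < h a then (1 : ℝ) else 0) x := fun m x =>
    (hK.pow m).mulVec_nonneg (fun z => by split_ifs <;> norm_num) x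
  induction i generalizing x with
  | zero =>
    by_cases hxM : x = M
    · rw [hxM, hS.self, hS.self, mul_zero, zero_add]; exact nn 0 M
    · rw [hS.zero x hxM, pow_zero, Matrix.one_mulVec, mul_one, zero_add]
      split_ifs with hxa
      · have := hS.le_one hK j x
        have := hS.nonneg hK j a
        linarith
      · rw [add_zero]; exact hS.mono_start hK hrow hinj hskip (not_lt.1 hxa) hx j
  | succ i ih =>
    by_cases hxM : x = M
    · rw [hxM, hS.self, hS.self, mul_zero, zero_add]; exact nn _ M
    · have hlt : h x < h M := lt_of_le_of_ne hx fun e => hxM (hinj e)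
      rw [add_right_comm, hS.succ _ x hxM, hS.succ _ x hxM, pow_succ_mulVec, Finset.mul_sum,
        ← Finset.sum_add_distrib]
      refine Finset.sum_le_sum fun y _ => ?_
      by_cases hy : K x y = 0
      · simp [hy]
      have := _root_.abs_le.1 (hskip x y hy)
      refine (mul_le_mul_of_nonneg_left (ih (x := y) (by omega)) (hK.nonneg _ _)).trans_eq ?_
      ring

lemma IsSurv.pow_le (hK : SubSt K) (hrow : ∀ x, ∑ y, K x y = 1) (hS : IsSurv K M S)
    {φ : ι → ℝ} (h1 : ∀ y, φ y ≤ 1) {D : ℝ} (hD : 0 ≤ D) (hM : ∀ k, ((K ^ k) *ᵥ φ) M ≤ D)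
    (m : ℕ) (x : ι) : ((K ^ m) *ᵥ φ) x ≤ S m x + D := by
  induction m generalizing x with
  | zero =>
    by_cases hx : x = M
    · rw [hx, hS.self, zero_add]; exact hM 0
    · rw [hS.zero x hx, pow_zero, Matrix.one_mulVec]
      linarith [h1 x]
  | succ m ih =>
    by_cases hx : x = M
    · rw [hx, hS.self, zero_add]; exact hM _
    · rw [pow_succ_mulVec, hS.succ m x hx]
      have : D = ∑ y, K x y * D := by rw [← Finset.sum_mul, hrow, one_mul]
      rw [this, ← Finset.sum_add_distrib]
      refine Finset.sum_le_sum fun y _ => ?_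
      rw [← mul_add]
      exact mul_le_mul_of_nonneg_left (ih y) (hK.nonneg _ _)

end Surv

namespace BDChain
variable {n : ℕ} (c : BDChain n)

lemma isSurv_hitSurv (M : Fin (n + 1)) : IsSurv c.K M (fun m x => c.hitSurv M x m) where
  zero x hx := by simp [hitSurv, hx, Matrix.one_apply]
  self m := by simp [hitSurv]
  succ m x hx := by
    simp only [hitSurv, if_neg hx, pow_succ', Matrix.mul_apply]
    rw [Finset.sum_comm]
    refine Finset.sum_congr rfl fun y _ => ?_
    rw [← Finset.mul_sum]
    by_cases hy : y = M
    · simp [killed, hy]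
    · simp [killed, hy, hx]

/-- The height function recording the position of a state. -/
def ht (x : Fin (n + 1)) : ℤ := (x : ℤ)

/-- The height function recording the reversed position of a state. -/
def htR (x : Fin (n + 1)) : ℤ := -(x : ℤ)

lemma ht_inj : Function.Injective (ht (n := n)) := fun x y e => by
  have : (x : ℤ) = y := e
  exact Fin.ext (by exact_mod_cast this)

lemma htR_inj : Function.Injective (htR (n := n)) := fun x y e => by
  have : -(x : ℤ) = -(y : ℤ) := e
  exact Fin.ext (by omega)

lemma ht_skip (x y : Fin (n + 1)) (hxy : c.K x y ≠ 0) : |ht x - ht y| ≤ 1 := by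
  by_contra hc
  exact hxy (c.K_tridiag x y (not_le.1 hc))

lemma htR_skip (x y : Fin (n + 1)) (hxy : c.K x y ≠ 0) : |htR x - htR y| ≤ 1 := by
  have := c.ht_skip x y hxy
  unfold ht at this
  unfold htR
  rw [abs_le] at this ⊢
  omega

lemma ht_le_iff {x y : Fin (n + 1)} : ht x ≤ ht y ↔ x ≤ y := by
  unfold ht; rw [Fin.le_def]; omega

lemma ht_lt_iff {x y : Fin (n + 1)} : ht x < ht y ↔ x < y := by
  unfold ht; rw [Fin.lt_def]; omega

lemma htR_le_iff {x y : Fin (n + 1)} : htR x ≤ htR y ↔ y ≤ x := by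
  unfold htR; rw [Fin.le_def]; omega

lemma htR_lt_iff {x y : Fin (n + 1)} : htR x < htR y ↔ y < x := by
  unfold htR; rw [Fin.lt_def]; omega

end BDChain

namespace BDChain
variable {n : ℕ} (c : BDChain n)

/-- The stationary flux through the cut between `b` and `b + 1`. -/
def flux (b : Fin (n + 1)) : ℝ := c.pi b * ∑ y, c.K b y * (if b < y then 1 else 0)

lemma cut_flux (b x : Fin (n + 1)) :
    c.pi x * ((if b < x then 1 else 0) - ∑ y, c.K x y * (if b < y then 1 else 0)) =
      c.flux b * ((if (x : ℕ) = b + 1 then 1 else 0) - (if x = b then 1 else 0)) := by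
  have far : ∀ z : Fin (n + 1), z ≠ b → (z : ℕ) ≠ b + 1 →
      c.pi z * ((if b < z then 1 else 0) - ∑ y, c.K z y * (if b < y then 1 else 0)) = 0 := by
    intro z hz hz'
    have hz0 : (z : ℕ) ≠ b := fun e => hz (Fin.ext e)
    rcases lt_or_ge b z with h | h
    · have : ∑ y, c.K z y * (if b < y then 1 else 0) = ∑ y, c.K z y := by
        refine Finset.sum_congr rfl fun y _ => ?_
        split_ifs with hy
        · ring
        · rw [c.K_tridiag z y, zero_mul]
          rw [Fin.lt_def] at h hy
          rw [lt_abs]; omega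
      rw [this, c.K_rowSum, if_pos h, sub_self, mul_zero]
    · have : ∑ y, c.K z y * (if b < y then 1 else 0) = 0 := by
        refine Finset.sum_eq_zero fun y _ => ?_
        split_ifs with hy
        · rw [c.K_tridiag z y, zero_mul]
          rw [Fin.le_def] at h
          rw [Fin.lt_def] at hy
          rw [lt_abs]; omega
        · ring
      rw [this, if_neg (not_lt.2 h), sub_self, mul_zero]
  have atb : c.pi b * ((if b < b then 1 else 0) - ∑ y, c.K b y * (if b < y then 1 else 0)) =
      -c.flux b := by
    rw [if_neg (lt_irrefl b), flux]; ring
  by_cases hxb : x = b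
  · subst hxb
    rw [atb, if_neg (by omega), if_pos rfl]; ring
  by_cases hx1 : (x : ℕ) = b + 1
  · have tot : ∑ z, c.pi z * ((if b < z then 1 else 0) - ∑ y, c.K z y * (if b < y then 1 else 0))
        = 0 := by
      have h := c.ev_mulVec (fun y => if b < y then 1 else 0)
      simp only [ev, Matrix.mulVec, dotProduct] at h
      simp only [mul_sub, Finset.sum_sub_distrib]
      rw [h, sub_self]
    rw [Finset.sum_eq_add_of_mem b x (Finset.mem_univ _) (Finset.mem_univ _) (Ne.symm hxb)
      (fun z _ hz => far z hz.1 fun e => hz.2 (Fin.ext (e.trans hx1.symm)))] at tot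
    rw [atb] at tot
    rw [if_pos hx1, if_neg hxb]
    linarith
  · rw [far x hxb hx1, if_neg hx1, if_neg hxb]; ring

lemma reversible (x y : Fin (n + 1)) : c.pi x * c.K x y = c.pi y * c.K y x := by
  have step : ∀ x y : Fin (n + 1), (y : ℕ) = x + 1 → c.pi x * c.K x y = c.pi y * c.K y x := by
    intro x y hxy
    have h := c.cut_flux x y
    have hlt : x < y := by rw [Fin.lt_def]; omega
    rw [if_pos hlt, if_pos hxy, if_neg hlt.ne'] at h
    have h1 : ∑ z, c.K x z * (if x < z then 1 else 0) = c.K x y := by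
      rw [Finset.sum_eq_single y]
      · rw [if_pos hlt, mul_one]
      · intro z _ hz
        split_ifs with hxz
        · have : (z : ℕ) ≠ y := fun e => hz (Fin.ext e)
          rw [c.K_tridiag x z, zero_mul]
          rw [Fin.lt_def] at hxz
          rw [lt_abs]; omega
        · ring
      · simp
    have h2 : 1 - ∑ z, c.K y z * (if x < z then 1 else 0) = c.K y x := by
      have e : (1 : ℝ) - ∑ z, c.K y z * (if x < z then 1 else 0) =
          ∑ z, (c.K y z - c.K y z * (if x < z then 1 else 0)) := by
        rw [Finset.sum_sub_distrib, c.K_rowSum]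
      rw [e, Finset.sum_eq_single x]
      · simp
      · intro z _ hz
        split_ifs with hxz
        · ring
        · have : (z : ℕ) ≠ x := fun e => hz (Fin.ext e)
          rw [c.K_tridiag y z]
          · ring
          rw [Fin.lt_def] at hxz
          rw [lt_abs]; omega
      · simp
    rw [h2, flux, h1] at h
    linarith
  rcases lt_trichotomy (x : ℕ) y with h | h | h
  · by_cases h1 : (y : ℕ) = x + 1
    · exact step x y h1
    · rw [c.K_tridiag x y (by rw [lt_abs]; omega), c.K_tridiag y x (by rw [lt_abs]; omega)]
      ring
  · rw [Fin.ext h]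
  · by_cases h1 : (x : ℕ) = y + 1
    · exact (step y x h1).symm
    · rw [c.K_tridiag x y (by rw [lt_abs]; omega), c.K_tridiag y x (by rw [lt_abs]; omega)]
      ring

lemma flux_nonneg (b : Fin (n + 1)) : 0 ≤ c.flux b :=
  mul_nonneg (c.pi_pos b).le (Finset.sum_nonneg fun y _ => mul_nonneg (c.K_nonneg _ _)
    (by split_ifs <;> norm_num))

lemma flux_pos {b x : Fin (n + 1)} (h : b < x) : 0 < c.flux b := by
  have hb : (b : ℕ) < n := by have := x.isLt; rw [Fin.lt_def] at h; omega
  have hK := (c.K_irred b hb).1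
  refine mul_pos (c.pi_pos b) (lt_of_lt_of_le hK ?_)
  have := Finset.single_le_sum (f := fun y => c.K b y * (if b < y then (1 : ℝ) else 0))
    (fun y _ => mul_nonneg (c.K_nonneg _ _) (by split_ifs <;> norm_num))
    (Finset.mem_univ (⟨b + 1, by omega⟩ : Fin (n + 1)))
  refine le_trans (le_of_eq ?_) this
  have hlt : b < (⟨b + 1, by omega⟩ : Fin (n + 1)) := by rw [Fin.lt_def]; simp
  simp only [if_pos hlt, mul_one]

/-- The stationary mass of `g` strictly above `b`. -/
def tail (g : Fin (n + 1) → ℝ) (b : Fin (n + 1)) : ℝ :=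
  ∑ y, if b < y then c.pi y * g y else 0

/-- The potential of `g` for the chain killed at `M`, on states above `M`. -/
def pot (M : Fin (n + 1)) (g : Fin (n + 1) → ℝ) (x : Fin (n + 1)) : ℝ :=
  ∑ b, if M ≤ b ∧ b < x then c.tail g b / c.flux b else 0

lemma pot_of_le {M x : Fin (n + 1)} (g : Fin (n + 1) → ℝ) (h : x ≤ M) : c.pot M g x = 0 :=
  Finset.sum_eq_zero fun _ _ => if_neg fun hb => absurd (lt_of_le_of_lt hb.1 hb.2) (not_lt.2 h)

lemma tail_nonneg {g : Fin (n + 1) → ℝ} (hg : ∀ x, 0 ≤ g x) (b : Fin (n + 1)) :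
    0 ≤ c.tail g b :=
  Finset.sum_nonneg fun y _ => by
    split_ifs
    · exact mul_nonneg (c.pi_pos y).le (hg y)
    · exact le_rfl

lemma pot_mono {M : Fin (n + 1)} {g : Fin (n + 1) → ℝ} (hg : ∀ x, 0 ≤ g x) {x y : Fin (n + 1)}
    (h : x ≤ y) : c.pot M g x ≤ c.pot M g y := by
  refine Finset.sum_le_sum fun b _ => ?_
  split_ifs with h1 h2 h2
  · exact le_rfl
  · exact absurd ⟨h1.1, h1.2.trans_le h⟩ h2
  · exact div_nonneg (c.tail_nonneg hg b) (c.flux_nonneg b)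
  · exact le_rfl

lemma pot_nonneg {M : Fin (n + 1)} {g : Fin (n + 1) → ℝ} (hg : ∀ x, 0 ≤ g x)
    (x : Fin (n + 1)) : 0 ≤ c.pot M g x :=
  Finset.sum_nonneg fun b _ => by
    split_ifs
    · exact div_nonneg (c.tail_nonneg hg b) (c.flux_nonneg b)
    · exact le_rfl

lemma pot_add {M M' x : Fin (n + 1)} (g : Fin (n + 1) → ℝ) (h : M ≤ M') (hx : M' ≤ x) :
    c.pot M g x = c.pot M g M' + c.pot M' g x := by
  unfold pot
  rw [← Finset.sum_add_distrib]
  refine Finset.sum_congr rfl fun b _ => ?_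
  by_cases h1 : b < M'
  · have h2 : b < x := h1.trans_le hx
    have h3 : ¬ M' ≤ b := not_le.2 h1
    simp [h1, h2, h3]
  · have h2 : M ≤ b := h.trans (not_lt.1 h1)
    simp [h1, h2, not_lt.1 h1]

lemma pot_eq {M x : Fin (n + 1)} (g : Fin (n + 1) → ℝ) (h : M < x) :
    c.pot M g x - (c.K *ᵥ c.pot M g) x = g x := by
  have hx0 : 0 < (x : ℕ) := lt_of_le_of_lt (Nat.zero_le _) (Fin.lt_def.1 h)
  set p : Fin (n + 1) := ⟨x - 1, by omega⟩ with hp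
  have hpx : (x : ℕ) = p + 1 := by simp only [hp]; omega
  have hplt : p < x := by rw [Fin.lt_def]; omega
  have hMp : M ≤ p := by rw [Fin.lt_def] at h; rw [Fin.le_def]; omega
  set w : Fin (n + 1) → ℝ := fun b => if M ≤ b then c.tail g b / c.flux b else 0 with hw
  have hpot : ∀ y, c.pot M g y = ∑ b, w b * (if b < y then 1 else 0) := fun y =>
    Finset.sum_congr rfl fun b _ => by
      simp only [hw]
      by_cases h1 : M ≤ b <;> by_cases h2 : b < y <;> simp [h1, h2]
  have e1 : c.pi x * (c.pot M g x - (c.K *ᵥ c.pot M g) x) =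
      ∑ b, w b * (c.pi x * ((if b < x then 1 else 0) - ∑ y, c.K x y * (if b < y then 1 else 0))) := by
    simp only [Matrix.mulVec, dotProduct, hpot, mul_sub, Finset.sum_sub_distrib, Finset.mul_sum]
    congr 1
    · exact Finset.sum_congr rfl fun b _ => by ring
    · rw [Finset.sum_comm]
      exact Finset.sum_congr rfl fun b _ => Finset.sum_congr rfl fun y _ => by ring
  have hpi := c.pi_pos x
  have e2 : ∑ b, w b * (c.flux b * ((if (x : ℕ) = b + 1 then 1 else 0) - (if x = b then 1 else 0)))
      = w p * c.flux p - w x * c.flux x := by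
    simp only [mul_sub, Finset.sum_sub_distrib]
    congr 1
    · rw [Finset.sum_eq_single p]
      · rw [if_pos hpx, mul_one]
      · intro b _ hb
        rw [if_neg fun e => hb (Fin.ext (by omega))]; ring
      · simp
    · rw [Finset.sum_eq_single x]
      · rw [if_pos rfl, mul_one]
      · intro b _ hb
        rw [if_neg fun e => hb e.symm]; ring
      · simp
  have e3 : w p * c.flux p = c.tail g p := by
    simp only [hw, if_pos hMp]
    exact div_mul_cancel₀ _ (c.flux_pos hplt).ne'
  have e4 : w x * c.flux x = c.tail g x := by
    simp only [hw, if_pos h.le]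
    by_cases hl : (x : ℕ) = n
    · have : c.tail g x = 0 := Finset.sum_eq_zero fun y _ => if_neg (by
        rw [Fin.lt_def]; have := y.isLt; omega)
      rw [this]; ring
    · have hlt : x < Fin.last n := by rw [Fin.lt_def, Fin.val_last]; have := x.isLt; omega
      exact div_mul_cancel₀ _ (c.flux_pos hlt).ne'
  have e5 : c.tail g p - c.tail g x = c.pi x * g x := by
    unfold tail
    rw [← Finset.sum_sub_distrib, Finset.sum_eq_single x]
    · rw [if_pos hplt, if_neg (lt_irrefl x), sub_zero]
    · intro y _ hy
      have : (y : ℕ) ≠ x := fun e => hy (Fin.ext e)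
      by_cases h1 : x < y
      · rw [if_pos h1, if_pos (hplt.trans h1), sub_self]
      · rw [if_neg h1, if_neg, sub_self]
        rw [Fin.lt_def] at h1 ⊢; omega
    · simp
  simp only [c.cut_flux] at e1
  rw [e2, e3, e4, e5] at e1
  exact mul_left_cancel₀ hpi.ne' e1

/-- The mean hitting time of `M` from above. -/
def mh (M : Fin (n + 1)) : Fin (n + 1) → ℝ := c.pot M fun _ => 1

/-- The quadratic variation density of a function. -/
def carre (g : Fin (n + 1) → ℝ) (x : Fin (n + 1)) : ℝ := ∑ y, c.K x y * (g y - g x) ^ 2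

/-- An upper bound for the variance of the hitting time of `M` from above. -/
def vh (M : Fin (n + 1)) : Fin (n + 1) → ℝ := c.pot M (c.carre (c.mh M))

lemma carre_nonneg (g : Fin (n + 1) → ℝ) (x : Fin (n + 1)) : 0 ≤ c.carre g x :=
  Finset.sum_nonneg fun _ _ => mul_nonneg (c.K_nonneg _ _) (sq_nonneg _)

lemma mh_nonneg (M x : Fin (n + 1)) : 0 ≤ c.mh M x := c.pot_nonneg (fun _ => zero_le_one) x

lemma vh_nonneg (M x : Fin (n + 1)) : 0 ≤ c.vh M x := c.pot_nonneg (c.carre_nonneg _) x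

lemma K_ne_zero_le {M x y : Fin (n + 1)} (h : M < x) (hy : c.K x y ≠ 0) : M ≤ y := by
  have := abs_le.1 (c.ht_skip x y hy)
  unfold ht at this
  rw [Fin.lt_def] at h
  rw [Fin.le_def]; omega

lemma sum_surv_le_mh (M : Fin (n + 1)) (k : ℕ) {x : Fin (n + 1)} (hx : M ≤ x) :
    ∑ j ∈ Finset.range k, c.hitSurv M x j ≤ c.mh M x := by
  have hS := c.isSurv_hitSurv M
  induction k generalizing x with
  | zero => simpa using c.mh_nonneg M x
  | succ k ih =>
    rcases hx.lt_or_eq with hlt | heq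
    · have h0 := hS.zero x hlt.ne'
      have hs := fun m => hS.succ m x hlt.ne'
      rw [Finset.sum_range_succ', h0]
      have := c.pot_eq (fun _ => 1) hlt
      have h2 : ∑ j ∈ Finset.range k, c.hitSurv M x (j + 1) ≤ (c.K *ᵥ c.mh M) x := by
        simp only [hs]
        rw [Finset.sum_comm]
        refine Finset.sum_le_sum fun y _ => ?_
        rw [← Finset.mul_sum]
        by_cases hy : c.K x y = 0
        · simp [hy]
        exact mul_le_mul_of_nonneg_left (ih (c.K_ne_zero_le hlt hy)) (c.K_nonneg _ _)
      unfold mh at *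
      linarith
    · subst heq
      have : ∀ j, c.hitSurv M M j = 0 := hS.self
      simp only [this, Finset.sum_const_zero]
      exact c.mh_nonneg M M

lemma summable_surv {M x : Fin (n + 1)} (hx : M ≤ x) : Summable (c.hitSurv M x) :=
  summable_of_sum_range_le (fun j => (c.isSurv_hitSurv M).nonneg c.subSt j x)
    fun k => c.sum_surv_le_mh M k hx

lemma hitMean_le_mh {M x : Fin (n + 1)} (hx : M ≤ x) : c.hitMean M x ≤ c.mh M x :=
  Real.tsum_le_of_sum_range_le (fun j => (c.isSurv_hitSurv M).nonneg c.subSt j x)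
    fun k => c.sum_surv_le_mh M k hx

/-- The quadratic functional controlling deviations of the hitting time. -/
def dev (M : Fin (n + 1)) (s : ℝ) (x : Fin (n + 1)) : ℝ := c.vh M x + (c.mh M x - s) ^ 2

lemma dev_super {M x : Fin (n + 1)} (h : M < x) (s : ℝ) :
    (c.K *ᵥ c.dev M (s - 1)) x ≤ c.dev M s x := by
  have hv := c.pot_eq (c.carre (c.mh M)) h
  have hm := c.pot_eq (fun _ => 1) h
  have e : (c.K *ᵥ c.dev M (s - 1)) x = (c.K *ᵥ c.vh M) x + c.carre (c.mh M) x
      + 2 * (c.mh M x - s + 1) * ((c.K *ᵥ c.mh M) x - c.mh M x) + (c.mh M x - s + 1) ^ 2 := by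
    have h1 : (c.mh M x - s + 1) ^ 2 = ∑ y, c.K x y * (c.mh M x - s + 1) ^ 2 := by
      rw [← Finset.sum_mul, c.K_rowSum, one_mul]
    have h2 : c.mh M x = ∑ y, c.K x y * c.mh M x := by
      rw [← Finset.sum_mul, c.K_rowSum, one_mul]
    have h3 : (c.K *ᵥ c.mh M) x - c.mh M x = ∑ y, c.K x y * (c.mh M y - c.mh M x) := by
      conv_lhs => rw [h2]
      simp only [Matrix.mulVec, dotProduct, mul_sub, Finset.sum_sub_distrib]
    rw [h1, h3]
    simp only [Matrix.mulVec, dotProduct, carre, dev, Finset.mul_sum]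
    rw [← Finset.sum_add_distrib, ← Finset.sum_add_distrib, ← Finset.sum_add_distrib]
    exact Finset.sum_congr rfl fun y _ => by ring
  rw [e]
  unfold dev
  change c.mh M x - (c.K *ᵥ c.mh M) x = 1 at hm
  change c.vh M x - (c.K *ᵥ c.vh M) x = _ at hv
  rw [show (c.K *ᵥ c.vh M) x = c.vh M x - c.carre (c.mh M) x by linarith,
    show (c.K *ᵥ c.mh M) x - c.mh M x = -1 by linarith]
  nlinarith

lemma surv_upper (M : Fin (n + 1)) {a : ℝ} (ha : 0 ≤ a) (k : ℕ) {s : ℝ} (hk : s + a ≤ k)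
    {x : Fin (n + 1)} (hx : M ≤ x) : c.hitSurv M x k * a ^ 2 ≤ c.dev M s x := by
  have hS := c.isSurv_hitSurv M
  have hdev : ∀ s x, 0 ≤ c.dev M s x := fun s x => add_nonneg (c.vh_nonneg M x) (sq_nonneg _)
  induction k generalizing s x with
  | zero =>
    have h1 := hS.le_one c.subSt 0 x
    have hm := c.mh_nonneg M x
    have hv := c.vh_nonneg M x
    push_cast at hk
    unfold dev
    have : a ^ 2 ≤ (c.mh M x - s) ^ 2 := pow_le_pow_left₀ ha (by linarith) 2
    nlinarith [sq_nonneg a]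
  | succ k ih =>
    rcases hx.lt_or_eq with hlt | heq
    · have hs := hS.succ k x hlt.ne'
      rw [hs, Finset.sum_mul]
      refine le_trans (Finset.sum_le_sum fun y _ => ?_) (c.dev_super hlt s)
      rw [mul_assoc]
      by_cases hy : c.K x y = 0
      · simp [hy]
      push_cast at hk
      exact mul_le_mul_of_nonneg_left (ih (by linarith) (c.K_ne_zero_le hlt hy)) (c.K_nonneg _ _)
    · subst heq
      have : c.hitSurv M M (k + 1) = 0 := hS.self _
      rw [this, zero_mul]; exact hdev _ _

lemma surv_lower (M : Fin (n + 1)) {a : ℝ} (ha : 0 ≤ a) (k : ℕ) {s : ℝ} (hk : k + a ≤ s)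
    {x : Fin (n + 1)} (hx : M ≤ x) : a ^ 2 * (1 - c.hitSurv M x k) ≤ c.dev M s x := by
  have hS := c.isSurv_hitSurv M
  have hdev : ∀ s x, 0 ≤ c.dev M s x := fun s x => add_nonneg (c.vh_nonneg M x) (sq_nonneg _)
  have hM : ∀ (s : ℝ) (k : ℕ), k + a ≤ s → a ^ 2 * (1 - c.hitSurv M M k) ≤ c.dev M s M := by
    intro s k hk
    have h1 : c.hitSurv M M k = 0 := hS.self k
    have hm : c.mh M M = 0 := c.pot_of_le _ le_rfl
    have hk0 : (0 : ℝ) ≤ k := Nat.cast_nonneg k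
    unfold dev
    rw [h1, hm]
    have : a ^ 2 ≤ s ^ 2 := pow_le_pow_left₀ ha (by linarith) 2
    have := c.vh_nonneg M M
    nlinarith
  induction k generalizing s x with
  | zero =>
    rcases hx.lt_or_eq with hlt | heq
    · have h0 := hS.zero x hlt.ne'
      rw [h0, sub_self, mul_zero]; exact hdev _ _
    · subst heq; exact hM s 0 hk
  | succ k ih =>
    rcases hx.lt_or_eq with hlt | heq
    · have hs := hS.succ k x hlt.ne'
      have e : a ^ 2 * (1 - c.hitSurv M x (k + 1)) =
          ∑ y, c.K x y * (a ^ 2 * (1 - c.hitSurv M y k)) := by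
        rw [hs]
        have : (1 : ℝ) = ∑ y, c.K x y := (c.K_rowSum x).symm
        conv_lhs => rw [this]
        rw [← Finset.sum_sub_distrib, Finset.mul_sum]
        exact Finset.sum_congr rfl fun y _ => by ring
      rw [e]
      refine le_trans (Finset.sum_le_sum fun y _ => ?_) (c.dev_super hlt s)
      by_cases hy : c.K x y = 0
      · simp [hy]
      push_cast at hk
      refine mul_le_mul_of_nonneg_left (ih (s := s - 1) (by linarith) (c.K_ne_zero_le hlt hy))
        (c.K_nonneg _ _)
    · subst heq; exact hM s (k + 1) hk

end BDChain

/-- Poisson weights. -/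
def poi (t : ℝ) (m : ℕ) : ℝ := Real.exp (-t) * t ^ m / m.factorial

lemma hasSum_exp_pow (x : ℝ) : HasSum (fun m : ℕ => x ^ m / m.factorial) (Real.exp x) := by
  rw [Real.exp_eq_exp_ℝ]
  exact NormedSpace.expSeries_div_hasSum_exp x

lemma hasSum_poi_mul_pow (t x : ℝ) :
    HasSum (fun m => poi t m * x ^ m) (Real.exp (-(t * (1 - x)))) := by
  have h := (hasSum_exp_pow (t * x)).mul_left (Real.exp (-t))
  rw [← Real.exp_add] at h
  have e1 : (fun m => poi t m * x ^ m) =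
      fun m : ℕ => Real.exp (-t) * ((t * x) ^ m / m.factorial) := by
    funext m
    simp only [poi, mul_pow]; ring
  have e2 : -(t * (1 - x)) = -t + t * x := by ring
  rw [e1, e2]
  exact h

lemma isWt_poi {t : ℝ} (ht : 0 ≤ t) : IsWt (poi t) := by
  refine ⟨fun m => by unfold poi; positivity, ?_⟩
  simpa using hasSum_poi_mul_pow t 1

namespace BDChain
variable {n : ℕ} (c : BDChain n)

lemma reversible_pow (m : ℕ) (x y : Fin (n + 1)) :
    c.pi x * (c.K ^ m) x y = c.pi y * (c.K ^ m) y x := by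
  induction m generalizing x y with
  | zero =>
    by_cases h : x = y
    · rw [h]
    · simp [h, Ne.symm h]
  | succ m ih =>
    have h1 : (c.K ^ (m + 1)) x y = ∑ z, (c.K ^ m) x z * c.K z y := by
      rw [pow_succ, Matrix.mul_apply]
    have h2 : (c.K ^ (m + 1)) y x = ∑ z, c.K y z * (c.K ^ m) z x := by
      rw [pow_succ', Matrix.mul_apply]
    rw [h1, h2, Finset.mul_sum, Finset.mul_sum]
    refine Finset.sum_congr rfl fun z _ => ?_
    rw [← mul_assoc, ih x z]
    have := c.reversible z y
    linear_combination (c.K ^ m) z x * this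

/-- Spectral representation of quadratic forms of powers of a reversible kernel. -/
lemma exists_spectral (g : Fin (n + 1) → ℝ) : ∃ z μ : Fin (n + 1) → ℝ, ∀ m : ℕ,
    c.ev (fun x => g x * ((c.K ^ m) *ᵥ g) x) = ∑ j, μ j ^ m * z j ^ 2 := by
  set s : Fin (n + 1) → ℝ := fun x => √(c.pi x) with hs
  have spos : ∀ x, 0 < s x := fun x => Real.sqrt_pos.2 (c.pi_pos x)
  have ssq : ∀ x, s x * s x = c.pi x := fun x => Real.mul_self_sqrt (c.pi_pos x).le
  set B : Matrix (Fin (n + 1)) (Fin (n + 1)) ℝ := Matrix.of fun x y => s x * c.K x y / s y with hB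
  have hBs : B.IsHermitian := by
    refine Matrix.IsHermitian.ext fun x y => ?_
    simp only [hB, Matrix.of_apply, star_trivial]
    rw [div_eq_div_iff (spos x).ne' (spos y).ne']
    have := c.reversible y x
    rw [← ssq, ← ssq] at this
    linear_combination this
  have hpow : ∀ m x y, (B ^ m) x y = s x * (c.K ^ m) x y / s y := by
    intro m
    induction m with
    | zero =>
      intro x y
      by_cases h : x = y
      · subst h; simp [(spos x).ne']
      · simp [h]
    | succ m ih =>
      intro x y
      rw [pow_succ, Matrix.mul_apply, pow_succ, Matrix.mul_apply, Finset.mul_sum,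
        Finset.sum_div]
      refine Finset.sum_congr rfl fun k _ => ?_
      rw [ih]
      simp only [hB, Matrix.of_apply]
      have := (spos k).ne'
      have := (spos y).ne'
      field_simp
  set U := hBs.eigenvectorUnitary with hU
  set u : Fin (n + 1) → ℝ := fun x => s x * g x with hu
  refine ⟨star (U : Matrix (Fin (n + 1)) (Fin (n + 1)) ℝ) *ᵥ u, hBs.eigenvalues, fun m => ?_⟩
  have h1 : c.ev (fun x => g x * ((c.K ^ m) *ᵥ g) x) = u ⬝ᵥ ((B ^ m) *ᵥ u) := by
    simp only [ev, dotProduct, Matrix.mulVec, hu, Finset.mul_sum, hpow]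
    refine Finset.sum_congr rfl fun x _ => Finset.sum_congr rfl fun y _ => ?_
    rw [← ssq x]
    have := (spos y).ne'
    field_simp
  have h2 : B ^ m = (U : Matrix (Fin (n + 1)) (Fin (n + 1)) ℝ) *
      Matrix.diagonal (fun j => hBs.eigenvalues j ^ m) *
      star (U : Matrix (Fin (n + 1)) (Fin (n + 1)) ℝ) := by
    conv_lhs => rw [hBs.spectral_theorem]
    rw [← map_pow, Unitary.conjStarAlgAut_apply, Matrix.diagonal_pow]
    rfl
  rw [h1, h2, ← Matrix.mulVec_mulVec, ← Matrix.mulVec_mulVec, Matrix.dotProduct_mulVec]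
  have h3 : u ᵥ* (U : Matrix (Fin (n + 1)) (Fin (n + 1)) ℝ) =
      star (U : Matrix (Fin (n + 1)) (Fin (n + 1)) ℝ) *ᵥ u := by
    rw [Matrix.star_eq_conjTranspose, Matrix.conjTranspose_eq_transpose_of_trivial,
      Matrix.mulVec_transpose]
  rw [h3, dotProduct]
  refine Finset.sum_congr rfl fun j _ => ?_
  rw [Matrix.mulVec_diagonal]
  ring

lemma ev_mul_avgOp_le {w : ℕ → ℝ} (hw : IsWt w) {ε : ℝ} (h : ∀ x, c.tvw w x ≤ ε)
    {g : Fin (n + 1) → ℝ} (hg : c.ev g = 0) :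
    c.ev (fun x => g x * avgOp c.K w g x) ≤ 2 * ε * c.ev (fun x => g x ^ 2) := by
  set k : Fin (n + 1) → Fin (n + 1) → ℝ := fun x y => wavg w (fun m => (c.K ^ m) x y) with hk
  have hop : ∀ f x, avgOp c.K w f x = ∑ y, k x y * f y := fun f x => c.avgOp_eq_sum hw f x
  have hrev : ∀ x y, c.pi x * (k x y - c.pi y) = c.pi y * (k y x - c.pi x) := fun x y => by
    have : c.pi x * k x y = c.pi y * k y x := by
      simp only [hk, ← wavg_mul_left]
      simp only [c.reversible_pow _ x y]
    linarith
  have hrow : ∀ x, ∑ y, |k x y - c.pi y| ≤ 2 * ε := by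
    intro x
    have h1 := (c.le_tvw hw x (f := fun y => if c.pi y ≤ k x y then 1 else 0)
      (fun y => by split_ifs <;> norm_num) (fun y => by split_ifs <;> norm_num)).trans (h x)
    have h2 : ∑ y, k x y = 1 := by
      have := hop (fun _ => 1) x
      rw [avgOp_const c.K_rowSum hw] at this
      simpa using this.symm
    rw [hop, ev, ← Finset.sum_sub_distrib] at h1
    have h3 : ∀ y, |k x y - c.pi y| = 2 * (k x y * (if c.pi y ≤ k x y then 1 else 0)
        - c.pi y * (if c.pi y ≤ k x y then 1 else 0)) - (k x y - c.pi y) := fun y => by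
      split_ifs with hy
      · rw [abs_of_nonneg (by linarith)]; ring
      · rw [abs_of_nonpos (by linarith)]; ring
    simp only [h3, Finset.sum_sub_distrib, ← Finset.mul_sum, h2, c.pi_sum]
    rw [Finset.sum_sub_distrib] at h1
    linarith
  have e1 : c.ev (fun x => g x * avgOp c.K w g x) =
      ∑ x, ∑ y, c.pi x * (k x y - c.pi y) * (g x * g y) := by
    have : ∀ x, avgOp c.K w g x = ∑ y, (k x y - c.pi y) * g y := fun x => by
      simp only [sub_mul, Finset.sum_sub_distrib]
      rw [show ∑ y, c.pi y * g y = 0 from hg, sub_zero, hop]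
    simp only [ev, this, Finset.mul_sum]
    exact Finset.sum_congr rfl fun x _ => Finset.sum_congr rfl fun y _ => by ring
  have e2 : ∀ x y, c.pi x * (k x y - c.pi y) * (g x * g y) ≤
      (1 / 2) * (c.pi x * g x ^ 2 * |k x y - c.pi y|) +
      (1 / 2) * (c.pi y * g y ^ 2 * |k y x - c.pi x|) := by
    intro x y
    have a1 : c.pi y * |k y x - c.pi x| = c.pi x * |k x y - c.pi y| := by
      rw [← abs_of_pos (c.pi_pos y), ← abs_mul, abs_of_pos (c.pi_pos y), ← hrev, abs_mul,
        abs_of_pos (c.pi_pos x)]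
    have a2 : (1 / 2) * (c.pi y * g y ^ 2 * |k y x - c.pi x|) =
        (1 / 2) * (c.pi x * |k x y - c.pi y| * g y ^ 2) := by rw [← a1]; ring
    rw [a2]
    have a3 : (k x y - c.pi y) * (g x * g y) ≤ |k x y - c.pi y| * ((g x ^ 2 + g y ^ 2) / 2) := by
      refine (le_abs_self _).trans ?_
      rw [abs_mul]
      refine mul_le_mul_of_nonneg_left ?_ (abs_nonneg _)
      rw [abs_le]
      constructor <;> nlinarith [sq_nonneg (g x + g y), sq_nonneg (g x - g y)]
    have := mul_le_mul_of_nonneg_left a3 (c.pi_pos x).le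
    nlinarith
  rw [e1]
  refine (Finset.sum_le_sum fun x _ => Finset.sum_le_sum fun y _ => e2 x y).trans ?_
  simp only [Finset.sum_add_distrib]
  have e3 : ∑ x, ∑ y, (1 / 2) * (c.pi y * g y ^ 2 * |k y x - c.pi x|) =
      ∑ x, ∑ y, (1 / 2) * (c.pi x * g x ^ 2 * |k x y - c.pi y|) := Finset.sum_comm
  rw [e3]
  have e4 : ∑ x, ∑ y, (1 / 2) * (c.pi x * g x ^ 2 * |k x y - c.pi y|) ≤
      ε * c.ev (fun x => g x ^ 2) := by
    rw [ev, Finset.mul_sum]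
    refine Finset.sum_le_sum fun x _ => ?_
    rw [← Finset.mul_sum, ← Finset.mul_sum]
    have := mul_le_mul_of_nonneg_left (hrow x) (mul_nonneg (c.pi_pos x).le (sq_nonneg (g x)))
    linarith
  linarith

lemma poincare {T ε : ℝ} (hT : 0 < T) (hε : 0 < ε) (h : ∀ x, c.tvw (poi T) x ≤ ε)
    {g : Fin (n + 1) → ℝ} (hg : c.ev g = 0) :
    Real.log (1 / (2 * ε)) / T * c.ev (fun x => g x ^ 2) ≤
      c.ev (fun x => g x * (g x - (c.K *ᵥ g) x)) := by
  have hw := isWt_poi hT.le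
  obtain ⟨z, μ, hz⟩ := c.exists_spectral g
  set N := c.ev (fun x => g x ^ 2) with hN
  set E := c.ev (fun x => g x * (g x - (c.K *ᵥ g) x)) with hE
  have hN' : N = ∑ j, z j ^ 2 := by
    have := hz 0
    simp only [pow_zero, Matrix.one_mulVec, one_mul] at this
    rw [← this, hN]
    congr 1; funext x; ring
  have hE' : E = ∑ j, (1 - μ j) * z j ^ 2 := by
    have := hz 1
    simp only [pow_one] at this
    simp only [sub_mul, one_mul, Finset.sum_sub_distrib]
    rw [← this, ← hN', hN, ← ev_sub, hE]
    congr 1; funext x; ring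
  have hH : c.ev (fun x => g x * avgOp c.K (poi T) g x) =
      ∑ j, Real.exp (-(T * (1 - μ j))) * z j ^ 2 := by
    have h1 : HasSum (fun m => ∑ j, poi T m * μ j ^ m * z j ^ 2)
        (∑ j, Real.exp (-(T * (1 - μ j))) * z j ^ 2) :=
      hasSum_sum fun j _ => (hasSum_poi_mul_pow T (μ j)).mul_right _
    rw [← h1.tsum_eq]
    obtain ⟨C, hC⟩ := c.subSt.exists_pow_bound g
    unfold ev avgOp
    simp only [← wavg_mul_left]
    rw [← hw.wavg_sum Finset.univ (C := fun x => c.pi x * (|g x| * C)) (fun x m => by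
      rw [abs_mul, abs_of_pos (c.pi_pos x), abs_mul]
      exact mul_le_mul_of_nonneg_left (mul_le_mul_of_nonneg_left (hC x m) (abs_nonneg _))
        (c.pi_pos x).le)]
    unfold wavg
    refine tsum_congr fun m => ?_
    have := hz m
    unfold ev at this
    simp only [mul_assoc, ← Finset.mul_sum]
    rw [this]
  have hup := c.ev_mul_avgOp_le hw h hg
  rw [hH, ← hN] at hup
  rcases (show 0 ≤ N by rw [hN']; positivity).eq_or_lt with h0 | hpos
  · rw [← h0, mul_zero, hE']
    have hz0 : ∀ j, z j ^ 2 = 0 := fun j =>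
      (Finset.sum_eq_zero_iff_of_nonneg fun j _ => sq_nonneg (z j)).1 (hN' ▸ h0.symm) j
        (Finset.mem_univ j)
    simp [hz0]
  · set y0 := -(T * E / N) with hy0
    have hlow : Real.exp y0 * N ≤ ∑ j, Real.exp (-(T * (1 - μ j))) * z j ^ 2 := by
      have h1 : ∀ j, Real.exp y0 * ((1 + (-(T * (1 - μ j)) - y0)) * z j ^ 2) ≤
          Real.exp (-(T * (1 - μ j))) * z j ^ 2 := fun j => by
        rw [← mul_assoc]
        refine mul_le_mul_of_nonneg_right ?_ (sq_nonneg _)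
        have := Real.add_one_le_exp (-(T * (1 - μ j)) - y0)
        calc Real.exp y0 * (1 + (-(T * (1 - μ j)) - y0))
            ≤ Real.exp y0 * Real.exp (-(T * (1 - μ j)) - y0) :=
              mul_le_mul_of_nonneg_left (by linarith) (Real.exp_pos _).le
          _ = _ := by rw [← Real.exp_add]; congr 1; ring
      refine le_trans (le_of_eq ?_) (Finset.sum_le_sum fun j _ => h1 j)
      rw [← Finset.mul_sum]
      congr 1
      have : ∀ j, (1 + (-(T * (1 - μ j)) - y0)) * z j ^ 2 =
          (1 - y0) * z j ^ 2 - T * ((1 - μ j) * z j ^ 2) := fun j => by ring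
      simp only [this, Finset.sum_sub_distrib, ← Finset.mul_sum]
      rw [← hE', ← hN', hy0]
      field_simp
      ring
    have h2 : Real.exp y0 ≤ 2 * ε := le_of_mul_le_mul_right (hlow.trans hup) hpos
    have h3 : y0 ≤ Real.log (2 * ε) := (Real.le_log_iff_exp_le (by positivity)).2 h2
    rw [one_div, Real.log_inv, div_mul_eq_mul_div, div_le_iff₀ hT]
    rw [hy0, neg_le, le_div_iff₀ hpos] at h3
    linarith

end BDChain

namespace BDChain
variable {n : ℕ} (c : BDChain n)

/-- A Poincaré inequality with constant `l`. -/
def Gap (l : ℝ) : Prop := ∀ g : Fin (n + 1) → ℝ, c.ev g = 0 →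
  l * c.ev (fun x => g x ^ 2) ≤ c.ev (fun x => g x * (g x - (c.K *ᵥ g) x))

lemma ev_energy_mh (b : Fin (n + 1)) :
    c.ev (fun x => c.mh b x * (c.mh b x - (c.K *ᵥ c.mh b) x)) = c.ev (c.mh b) := by
  refine congrArg c.ev (funext fun x => ?_)
  by_cases h : b < x
  · have := c.pot_eq (fun _ => 1) h
    unfold mh
    rw [this, mul_one]
  · rw [show c.mh b x = 0 from c.pot_of_le _ (not_lt.1 h), zero_mul]

lemma ev_sub_mulVec (g : Fin (n + 1) → ℝ) : c.ev (fun x => g x - (c.K *ᵥ g) x) = 0 := by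
  rw [c.ev_sub, show c.ev (fun x => (c.K *ᵥ g) x) = c.ev g from c.ev_mulVec g, sub_self]

lemma Gap.variance_le {l : ℝ} (h : c.Gap l) (g : Fin (n + 1) → ℝ) :
    l * (c.ev (fun x => g x ^ 2) - c.ev g ^ 2) ≤
      c.ev (fun x => g x * (g x - (c.K *ᵥ g) x)) := by
  have hK : ∀ x, (c.K *ᵥ fun x => g x - c.ev g) x = (c.K *ᵥ g) x - c.ev g := fun x => by
    simp only [Matrix.mulVec, dotProduct, mul_sub, Finset.sum_sub_distrib, ← Finset.sum_mul,
      c.K_rowSum, one_mul]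
  have h1 := h (fun x => g x - c.ev g) (by rw [c.ev_sub, c.ev_const, sub_self])
  have e1 : c.ev (fun x => (g x - c.ev g) ^ 2) = c.ev (fun x => g x ^ 2) - c.ev g ^ 2 := by
    have : (fun x => (g x - c.ev g) ^ 2) =
        fun x => g x ^ 2 - ((2 * c.ev g) * g x - c.ev g ^ 2) := by funext x; ring
    rw [this, c.ev_sub, c.ev_sub, c.ev_const, c.ev_smul]; ring
  have e2 : c.ev (fun x => (g x - c.ev g) * (g x - c.ev g - (c.K *ᵥ fun x => g x - c.ev g) x)) =
      c.ev (fun x => g x * (g x - (c.K *ᵥ g) x)) := by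
    have : (fun x => (g x - c.ev g) * (g x - c.ev g - (c.K *ᵥ fun x => g x - c.ev g) x)) =
        fun x => g x * (g x - (c.K *ᵥ g) x) - c.ev g * (g x - (c.K *ᵥ g) x) := by
      funext x; rw [hK]; ring
    rw [this, c.ev_sub, c.ev_smul, c.ev_sub_mulVec]; ring
  rwa [e1, e2] at h1

lemma tail_one_add_piLow (b : Fin (n + 1)) : c.tail (fun _ => 1) b + c.piLow b = 1 := by
  rw [tail, piLow, ← Finset.sum_add_distrib]
  refine (Finset.sum_congr rfl fun y _ => ?_).trans c.pi_sum
  by_cases h : b < y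
  · simp [h, not_le.2 h]
  · simp [h, not_lt.1 h]

lemma Gap.ev_mh_le {l : ℝ} (h : c.Gap l) (hl : 0 < l) (b : Fin (n + 1)) :
    l * c.piLow b * c.ev (c.mh b) ≤ c.tail (fun _ => 1) b := by
  have h1 := h.variance_le c (c.mh b)
  rw [c.ev_energy_mh] at h1
  have hT := c.tail_one_add_piLow b
  have hL : 0 ≤ c.piLow b := Finset.sum_nonneg fun y _ => by
    split_ifs
    · exact (c.pi_pos y).le
    · exact le_rfl
  have hT0 : 0 ≤ c.tail (fun _ => 1) b := c.tail_nonneg (fun _ => zero_le_one) b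
  have hm0 : 0 ≤ c.ev (c.mh b) := c.ev_nonneg (c.mh_nonneg b)
  have cs : c.ev (c.mh b) ^ 2 ≤ c.tail (fun _ => 1) b * c.ev (fun x => c.mh b x ^ 2) := by
    refine Finset.sum_sq_le_sum_mul_sum_of_sq_le_mul _ (fun y _ => ?_) (fun y _ => ?_)
      fun y _ => le_of_eq ?_
    · split_ifs
      · exact mul_nonneg (c.pi_pos y).le zero_le_one
      · exact le_rfl
    · exact mul_nonneg (c.pi_pos y).le (sq_nonneg _)
    · split_ifs with hy
      · ring
      · rw [show c.mh b y = 0 from c.pot_of_le _ (not_lt.1 hy)]; ring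
  set m := c.ev (c.mh b)
  set q := c.ev (fun x => c.mh b x ^ 2)
  set T := c.tail (fun _ => 1) b
  rcases hm0.eq_or_lt with h0 | hpos
  · rw [← h0, mul_zero]; exact hT0
  · have hq : 0 ≤ q := c.ev_nonneg fun x => sq_nonneg _
    have h2 : l * (q * c.piLow b) ≤ m := by
      refine le_trans (mul_le_mul_of_nonneg_left ?_ hl.le) h1
      nlinarith
    have h3 : (l * c.piLow b * m) * m ≤ T * m := by
      calc (l * c.piLow b * m) * m = l * c.piLow b * m ^ 2 := by ring
        _ ≤ l * c.piLow b * (T * q) := mul_le_mul_of_nonneg_left cs (by positivity)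
        _ = T * (l * (q * c.piLow b)) := by ring
        _ ≤ T * m := mul_le_mul_of_nonneg_left h2 hT0
    exact le_of_mul_le_mul_right h3 hpos

lemma ev_carre (g : Fin (n + 1) → ℝ) :
    c.ev (c.carre g) = 2 * c.ev (fun x => g x * (g x - (c.K *ᵥ g) x)) := by
  have h1 : c.carre g = fun x =>
      2 * (g x * (g x - (c.K *ᵥ g) x)) - (g x ^ 2 - (c.K *ᵥ fun y => g y ^ 2) x) := by
    funext x
    have hr : ∀ a : ℝ, a = ∑ y, c.K x y * a := fun a => by
      rw [← Finset.sum_mul, c.K_rowSum, one_mul]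
    have e : 2 * (g x * (g x - (c.K *ᵥ g) x)) - (g x ^ 2 - (c.K *ᵥ fun y => g y ^ 2) x) =
        g x ^ 2 - 2 * g x * (c.K *ᵥ g) x + (c.K *ᵥ fun y => g y ^ 2) x := by ring
    rw [e, hr (g x ^ 2)]
    simp only [carre, Matrix.mulVec, dotProduct, Finset.mul_sum]
    rw [← Finset.sum_sub_distrib, ← Finset.sum_add_distrib]
    exact Finset.sum_congr rfl fun y _ => by ring
  rw [h1, c.ev_sub, c.ev_smul, c.ev_sub_mulVec, sub_zero]

lemma tail_carre_mh_le {M b : Fin (n + 1)} (h : M ≤ b) :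
    c.tail (c.carre (c.mh M)) b ≤ 2 * c.ev (c.mh b) := by
  rw [← c.ev_energy_mh, ← c.ev_carre, tail, ev]
  refine Finset.sum_le_sum fun y _ => ?_
  split_ifs with hy
  · refine le_of_eq (congrArg _ (Finset.sum_congr rfl fun z _ => ?_))
    by_cases hK : c.K y z = 0
    · rw [hK, zero_mul, zero_mul]
    · have hz := c.K_ne_zero_le hy hK
      have e1 : c.mh M z = c.mh M b + c.mh b z := c.pot_add _ h hz
      have e2 : c.mh M y = c.mh M b + c.mh b y := c.pot_add _ h hy.le
      rw [e1, e2]; ring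
  · exact mul_nonneg (c.pi_pos y).le (c.carre_nonneg _ y)

lemma piLow_mono {a b : Fin (n + 1)} (h : a ≤ b) : c.piLow a ≤ c.piLow b := by
  refine Finset.sum_le_sum fun y _ => ?_
  have := c.pi_pos y
  split_ifs with h1 h2 h2
  · exact le_rfl
  · exact absurd (h1.trans h) h2
  · exact this.le
  · exact le_rfl

lemma piLow_nonneg (a : Fin (n + 1)) : 0 ≤ c.piLow a := Finset.sum_nonneg fun y _ => by
  split_ifs
  · exact (c.pi_pos y).le
  · exact le_rfl

lemma piLow_pos (a : Fin (n + 1)) : 0 < c.piLow a := by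
  have h := Finset.single_le_sum (f := fun y => if y ≤ a then c.pi y else 0)
    (fun y _ => by
      split_ifs
      · exact (c.pi_pos y).le
      · exact le_rfl) (Finset.mem_univ a)
  exact lt_of_lt_of_le (by simpa using c.pi_pos a) h

lemma piHigh_pos (a : Fin (n + 1)) : 0 < c.piHigh a := by
  have h := Finset.single_le_sum (f := fun y => if a ≤ y then c.pi y else 0)
    (fun y _ => by
      split_ifs
      · exact (c.pi_pos y).le
      · exact le_rfl) (Finset.mem_univ a)
  exact lt_of_lt_of_le (by simpa using c.pi_pos a) h

lemma Gap.vh_le {l : ℝ} (h : c.Gap l) (hl : 0 < l) (M x : Fin (n + 1)) :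
    c.vh M x ≤ 2 / (l * c.piLow M) * c.mh M x := by
  unfold vh mh pot
  rw [Finset.mul_sum]
  refine Finset.sum_le_sum fun b _ => ?_
  split_ifs with hb
  · rw [← mul_div_assoc]
    refine div_le_div_of_nonneg_right ((c.tail_carre_mh_le hb.1).trans ?_) (c.flux_nonneg b)
    have h1 := h.ev_mh_le c hl b
    have h2 := c.piLow_pos M
    have h3 := c.ev_nonneg (c.mh_nonneg b)
    rw [div_mul_eq_mul_div, le_div_iff₀ (by positivity)]
    have h4 : l * c.piLow M * c.ev (c.mh b) ≤ l * c.piLow b * c.ev (c.mh b) :=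
      mul_le_mul_of_nonneg_right (mul_le_mul_of_nonneg_left (c.piLow_mono hb.1) hl.le) h3
    nlinarith
  · rw [mul_zero]

lemma Gap.mh_le {l : ℝ} (h : c.Gap l) (hl : 0 < l) (M M' : Fin (n + 1)) :
    l * c.piLow M * c.piHigh M' * c.mh M M' ≤ 1 := by
  have h1 := h.ev_mh_le c hl M
  have h2 := c.tail_one_add_piLow M
  have h3 : c.piHigh M' * c.mh M M' ≤ c.ev (c.mh M) := by
    rw [piHigh, Finset.sum_mul]
    refine Finset.sum_le_sum fun y _ => ?_
    split_ifs with hy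
    · exact mul_le_mul_of_nonneg_left (c.pot_mono (fun _ => zero_le_one) hy) (c.pi_pos y).le
    · rw [zero_mul]; exact mul_nonneg (c.pi_pos y).le (c.mh_nonneg M y)
  have h4 := mul_le_mul_of_nonneg_left h3 (mul_nonneg hl.le (c.piLow_nonneg M))
  have h5 := c.piLow_nonneg M
  linarith

end BDChain

/-- The indicator of times at distance at least `a` from `s`. -/
def farInd (s a : ℝ) (m : ℕ) : ℝ := if a ≤ |(m : ℝ) - s| then 1 else 0

lemma farInd_nonneg (s a : ℝ) (m : ℕ) : 0 ≤ farInd s a m := by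
  unfold farInd; split_ifs <;> norm_num

lemma abs_farInd_le (s a : ℝ) (m : ℕ) : |farInd s a m| ≤ 1 := by
  unfold farInd; split_ifs <;> norm_num

lemma farInd_le (s : ℝ) {a : ℝ} (ha : 0 < a) (m : ℕ) : farInd s a m ≤ ((m : ℝ) - s) ^ 2 / a ^ 2 := by
  unfold farInd
  split_ifs with h
  · rw [le_div_iff₀ (by positivity), one_mul, ← sq_abs ((m : ℝ) - s)]
    exact pow_le_pow_left₀ ha.le h 2
  · positivity

/-- A family of random times indexed by real time. -/
structure TimeScale (W : ℝ → ℕ → ℝ) : Prop where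
  isWt : ∀ s, 0 ≤ s → IsWt (W s)
  conv : ∀ s v, 0 ≤ s → 0 ≤ v → ∃ r, 0 ≤ r ∧ s + v - 2 ≤ r ∧ r ≤ s + v ∧
    wconv (W s) (W v) = W r
  split : ∀ s s', 0 ≤ s → s ≤ s' → ∃ w, IsWt w ∧ W s' = wconv (W s) w
  cheb : ∀ s a, 0 ≤ s → 0 < a → wavg (W s) (farInd s a) ≤ (s + 1) / a ^ 2

lemma hasSum_nat_shift {a : ℕ → ℝ} {v : ℝ} (h0 : a 0 = 0) (h : HasSum (fun m => a (m + 1)) v) :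
    HasSum a v := by
  have := (hasSum_nat_add_iff (f := a) 1).1 h
  simpa [h0] using this

lemma poi_succ (v : ℝ) (m : ℕ) : poi v (m + 1) * ((m : ℝ) + 1) = v * poi v m := by
  unfold poi
  rw [Nat.factorial_succ]
  push_cast
  have : (m.factorial : ℝ) ≠ 0 := by positivity
  field_simp
  ring

lemma hasSum_poi_mul_shift {v : ℝ} {a : ℕ → ℝ} {S : ℝ}
    (h : HasSum (fun m => poi v m * a (m + 1)) S) :
    HasSum (fun m => poi v m * (m * a m)) (v * S) := by
  refine hasSum_nat_shift (by simp) ((h.mul_left v).congr_fun fun m => ?_)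
  push_cast
  linear_combination a (m + 1) * poi_succ v m

lemma hasSum_poi_one (v : ℝ) : HasSum (poi v) 1 := by
  simpa using hasSum_poi_mul_pow v 1

lemma hasSum_poi_mean (v : ℝ) : HasSum (fun m => poi v m * (m : ℝ)) v := by
  have := hasSum_poi_mul_shift (v := v) (a := fun _ => 1) (S := 1) (by simpa using hasSum_poi_one v)
  simpa using this

lemma hasSum_poi_var (v : ℝ) : HasSum (fun m => poi v m * ((m : ℝ) - v) ^ 2) v := by
  have h1 := hasSum_poi_mean v
  have h0 := hasSum_poi_one v
  have h2 : HasSum (fun m => poi v m * ((m : ℝ) * m)) (v * (v + 1)) :=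
    hasSum_poi_mul_shift ((h1.add h0).congr_fun fun m => by push_cast; ring)
  have h3 := (h2.sub (h1.mul_left (2 * v))).add (h0.mul_left (v ^ 2))
  have e : v * (v + 1) - 2 * v * v + v ^ 2 * 1 = v := by ring
  rw [e] at h3
  exact h3.congr_fun fun m => by ring

lemma wconv_poi (s v : ℝ) : wconv (poi s) (poi v) = poi (s + v) := by
  funext m
  unfold wconv poi
  rw [(Commute.all s v).add_pow', neg_add, Real.exp_add, Finset.mul_sum, Finset.sum_div]
  refine Finset.sum_congr rfl fun p hp => ?_
  have hp' := Finset.HasAntidiagonal.mem_antidiagonal.1 hp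
  have hc : ((p.1 + p.2).choose p.1 : ℝ) * (p.1.factorial * p.2.factorial) =
      (p.1 + p.2).factorial := by
    rw [← mul_assoc, Nat.choose_symm_add]; exact_mod_cast Nat.add_choose_mul_factorial_mul_factorial p.1 p.2
  rw [← hp', nsmul_eq_mul, ← hc]
  have h1 : (p.1.factorial : ℝ) ≠ 0 := by positivity
  have h2 : (p.2.factorial : ℝ) ≠ 0 := by positivity
  have h3 : ((p.1 + p.2).choose p.1 : ℝ) ≠ 0 :=
    Nat.cast_ne_zero.2 (Nat.choose_pos (Nat.le_add_right _ _)).ne'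
  field_simp

lemma wavg_poi_farInd_le {s a : ℝ} (hs : 0 ≤ s) (ha : 0 < a) :
    wavg (poi s) (farInd s a) ≤ s / a ^ 2 := by
  have h := (hasSum_poi_var s).div_const (a ^ 2)
  refine hasSum_le (fun m => ?_) ((isWt_poi hs).summable (abs_farInd_le s a)).hasSum h
  rw [mul_div_assoc]
  exact mul_le_mul_of_nonneg_left (farInd_le s ha m) ((isWt_poi hs).1 m)

lemma timeScale_poi : TimeScale poi where
  isWt := fun s hs => isWt_poi hs
  conv := fun s v hs hv => ⟨s + v, by positivity, by linarith, le_rfl, wconv_poi s v⟩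
  split := fun s s' hs h => ⟨poi (s' - s), isWt_poi (sub_nonneg.2 h), by
    rw [wconv_poi]; congr 1; ring⟩
  cheb := fun s a hs ha => (wavg_poi_farInd_le hs ha).trans
    (div_le_div_of_nonneg_right (by linarith) (sq_nonneg a))

/-- Deterministic times. -/
def detTime (s : ℝ) : ℕ → ℝ := Pi.single ⌊s⌋₊ 1

lemma timeScale_detTime : TimeScale detTime where
  isWt := fun s _ => isWt_single _
  conv := fun s v hs hv => by
    refine ⟨((⌊s⌋₊ + ⌊v⌋₊ : ℕ) : ℝ), by positivity, ?_, ?_, ?_⟩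
    · have := Nat.lt_floor_add_one s
      have := Nat.lt_floor_add_one v
      push_cast; linarith
    · have := Nat.floor_le hs
      have := Nat.floor_le hv
      push_cast; linarith
    · unfold detTime
      rw [wconv_single, Nat.floor_natCast]
  split := fun s s' _ h => by
    refine ⟨Pi.single (⌊s'⌋₊ - ⌊s⌋₊) 1, isWt_single _, ?_⟩
    unfold detTime
    rw [wconv_single, Nat.add_sub_cancel' (Nat.floor_mono h)]
  cheb := fun s a hs ha => by
    unfold detTime
    rw [wavg_single]
    refine (farInd_le s ha _).trans (div_le_div_of_nonneg_right ?_ (sq_nonneg a))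
    have h1 := Nat.lt_floor_add_one s
    have h2 := Nat.floor_le hs
    nlinarith

/-- The transition kernel is well behaved with respect to a time scale: averaging smooths
functions at rate `κ`, and the origin is retained with probability at least `ρ ^ s`. -/
structure BDChain.Adapted {n : ℕ} (c : BDChain n) (W : ℝ → ℕ → ℝ) (κ ρ : ℝ) : Prop where
  smooth : ∀ f : Fin (n + 1) → ℝ, (∀ x, 0 ≤ f x) → (∀ x, f x ≤ 1) → ∀ v, 0 < v → ∀ x,
    |avgOp c.K (W v) (c.K *ᵥ f) x - avgOp c.K (W v) f x| ≤ 1 / √(κ * v)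
  loop : ∀ s, 0 ≤ s → ρ ^ s ≤ avgOp c.K (W s) (fun y => if y = 0 then 1 else 0) 0
  poi_le : ∀ s, 0 < s → ∀ x, c.tvw (poi s) x ≤ c.tvw (W (s / 2)) x + 4 / s

namespace BDChain
variable {n : ℕ} (c : BDChain n)

lemma pow_mulVec_mem {A : Matrix (Fin (n + 1)) (Fin (n + 1)) ℝ} (hA : SubSt A)
    {f : Fin (n + 1) → ℝ} (h0 : ∀ x, 0 ≤ f x) (h1 : ∀ x, f x ≤ 1) (m : ℕ) (x : Fin (n + 1)) :
    0 ≤ ((A ^ m) *ᵥ f) x ∧ |((A ^ m) *ᵥ f) x| ≤ 1 :=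
  ⟨(hA.pow m).mulVec_nonneg h0 x,
    (hA.pow m).abs_mulVec_le (fun x => abs_le.2 ⟨by linarith [h0 x], h1 x⟩) x⟩

lemma self_pow_le_loop {δ : ℝ} (hδ : 0 ≤ δ) (h : δ ≤ c.K 0 0) (m : ℕ) : δ ^ m ≤ (c.K ^ m) 0 0 := by
  induction m with
  | zero => simp
  | succ m ih =>
    rw [pow_succ, pow_succ, Matrix.mul_apply]
    refine le_trans (mul_le_mul ih h hδ ((pow_nonneg hδ m).trans ih)) ?_
    exact Finset.single_le_sum (f := fun z => (c.K ^ m) 0 z * c.K z 0)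
      (fun z _ => mul_nonneg ((c.subSt.pow m).nonneg _ _) (c.K_nonneg _ _)) (Finset.mem_univ 0)

lemma pow_mulVec_ind (m : ℕ) (x a : Fin (n + 1)) :
    ((c.K ^ m) *ᵥ fun y => if y = a then 1 else 0) x = (c.K ^ m) x a := by
  simp [Matrix.mulVec, dotProduct]

lemma tvw_le_wavg {w : ℕ → ℝ} (hw : IsWt w) (x : Fin (n + 1)) :
    c.tvw w x ≤ wavg w fun m => c.tvw (Pi.single m 1) x := by
  refine c.tvw_le hw fun f h0 h1 => ?_
  obtain ⟨C, hC⟩ := c.subSt.exists_pow_bound f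
  rw [avgOp, ← hw.wavg_const (c.ev f), ← hw.wavg_sub (hC x) (fun _ => le_rfl)]
  have hb : ∀ m, |((c.K ^ m) *ᵥ f) x - c.ev f| ≤ C + |c.ev f| := fun m =>
    (abs_sub _ _).trans (by linarith [hC x m])
  refine hw.wavg_mono hb (C' := 1) (fun m => ?_) fun m => ?_
  · rw [abs_of_nonneg (c.tvw_nonneg _ x)]
    exact c.tvw_le_one (isWt_single m) x
  · have := c.le_tvw (isWt_single m) x h0 h1
    unfold avgOp at this
    rwa [wavg_single] at this

lemma tvw_det_anti (x : Fin (n + 1)) {j m : ℕ} (h : j ≤ m) :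
    c.tvw (Pi.single m 1) x ≤ c.tvw (Pi.single j 1) x := by
  have := c.tvw_wconv_le (isWt_single j) (isWt_single (m - j)) x
  rwa [wconv_single, Nat.add_sub_cancel' h] at this

lemma adapted_poi : c.Adapted poi 1 (Real.exp (-1)) where
  smooth := fun f h0 h1 v hv x => by
    have hw := isWt_poi hv.le
    have hb := pow_mulVec_mem c.subSt h0 h1
    set a : ℕ → ℝ := fun m => ((c.K ^ m) *ᵥ f) x with ha
    have e1 : avgOp c.K (poi v) (c.K *ᵥ f) x = wavg (poi v) fun m => a (m + 1) := by
      simp only [avgOp, ha, Matrix.mulVec_mulVec, ← pow_succ]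
    have hs1 : HasSum (fun m => poi v m * a (m + 1)) (wavg (poi v) fun m => a (m + 1)) :=
      (hw.summable fun m => (hb (m + 1) x).2).hasSum
    have hs2 := (hasSum_poi_mul_shift hs1).div_const v
    rw [mul_div_cancel_left₀ _ hv.ne'] at hs2
    have hs0 : HasSum (fun m => poi v m * a m) (avgOp c.K (poi v) f x) :=
      (hw.summable fun m => (hb m x).2).hasSum
    have hd := hs2.sub hs0
    rw [e1, one_mul]
    have hsq : 0 < √v := Real.sqrt_pos.2 hv
    have hvv : √v * √v = v := Real.mul_self_sqrt hv.le
    have hub := (((hasSum_poi_var v).mul_left (1 / (2 * (v * √v)))).add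
      ((hasSum_poi_one v).mul_left (1 / (2 * √v))))
    have key : ∀ m, |poi v m * (m * a m) / v - poi v m * a m| ≤
        1 / (2 * (v * √v)) * (poi v m * ((m : ℝ) - v) ^ 2) + 1 / (2 * √v) * poi v m := by
      intro m
      have e : poi v m * (m * a m) / v - poi v m * a m = poi v m * (((m : ℝ) - v) / v * a m) := by
        field_simp
      rw [e, abs_mul, abs_of_nonneg (hw.1 m)]
      have h2 : |((m : ℝ) - v) / v * a m| ≤ |((m : ℝ) - v) / v| := by
        rw [abs_mul]
        exact mul_le_of_le_one_right (abs_nonneg _) (hb m x).2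
      have h3 : |((m : ℝ) - v) / v| ≤
          1 / (2 * (v * √v)) * ((m : ℝ) - v) ^ 2 + 1 / (2 * √v) := by
        rw [abs_div, abs_of_pos hv, ← sq_abs ((m : ℝ) - v), div_le_iff₀ hv]
        set b := |(m : ℝ) - v|
        have e2 : (1 / (2 * (v * √v)) * b ^ 2 + 1 / (2 * √v)) * v = (b ^ 2 + √v * √v) / (2 * √v) := by
          rw [hvv]; field_simp
        rw [e2, le_div_iff₀ (by positivity)]
        nlinarith [sq_nonneg (b - √v)]
      calc poi v m * |((m : ℝ) - v) / v * a m|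
          ≤ poi v m * (1 / (2 * (v * √v)) * ((m : ℝ) - v) ^ 2 + 1 / (2 * √v)) :=
            mul_le_mul_of_nonneg_left (h2.trans h3) (hw.1 m)
        _ = _ := by ring
    have e3 : 1 / (2 * (v * √v)) * v + 1 / (2 * √v) * 1 = 1 / √v := by field_simp; ring
    rw [e3] at hub
    rw [abs_le]
    exact ⟨neg_le.1 (hasSum_le (fun m => (neg_le_abs _).trans (key m)) hd.neg hub),
      hasSum_le (fun m => (le_abs_self _).trans (key m)) hd hub⟩
  loop := fun s hs => by
    have h := (hasSum_poi_one s).summable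
    have e : Real.exp (-1) ^ s = poi s 0 * ((c.K ^ 0) *ᵥ fun y => if y = 0 then (1 : ℝ) else 0) 0 := by
      rw [pow_mulVec_ind, ← Real.exp_mul]; simp [poi]
    rw [e]
    have h0 : ∀ y : Fin (n + 1), (0 : ℝ) ≤ if y = 0 then 1 else 0 := fun y => by split_ifs <;> norm_num
    have h1 : ∀ y : Fin (n + 1), (if y = 0 then (1 : ℝ) else 0) ≤ 1 := fun y => by split_ifs <;> norm_num
    have hb := pow_mulVec_mem c.subSt h0 h1
    exact ((isWt_poi hs).summable fun m => (hb m 0).2).le_tsum 0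
      fun m _ => mul_nonneg ((isWt_poi hs).1 m) (hb m 0).1
  poi_le := fun s hs x => by
    have := c.tvw_wconv_le (isWt_poi (half_pos hs).le) (isWt_poi (half_pos hs).le) x
    rw [wconv_poi, add_halves] at this
    have : 0 < 4 / s := by positivity
    linarith

end BDChain

lemma sum_bernstein_one (p : ℝ) (V : ℕ) :
    ∑ j ∈ Finset.range (V + 1), (bernsteinPolynomial ℝ V j).eval p = 1 := by
  rw [← Polynomial.eval_finsetSum, bernsteinPolynomial.sum, Polynomial.eval_one]

lemma sum_bernstein_var (p : ℝ) (V : ℕ) :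
    ∑ j ∈ Finset.range (V + 1), (V * p - j) ^ 2 * (bernsteinPolynomial ℝ V j).eval p =
      V * p * (1 - p) := by
  have := congrArg (Polynomial.eval p) (bernsteinPolynomial.variance ℝ V)
  simpa [Polynomial.eval_finsetSum] using this

lemma eval_bernstein (p : ℝ) (V j : ℕ) :
    (bernsteinPolynomial ℝ V j).eval p = V.choose j * p ^ j * (1 - p) ^ (V - j) := by
  simp [bernsteinPolynomial]

lemma bernstein_diff {p : ℝ} (hp : p < 1) {V j : ℕ} (hj : j ≤ V + 1) :
    (if j ≤ V then (bernsteinPolynomial ℝ V j).eval p else 0) -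
      (bernsteinPolynomial ℝ (V + 1) j).eval p =
    (bernsteinPolynomial ℝ (V + 1) j).eval p * (((V + 1 : ℕ) * p - j) / ((V + 1 : ℕ) * (1 - p))) := by
  have hq : 1 - p ≠ 0 := by linarith
  have hV : ((V : ℝ) + 1) ≠ 0 := by positivity
  rw [eval_bernstein, eval_bernstein]
  rcases hj.lt_or_eq with h | h
  · have hj' : j ≤ V := Nat.lt_succ_iff.1 h
    rw [if_pos hj']
    have hc : ((V + 1).choose j : ℝ) * ((V : ℝ) + 1 - j) = V.choose j * (V + 1) := by
      have := Nat.choose_mul_succ_eq V j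
      rw [← Nat.cast_inj (R := ℝ)] at this
      push_cast [Nat.cast_sub hj] at this
      linarith
    have e : V + 1 - j = (V - j) + 1 := by omega
    rw [e, pow_succ]
    push_cast
    field_simp
    linear_combination -p ^ j * hc
  · subst h
    rw [if_neg (by omega)]
    push_cast
    field_simp
    ring

namespace BDChain
variable {n : ℕ} (c : BDChain n)

/-- The kernel conditioned to use the non-lazy part. -/
def unlazy (δ : ℝ) : Matrix (Fin (n + 1)) (Fin (n + 1)) ℝ := (1 - δ)⁻¹ • (c.K - δ • 1)

lemma unlazy_subSt {δ : ℝ} (hδ : δ < 1) (h : ∀ i, δ ≤ c.K i i) : SubSt (c.unlazy δ) := by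
  have hp : 0 < (1 - δ)⁻¹ := inv_pos.2 (by linarith)
  refine ⟨fun i j => ?_, fun i => le_of_eq ?_⟩
  · refine mul_nonneg hp.le ?_
    by_cases hij : i = j
    · subst hij; simpa using h i
    · simpa [hij] using c.K_nonneg i j
  · have : ∑ j, (c.unlazy δ) i j = (1 - δ)⁻¹ * (∑ j, c.K i j - δ * ∑ j, (1 : Matrix (Fin (n + 1)) (Fin (n + 1)) ℝ) i j) := by
      simp [unlazy, Finset.mul_sum, mul_sub, Finset.sum_sub_distrib]
    rw [this, c.K_rowSum]
    have h1 : ∑ j, (1 : Matrix (Fin (n + 1)) (Fin (n + 1)) ℝ) i j = 1 := by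
      simp [Matrix.one_apply]
    rw [h1, mul_one, inv_mul_cancel₀ (by linarith)]

lemma pow_eq_sum_bernstein {δ : ℝ} (hδ : δ < 1) (V : ℕ) (f : Fin (n + 1) → ℝ) (x : Fin (n + 1)) :
    ((c.K ^ V) *ᵥ f) x = ∑ j ∈ Finset.range (V + 1),
      (bernsteinPolynomial ℝ V j).eval (1 - δ) * (((c.unlazy δ) ^ j) *ᵥ f) x := by
  have hK : c.K = (1 - δ) • c.unlazy δ + δ • 1 := by
    rw [unlazy, smul_smul, mul_inv_cancel₀ (by linarith), one_smul, sub_add_cancel]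
  have hcomm : Commute ((1 - δ) • c.unlazy δ) (δ • (1 : Matrix (Fin (n + 1)) (Fin (n + 1)) ℝ)) :=
    (Commute.one_right _).smul_right δ
  have e : c.K ^ V = ∑ j ∈ Finset.range (V + 1),
      (bernsteinPolynomial ℝ V j).eval (1 - δ) • (c.unlazy δ) ^ j := by
    conv_lhs => rw [hK]
    rw [hcomm.add_pow]
    refine Finset.sum_congr rfl fun j _ => ?_
    rw [_root_.smul_pow, _root_.smul_pow, one_pow, mul_smul_comm, mul_one, ← nsmul_eq_mul', smul_smul,
      ← Nat.cast_smul_eq_nsmul ℝ, smul_smul, eval_bernstein]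
    congr 1
    ring
  rw [e, Matrix.sum_mulVec, Finset.sum_apply]
  simp [Matrix.smul_mulVec]

lemma adapted_detTime {δ : ℝ} (hδ : 0 < δ) (hδ' : δ ≤ 1 / 2) (h : ∀ i, δ ≤ c.K i i) :
    c.Adapted detTime δ δ where
  smooth := fun f h0 h1 v hv x => by
    set V := ⌊v⌋₊ with hVdef
    have hb := pow_mulVec_mem (c.unlazy_subSt (by linarith) h) h0 h1
    unfold avgOp detTime
    rw [wavg_single, wavg_single, Matrix.mulVec_mulVec, ← pow_succ, abs_sub_comm,
      c.pow_eq_sum_bernstein (δ := δ) (by linarith), c.pow_eq_sum_bernstein (δ := δ) (by linarith)]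
    set a : ℕ → ℝ := fun j => (((c.unlazy δ) ^ j) *ᵥ f) x with ha
    set B : ℕ → ℝ := fun j => (bernsteinPolynomial ℝ (V + 1) j).eval (1 - δ) with hB
    set N : ℝ := ((V + 1 : ℕ) : ℝ) with hN
    have hNv : v ≤ N := by
      have := Nat.lt_floor_add_one v
      rw [hN]; push_cast; exact this.le
    have hN0 : 0 < N := lt_of_lt_of_le hv hNv
    have hB0 : ∀ j, 0 ≤ B j := fun j => by
      simp only [hB, eval_bernstein]
      have : 0 ≤ 1 - δ := by linarith
      have : 0 ≤ 1 - (1 - δ) := by linarith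
      positivity
    have e1 : ∑ j ∈ Finset.range (V + 1), (bernsteinPolynomial ℝ V j).eval (1 - δ) * a j =
        ∑ j ∈ Finset.range (V + 1 + 1),
          (if j ≤ V then (bernsteinPolynomial ℝ V j).eval (1 - δ) else 0) * a j := by
      rw [Finset.sum_range_succ _ (V + 1), if_neg (by omega), zero_mul, add_zero]
      refine Finset.sum_congr rfl fun j hj => ?_
      rw [if_pos (Nat.lt_succ_iff.1 (Finset.mem_range.1 hj))]
    have e2 : ∑ j ∈ Finset.range (V + 1), (bernsteinPolynomial ℝ V j).eval (1 - δ) * a j -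
        ∑ j ∈ Finset.range (V + 1 + 1), B j * a j =
        ∑ j ∈ Finset.range (V + 1 + 1), B j * ((N * (1 - δ) - j) / (N * δ)) * a j := by
      rw [e1, ← Finset.sum_sub_distrib]
      refine Finset.sum_congr rfl fun j hj => ?_
      have := bernstein_diff (p := 1 - δ) (by linarith)
        (Nat.lt_succ_iff.1 (Finset.mem_range.1 hj))
      rw [sub_sub_cancel] at this
      rw [← sub_mul, this]
    rw [e2]
    set q := √(δ * N) with hq
    have hq0 : 0 < q := Real.sqrt_pos.2 (by positivity)
    have hqq : q * q = δ * N := Real.mul_self_sqrt (by positivity)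
    have key : ∀ j, |B j * ((N * (1 - δ) - j) / (N * δ)) * a j| ≤
        1 / (2 * (q * (N * δ))) * ((N * (1 - δ) - j) ^ 2 * B j) + q / (2 * (N * δ)) * B j := by
      intro j
      set b := N * (1 - δ) - (j : ℝ)
      rw [abs_mul, abs_mul, abs_of_nonneg (hB0 j)]
      have h3 : |b / (N * δ)| ≤ 1 / (2 * (q * (N * δ))) * b ^ 2 + q / (2 * (N * δ)) := by
        rw [abs_div, abs_of_pos (show 0 < N * δ by positivity), ← sq_abs b,
          div_le_iff₀ (by positivity)]
        have e3 : (1 / (2 * (q * (N * δ))) * |b| ^ 2 + q / (2 * (N * δ))) * (N * δ) =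
            (|b| ^ 2 + q ^ 2) / (2 * q) := by field_simp
        rw [e3, le_div_iff₀ (by positivity)]
        nlinarith [sq_nonneg (|b| - q)]
      calc B j * |b / (N * δ)| * |a j| ≤ B j * |b / (N * δ)| :=
            mul_le_of_le_one_right (mul_nonneg (hB0 j) (abs_nonneg _)) (hb j x).2
        _ ≤ B j * (1 / (2 * (q * (N * δ))) * b ^ 2 + q / (2 * (N * δ))) :=
            mul_le_mul_of_nonneg_left h3 (hB0 j)
        _ = _ := by ring
    refine (Finset.abs_sum_le_sum_abs _ _).trans ((Finset.sum_le_sum fun j _ => key j).trans ?_)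
    have v1 : ∑ j ∈ Finset.range (V + 1 + 1), (N * (1 - δ) - j) ^ 2 * B j =
        N * (1 - δ) * (1 - (1 - δ)) := sum_bernstein_var (1 - δ) (V + 1)
    have v2 : ∑ j ∈ Finset.range (V + 1 + 1), B j = 1 := sum_bernstein_one (1 - δ) (V + 1)
    rw [Finset.sum_add_distrib, ← Finset.mul_sum, ← Finset.mul_sum, v1, v2]
    have hle : 1 / q ≤ 1 / √(δ * v) := one_div_le_one_div_of_le (Real.sqrt_pos.2 (by positivity))
      (Real.sqrt_le_sqrt (mul_le_mul_of_nonneg_left hNv hδ.le))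
    refine le_trans ?_ hle
    have e4 : N * δ = q * q := by rw [hqq]; ring
    have e5 : N * (1 - δ) * (1 - (1 - δ)) = (q * q) * (1 - δ) := by rw [hqq]; ring
    rw [e4, e5]
    have e6 : 1 / (2 * (q * (q * q))) * (q * q * (1 - δ)) + q / (2 * (q * q)) * 1 =
        (1 - δ / 2) * (1 / q) := by field_simp; ring
    rw [e6]
    exact mul_le_of_le_one_left (by positivity) (by linarith)
  loop := fun s hs => by
    unfold avgOp detTime
    rw [wavg_single, pow_mulVec_ind]
    refine le_trans ?_ (c.self_pow_le_loop hδ.le (h 0) _)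
    rw [← Real.rpow_natCast]
    exact Real.rpow_le_rpow_of_exponent_ge hδ (by linarith) (Nat.floor_le hs)
  poi_le := fun s hs x => by
    have hw := isWt_poi hs.le
    refine (c.tvw_le_wavg hw x).trans ?_
    have hT : ∀ m, 0 ≤ c.tvw (Pi.single m 1) x ∧ c.tvw (Pi.single m 1) x ≤ 1 := fun m =>
      ⟨c.tvw_nonneg _ x, c.tvw_le_one (isWt_single m) x⟩
    set D := c.tvw (detTime (s / 2)) x with hD
    have hD' : 0 ≤ D ∧ D ≤ 1 := hT _
    have h1 : wavg (poi s) (fun m => c.tvw (Pi.single m 1) x) ≤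
        wavg (poi s) (fun m => D + farInd s (s / 2) m) := by
      refine hw.wavg_mono (C := 1) (C' := 2) (fun m => by rw [abs_of_nonneg (hT m).1]; exact (hT m).2)
        (fun m => ?_) fun m => ?_
      · rw [abs_of_nonneg (add_nonneg hD'.1 (farInd_nonneg _ _ _))]
        have := abs_le.1 (abs_farInd_le s (s / 2) m)
        linarith [hD'.2, this.2]
      · by_cases hm : ⌊s / 2⌋₊ ≤ m
        · have := c.tvw_det_anti x hm
          have := farInd_nonneg s (s / 2) m
          simp only [hD, detTime]
          linarith
        · push Not at hm
          have h2 : (m : ℝ) < ⌊s / 2⌋₊ := by exact_mod_cast hm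
          have h3 := Nat.floor_le (half_pos hs).le
          have h4 : farInd s (s / 2) m = 1 := by
            unfold farInd
            rw [if_pos]
            rw [abs_sub_comm]
            exact le_trans (by linarith) (le_abs_self _)
          rw [h4]
          linarith [(hT m).2, hD'.1]
    refine h1.trans ?_
    rw [hw.wavg_add (fun _ => le_rfl) (abs_farInd_le s (s / 2)), hw.wavg_const]
    have := wavg_poi_farInd_le hs.le (half_pos hs)
    have e : s / (s / 2) ^ 2 = 4 / s := by field_simp; norm_num
    linarith

end BDChain

lemma mulVec_wavg {ι : Type*} [Fintype ι] (A : Matrix ι ι ℝ) {w : ℕ → ℝ} (hw : IsWt w) {g : ℕ → ι → ℝ} {C : ℝ}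
    (hg : ∀ m y, |g m y| ≤ C) (x : ι) :
    (A *ᵥ fun y => wavg w fun m => g m y) x = wavg w fun m => (A *ᵥ g m) x := by
  simp only [Matrix.mulVec, dotProduct, ← wavg_mul_left]
  rw [hw.wavg_sum Finset.univ (C := fun y => |A x y| * C) fun y m => by
    rw [abs_mul]; exact mul_le_mul_of_nonneg_left (hg m y) (abs_nonneg _)]

section Generic
variable {ι : Type*} [Fintype ι] [DecidableEq ι] {K : Matrix ι ι ℝ} {h : ι → ℤ} {M : ι} {S : ℕ → ι → ℝ}

lemma IsSurv.add_le_pow_ind (hK : SubSt K)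
    (hinj : Function.Injective h) (hskip : ∀ x y, K x y ≠ 0 → |h x - h y| ≤ 1)
    (hS : IsSurv K M S) (i j : ℕ) {x : ι} (hx : h x ≤ h M) :
    S (i + j) x ≤ ((K ^ i) *ᵥ fun y => if h y < h M then S j y else 0) x := by
  have nn : ∀ m x, 0 ≤ ((K ^ m) *ᵥ fun y => if h y < h M then S j y else 0) x := fun m x =>
    (hK.pow m).mulVec_nonneg (fun z => by
      split_ifs
      · exact hS.nonneg hK j z
      · exact le_rfl) x
  induction i generalizing x with
  | zero =>
    by_cases hxM : x = M
    · rw [hxM, hS.self]; exact nn 0 M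
    · have : h x < h M := lt_of_le_of_ne hx fun e => hxM (hinj e)
      simp [this]
  | succ i ih =>
    by_cases hxM : x = M
    · rw [hxM, hS.self]; exact nn _ M
    · have hlt : h x < h M := lt_of_le_of_ne hx fun e => hxM (hinj e)
      rw [pow_succ_mulVec, show i + 1 + j = (i + j) + 1 by ring, hS.succ _ x hxM]
      refine Finset.sum_le_sum fun y _ => ?_
      by_cases hy : K x y = 0
      · simp [hy]
      · have := _root_.abs_le.1 (hskip x y hy)
        exact mul_le_mul_of_nonneg_left (ih (by omega)) (hK.nonneg x y)

lemma crossing_avg (hK : SubSt K) (hrow : ∀ x, ∑ y, K x y = 1)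
    (hinj : Function.Injective h) (hskip : ∀ x y, K x y ≠ 0 → |h x - h y| ≤ 1)
    (hS : IsSurv K M S) {B : ℝ} (x : ι) (hx : h x ≤ h M)
    (μ : ι → ℝ) (hμ : ∀ y, 0 ≤ μ y) (hμ1 : ∑ y, μ y = 1) (hsupp : ∀ y, μ y ≠ 0 → h x ≤ h y)
    (hB : ∀ k, ∑ y, (μ ᵥ* (K ^ k)) y * (if h M < h y then 1 else 0) ≤ B)
    {ψ : ι → ℝ} {ω : ℝ} (h0 : ∀ y, 0 ≤ ψ y) (h1 : ∀ y, ψ y ≤ 1)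
    (hω : ∀ x, |(K *ᵥ ψ) x - ψ x| ≤ ω) {w : ℕ → ℝ} (hw : IsWt w) :
    avgOp K w ψ x - ∑ y, μ y * avgOp K w ψ y ≤
      wavg w (fun m => S m x) + (1 - wavg w (fun m => S m x)) * B + ω := by
  obtain ⟨C, hC⟩ := hK.exists_pow_bound ψ
  have e1 : ∑ y, μ y * avgOp K w ψ y = wavg w fun s => ∑ y, μ y * ((K ^ s) *ᵥ ψ) y := by
    simp only [avgOp, ← wavg_mul_left]
    rw [hw.wavg_sum Finset.univ (C := fun y => μ y * C) fun y m => by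
      rw [abs_mul, abs_of_nonneg (hμ y)]; exact mul_le_mul_of_nonneg_left (hC y m) (hμ y)]
  have hb2 : ∀ m, |∑ y, μ y * ((K ^ m) *ᵥ ψ) y| ≤ C := fun m => by
    refine (Finset.abs_sum_le_sum_abs _ _).trans ?_
    calc ∑ y, |μ y * ((K ^ m) *ᵥ ψ) y| ≤ ∑ y, μ y * C := Finset.sum_le_sum fun y _ => by
          rw [abs_mul, abs_of_nonneg (hμ y)]; exact mul_le_mul_of_nonneg_left (hC y m) (hμ y)
      _ = C := by rw [← Finset.sum_mul, hμ1, one_mul]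
  have hSb : ∀ m, |S m x| ≤ 1 := fun m => hS.abs_le hK m x
  have e2 : wavg w (fun m => S m x) + (1 - wavg w (fun m => S m x)) * B + ω =
      wavg w fun m => (1 - B) * S m x + (B + ω) := by
    rw [hw.wavg_add (C := |1 - B|) (fun m => by
      rw [abs_mul]; exact mul_le_of_le_one_right (abs_nonneg _) (hSb m)) (fun _ => le_rfl),
      wavg_mul_left, hw.wavg_const]
    ring
  rw [e1, e2, avgOp, ← hw.wavg_sub (hC x) hb2]
  refine hw.wavg_mono (C := C + C) (C' := |1 - B| + |B + ω|)
    (fun m => (abs_sub _ _).trans (add_le_add (hC x m) (hb2 m)))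
    (fun m => (abs_add_le _ _).trans (add_le_add (by
      rw [abs_mul]; exact mul_le_of_le_one_right (abs_nonneg _) (hSb m)) le_rfl)) fun m => ?_
  refine (crossing_bound hK hrow hinj hskip hS x hx μ hμ hμ1 hsupp hB h0 h1 hω m).trans
    (le_of_eq ?_)
  ring

end Generic

namespace BDChain
variable {n : ℕ} (c : BDChain n)

/-- The probability that the chain observed at a random time has not visited `M`. -/
def surv (w : ℕ → ℝ) (M x : Fin (n + 1)) : ℝ := wavg w (c.hitSurv M x)

lemma surv_nonneg {w : ℕ → ℝ} (hw : IsWt w) (M x : Fin (n + 1)) : 0 ≤ c.surv w M x :=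
  hw.wavg_nonneg fun m => (c.isSurv_hitSurv M).nonneg c.subSt m x

lemma hitSurv_abs (M x : Fin (n + 1)) (m : ℕ) : |c.hitSurv M x m| ≤ 1 :=
  (c.isSurv_hitSurv M).abs_le c.subSt m x

lemma surv_le_one {w : ℕ → ℝ} (hw : IsWt w) (M x : Fin (n + 1)) : c.surv w M x ≤ 1 :=
  hw.wavg_le (c.hitSurv_abs M x) fun m => (c.isSurv_hitSurv M).le_one c.subSt m x

lemma surv_abs {w : ℕ → ℝ} (hw : IsWt w) (M x : Fin (n + 1)) : |c.surv w M x| ≤ 1 :=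
  hw.abs_wavg_le (c.hitSurv_abs M x)

variable {W : ℝ → ℕ → ℝ} {κ ρ : ℝ}

lemma surv_anti (hW : TimeScale W) (M x : Fin (n + 1)) {s s' : ℝ} (hs : 0 ≤ s) (h : s ≤ s') :
    c.surv (W s') M x ≤ c.surv (W s) M x := by
  obtain ⟨w, hw, e⟩ := hW.split s s' hs h
  rw [surv, e, (hW.isWt s hs).wavg_wconv hw (c.hitSurv_abs M x)]
  refine (hW.isWt s hs).wavg_mono (fun m => hw.abs_wavg_le fun j => c.hitSurv_abs M x (m + j))
    (c.hitSurv_abs M x) fun m => ?_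
  exact hw.wavg_le (fun j => c.hitSurv_abs M x (m + j)) fun j =>
    (c.isSurv_hitSurv M).anti c.subSt x (Nat.le_add_right m j)

lemma tvw_anti (hW : TimeScale W) (x : Fin (n + 1)) {s s' : ℝ} (hs : 0 ≤ s) (h : s ≤ s') :
    c.tvw (W s') x ≤ c.tvw (W s) x := by
  obtain ⟨w, hw, e⟩ := hW.split s s' hs h
  rw [e]
  exact c.tvw_wconv_le (hW.isWt s hs) hw x

lemma tvw_add_le (hW : TimeScale W) (x : Fin (n + 1)) {s v B : ℝ} (hs : 0 ≤ s) (hv : 0 ≤ v)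
    (h : c.tvw (wconv (W s) (W v)) x ≤ B) : c.tvw (W (s + v)) x ≤ B := by
  obtain ⟨r, hr, _, hr2, e⟩ := hW.conv s v hs hv
  exact (c.tvw_anti hW x hr hr2).trans (e ▸ h)

lemma surv_add_le (hW : TimeScale W) (M x : Fin (n + 1)) {s v B : ℝ} (hs : 0 ≤ s) (hv : 0 ≤ v)
    (h : wavg (W s) (fun i => wavg (W v) fun j => c.hitSurv M x (i + j)) ≤ B) :
    c.surv (W (s + v)) M x ≤ B := by
  obtain ⟨r, hr, _, hr2, e⟩ := hW.conv s v hs hv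
  refine (c.surv_anti hW M x hr hr2).trans ?_
  rw [← e, surv, (hW.isWt s hs).wavg_wconv (hW.isWt v hv) (c.hitSurv_abs M x)]
  exact h

lemma avgOp_smooth (hW : TimeScale W) (hA : c.Adapted W κ ρ) {f : Fin (n + 1) → ℝ}
    (h0 : ∀ x, 0 ≤ f x) (h1 : ∀ x, f x ≤ 1) {v : ℝ} (hv : 0 < v) (x : Fin (n + 1)) :
    |(c.K *ᵥ avgOp c.K (W v) f) x - avgOp c.K (W v) f x| ≤ 1 / √(κ * v) := by
  rw [mulVec_avgOp_comm c.subSt (hW.isWt v hv.le)]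
  exact hA.smooth f h0 h1 v hv x

lemma tvw_cross (hW : TimeScale W) (hA : c.Adapted W κ ρ) {h : Fin (n + 1) → ℤ}
    (hinj : Function.Injective h) (hskip : ∀ x y, c.K x y ≠ 0 → |h x - h y| ≤ 1)
    {x : Fin (n + 1)} (hx : ∀ y, h x ≤ h y) (M : Fin (n + 1)) {s v B : ℝ} (hs : 0 ≤ s) (hv : 0 < v)
    (hB : c.ev (fun y => if h M < h y then 1 else 0) ≤ B) :
    c.tvw (W (s + v)) x ≤ c.surv (W s) M x + (1 - c.surv (W s) M x) * B + 1 / √(κ * v) := by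
  have hws := hW.isWt s hs
  have hwv := hW.isWt v hv.le
  refine c.tvw_add_le hW x hs hv.le (c.tvw_le (hws.conv hwv) fun f h0 h1 => ?_)
  have hst : ∀ k, c.pi ᵥ* (c.K ^ k) = c.pi := fun k => by
    induction k with
    | zero => simp
    | succ k ih =>
      rw [pow_succ, ← Matrix.vecMul_vecMul, ih]
      exact funext c.pi_stat
  have := crossing_avg c.subSt c.K_rowSum hinj hskip (c.isSurv_hitSurv M) (B := B) x (hx M) c.pi
    (fun y => (c.pi_pos y).le) c.pi_sum (fun y _ => hx y) (fun k => by rw [hst]; exact hB)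
    (ψ := avgOp c.K (W v) f) (fun y => avgOp_nonneg c.subSt hwv h0 y)
    (fun y => c.avgOp_le_one hwv h1 y) (fun y => c.avgOp_smooth hW hA h0 h1 hv y) hws
  rw [avgOp_wconv c.subSt hws hwv, ← c.ev_avgOp hwv f, ← c.ev_avgOp hws (avgOp c.K (W v) f)]
  exact this

lemma surv_le_tvw {w : ℕ → ℝ} (hw : IsWt w) {h : Fin (n + 1) → ℤ}
    (hinj : Function.Injective h) (hskip : ∀ x y, c.K x y ≠ 0 → |h x - h y| ≤ 1)
    {x M : Fin (n + 1)} (hx : h x ≤ h M) :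
    c.surv w M x ≤ c.tvw w x + c.ev (fun y => if h y < h M then 1 else 0) := by
  set f : Fin (n + 1) → ℝ := fun y => if h y < h M then 1 else 0 with hf
  have h0 : ∀ y, 0 ≤ f y := fun y => by simp only [hf]; split_ifs <;> norm_num
  have h1 : ∀ y, f y ≤ 1 := fun y => by simp only [hf]; split_ifs <;> norm_num
  have h2 := c.le_tvw hw x h0 h1
  obtain ⟨C, hC⟩ := c.subSt.exists_pow_bound f
  have h3 : c.surv w M x ≤ avgOp c.K w f x := hw.wavg_mono (c.hitSurv_abs M x) (hC x) fun m =>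
    (c.isSurv_hitSurv M).le_pow_ind c.subSt hinj hskip m hx
  linarith

lemma ev_ind_gt (M : Fin (n + 1)) :
    c.ev (fun y => if ht M < ht y then 1 else 0) = 1 - c.piLow M := by
  have h := c.tail_one_add_piLow M
  have e : c.ev (fun y => if ht M < ht y then 1 else 0) = c.tail (fun _ => 1) M := by
    simp [ev, tail, ht_lt_iff]
  linarith

lemma ev_ind_lt (M : Fin (n + 1)) :
    c.ev (fun y => if ht y < ht M then 1 else 0) = 1 - c.piHigh M := by
  rw [eq_sub_iff_add_eq, ev, piHigh, ← Finset.sum_add_distrib]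
  refine (Finset.sum_congr rfl fun y _ => ?_).trans c.pi_sum
  simp only [ht_lt_iff]
  by_cases h : y < M
  · simp [h, not_le.2 h]
  · simp [h, not_lt.1 h]

lemma piLow_le_one (M : Fin (n + 1)) : c.piLow M ≤ 1 := by
  have := c.tail_one_add_piLow M
  have := c.tail_nonneg (fun _ => zero_le_one) M
  linarith

lemma piHigh_le_one (M : Fin (n + 1)) : c.piHigh M ≤ 1 := by
  have h := c.ev_ind_lt M
  have := c.ev_nonneg (f := fun y => if ht y < ht M then 1 else 0)
    fun y => by split_ifs <;> norm_num
  linarith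

lemma htR_lt_eq (x y : Fin (n + 1)) : (htR x < htR y) = (ht y < ht x) := by
  rw [htR_lt_iff, ht_lt_iff]

lemma tvw_zero_le (hW : TimeScale W) (hA : c.Adapted W κ ρ) (M : Fin (n + 1)) {s v : ℝ}
    (hs : 0 ≤ s) (hv : 0 < v) :
    c.tvw (W (s + v)) 0 ≤ 1 - (1 - c.surv (W s) M 0) * c.piLow M + 1 / √(κ * v) := by
  have := c.tvw_cross hW hA ht_inj c.ht_skip (x := 0) (fun y => ht_le_iff.2 (Fin.zero_le y)) M
    hs hv (c.ev_ind_gt M).le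
  linarith

lemma tvw_last_le (hW : TimeScale W) (hA : c.Adapted W κ ρ) (M : Fin (n + 1)) {s v : ℝ}
    (hs : 0 ≤ s) (hv : 0 < v) :
    c.tvw (W (s + v)) (Fin.last n) ≤
      c.surv (W s) M (Fin.last n) + (1 - c.piHigh M) + 1 / √(κ * v) := by
  have h := c.tvw_cross hW hA htR_inj c.htR_skip (x := Fin.last n)
    (fun y => htR_le_iff.2 (Fin.le_last y)) M hs hv (B := 1 - c.piHigh M)
    (by simp only [htR_lt_eq]; exact (c.ev_ind_lt M).le)
  have h1 := c.surv_nonneg (hW.isWt s hs) M (Fin.last n)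
  have h2 := c.piHigh_le_one M
  nlinarith [mul_nonneg h1 (sub_nonneg.2 h2)]

lemma surv_zero_le {w : ℕ → ℝ} (hw : IsWt w) (M : Fin (n + 1)) :
    c.surv w M 0 ≤ c.tvw w 0 + (1 - c.piHigh M) := by
  have := c.surv_le_tvw hw ht_inj c.ht_skip (x := 0) (M := M) (ht_le_iff.2 (Fin.zero_le M))
  rwa [c.ev_ind_lt] at this

lemma surv_last_le {w : ℕ → ℝ} (hw : IsWt w) (M : Fin (n + 1)) :
    c.surv w M (Fin.last n) ≤ c.tvw w (Fin.last n) + (1 - c.piLow M) := by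
  have := c.surv_le_tvw hw htR_inj c.htR_skip (x := Fin.last n) (M := M)
    (htR_le_iff.2 (Fin.le_last M))
  simp only [htR_lt_eq] at this
  rwa [c.ev_ind_gt] at this

end BDChain

namespace BDChain
variable {n : ℕ} (c : BDChain n) {W : ℝ → ℕ → ℝ} {κ ρ : ℝ}

lemma piHigh_smul_sum (M : Fin (n + 1)) :
    ∑ y, (if M ≤ y then c.pi y / c.piHigh M else 0) = 1 := by
  have h : ∀ y, (if M ≤ y then c.pi y / c.piHigh M else 0) =
      (if M ≤ y then c.pi y else 0) / c.piHigh M := fun y => by split_ifs <;> simp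
  simp only [h]
  rw [← Finset.sum_div]
  exact div_self (c.piHigh_pos M).ne'

lemma vecMul_restrict_le (M M' : Fin (n + 1)) (k : ℕ) :
    ∑ y, ((fun z => if M ≤ z then c.pi z / c.piHigh M else 0) ᵥ* (c.K ^ k)) y *
      (if ht M' < ht y then 1 else 0) ≤ (1 - c.piLow M') / c.piHigh M := by
  have hp := c.piHigh_pos M
  set g : Fin (n + 1) → ℝ := fun y => if ht M' < ht y then 1 else 0 with hg
  have h0 : ∀ y, 0 ≤ g y := fun y => by simp only [hg]; split_ifs <;> norm_num
  have e : ∑ y, ((fun z => if M ≤ z then c.pi z / c.piHigh M else 0) ᵥ* (c.K ^ k)) y * g y =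
      ∑ z, (if M ≤ z then c.pi z / c.piHigh M else 0) * ((c.K ^ k) *ᵥ g) z := by
    have := Matrix.dotProduct_mulVec
      (fun z => if M ≤ z then c.pi z / c.piHigh M else 0) (c.K ^ k) g
    simp only [dotProduct] at this
    exact this.symm
  rw [e, le_div_iff₀ hp, ← c.ev_ind_gt, ← c.ev_pow _ k, Finset.sum_mul, ev]
  refine Finset.sum_le_sum fun z _ => ?_
  have hz := (c.subSt.pow k).mulVec_nonneg h0 z
  have hpz := (c.pi_pos z).le
  split_ifs
  · exact le_of_eq (by field_simp; rfl)
  · simpa using mul_nonneg hpz hz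

lemma surv_mono_start {w : ℕ → ℝ} (hw : IsWt w) {M x : Fin (n + 1)} (hx : x ≤ M) :
    c.surv w M x ≤ c.surv w M 0 :=
  hw.wavg_mono (c.hitSurv_abs M x) (c.hitSurv_abs M 0) fun m =>
    (c.isSurv_hitSurv M).mono_start c.subSt c.K_rowSum ht_inj c.ht_skip
      (ht_le_iff.2 (Fin.zero_le x)) (ht_le_iff.2 hx) m

lemma surv_le_last {w : ℕ → ℝ} (hw : IsWt w) {M x : Fin (n + 1)} (hx : M ≤ x) :
    c.surv w M x ≤ c.surv w M (Fin.last n) :=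
  hw.wavg_mono (c.hitSurv_abs M x) (c.hitSurv_abs M _) fun m =>
    (c.isSurv_hitSurv M).mono_start c.subSt c.K_rowSum htR_inj c.htR_skip
      (htR_le_iff.2 (Fin.le_last x)) (htR_le_iff.2 hx) m

lemma tvw_mid_le (hW : TimeScale W) (hA : c.Adapted W κ ρ) {x M M' : Fin (n + 1)}
    (hx : x ≤ M) (hM : M ≤ M') {s v : ℝ} (hs : 0 ≤ s) (hv : 0 < v) :
    c.tvw (W (s + v)) x ≤ c.tvw (W s) 0 +
      2 * (c.surv (W s) M' 0 + (1 - c.piLow M') / c.piHigh M + 1 / √(κ * v)) := by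
  have hws := hW.isWt s hs
  have hwv := hW.isWt v hv.le
  refine c.tvw_add_le hW x hs hv.le (c.tvw_le (hws.conv hwv) fun f h0 h1 => ?_)
  set μ : Fin (n + 1) → ℝ := fun z => if M ≤ z then c.pi z / c.piHigh M else 0 with hμ
  set B : ℝ := (1 - c.piLow M') / c.piHigh M with hB
  set ψ := avgOp c.K (W v) f with hψ
  have hp := c.piHigh_pos M
  have hB0 : 0 ≤ B := div_nonneg (sub_nonneg.2 (c.piLow_le_one M')) hp.le
  have hμ0 : ∀ y, 0 ≤ μ y := fun y => by
    simp only [hμ]; split_ifs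
    · exact div_nonneg (c.pi_pos y).le hp.le
    · exact le_rfl
  have hsupp : ∀ y, μ y ≠ 0 → M ≤ y := fun y hy => by
    by_contra h
    simp [hμ, h] at hy
  have ψ0 : ∀ y, 0 ≤ ψ y := fun y => avgOp_nonneg c.subSt hwv h0 y
  have ψ1 : ∀ y, ψ y ≤ 1 := fun y => c.avgOp_le_one hwv h1 y
  have key := fun (z : Fin (n + 1)) (hz : z ≤ M) (φ : Fin (n + 1) → ℝ) (φ0 : ∀ y, 0 ≤ φ y)
      (φ1 : ∀ y, φ y ≤ 1) (hω : ∀ y, |(c.K *ᵥ φ) y - φ y| ≤ 1 / √(κ * v)) =>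
    crossing_avg c.subSt c.K_rowSum ht_inj c.ht_skip (c.isSurv_hitSurv M') (B := B) z
      (ht_le_iff.2 (hz.trans hM)) μ hμ0 (c.piHigh_smul_sum M)
      (fun y hy => ht_le_iff.2 (hz.trans (hsupp y hy))) (fun k => c.vecMul_restrict_le M M' k)
      φ0 φ1 hω hws
  have hle : ∀ z ≤ M, c.surv (W s) M' z + (1 - c.surv (W s) M' z) * B ≤
      c.surv (W s) M' 0 + B := fun z hz => by
    have h2 := c.surv_nonneg hws M' z
    have h3 := c.surv_mono_start hws (hz.trans hM)
    nlinarith [mul_nonneg h2 hB0]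
  have k1 := key x hx ψ ψ0 ψ1 fun y => c.avgOp_smooth hW hA h0 h1 hv y
  have hK1 : ∀ y, (c.K *ᵥ fun z => 1 - ψ z) y = 1 - (c.K *ᵥ ψ) y := fun y => by
    have : (fun z => 1 - ψ z) = (fun _ => (1 : ℝ)) - ψ := rfl
    rw [this, Matrix.mulVec_sub, Pi.sub_apply]
    congr 1
    simp [Matrix.mulVec, dotProduct, c.K_rowSum]
  have k2 := key 0 (Fin.zero_le M) (fun z => 1 - ψ z) (fun y => sub_nonneg.2 (ψ1 y))
    (fun y => by linarith [ψ0 y]) fun y => by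
      rw [hK1, show 1 - (c.K *ᵥ ψ) y - (1 - ψ y) = -((c.K *ᵥ ψ) y - ψ y) by ring, abs_neg]
      exact c.avgOp_smooth hW hA h0 h1 hv y
  have e1 : ∀ y, avgOp c.K (W s) (fun z => 1 - ψ z) y = 1 - avgOp c.K (W s) ψ y := fun y => by
    rw [show (fun z => 1 - ψ z) = fun z => (fun _ => (1 : ℝ)) z - ψ z from rfl,
      avgOp_sub c.subSt hws, avgOp_const c.K_rowSum hws]
  simp only [e1, mul_sub, mul_one, Finset.sum_sub_distrib] at k2
  rw [c.piHigh_smul_sum M] at k2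
  have l1 := hle x hx
  have l2 := hle 0 (Fin.zero_le M)
  have h5 := c.le_tvw (hws.conv hwv) 0 h0 h1
  have h6 := c.tvw_wconv_le hws hwv 0
  rw [avgOp_wconv c.subSt hws hwv] at h5 ⊢
  simp only [surv] at l1 l2 ⊢
  linarith

lemma pow_mulVec_avgOp {w : ℕ → ℝ} (hw : IsWt w) (k : ℕ) (f : Fin (n + 1) → ℝ)
    (x : Fin (n + 1)) :
    ((c.K ^ k) *ᵥ avgOp c.K w f) x = avgOp c.K w ((c.K ^ k) *ᵥ f) x := by
  rw [mulVec_avgOp c.subSt hw, avgOp]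
  congr 1
  funext m
  rw [Matrix.mulVec_mulVec, ← pow_add, ← pow_add, Nat.add_comm k m]

lemma tvw_le_surv_add (hW : TimeScale W) (M x : Fin (n + 1)) {s u : ℝ} (hs : 0 ≤ s)
    (hu : 0 ≤ u) : c.tvw (W (s + u)) x ≤ c.surv (W u) M x + c.tvw (W s) M := by
  have hws := hW.isWt s hs
  have hwu := hW.isWt u hu
  rw [add_comm s u]
  refine c.tvw_add_le hW x hu hs (c.tvw_le (hwu.conv hws) fun f h0 h1 => ?_)
  rw [avgOp_wconv c.subSt hwu hws]
  set φ := avgOp c.K (W s) f with hφ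
  set D := c.ev f + c.tvw (W s) M with hD
  have hD0 : 0 ≤ D := add_nonneg (c.ev_nonneg h0) (c.tvw_nonneg _ _)
  have hM : ∀ k, ((c.K ^ k) *ᵥ φ) M ≤ D := fun k => by
    rw [hφ, c.pow_mulVec_avgOp hws]
    have h := c.le_tvw hws M (f := (c.K ^ k) *ᵥ f)
      (fun y => (pow_mulVec_mem c.subSt h0 h1 k y).1)
      (fun y => (_root_.abs_le.1 (pow_mulVec_mem c.subSt h0 h1 k y).2).2)
    rw [c.ev_pow] at h
    linarith
  obtain ⟨C, hC⟩ := c.subSt.exists_pow_bound φ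
  have h : avgOp c.K (W u) φ x ≤ wavg (W u) fun m => c.hitSurv M x m + D :=
    hwu.wavg_mono (C' := 1 + |D|) (hC x)
      (fun m => (abs_add_le _ _).trans (add_le_add (c.hitSurv_abs M x m) le_rfl))
      fun m => (c.isSurv_hitSurv M).pow_le c.subSt c.K_rowSum
        (fun y => c.avgOp_le_one hws h1 y) hD0 hM m x
  rw [hwu.wavg_add (c.hitSurv_abs M x) (fun _ => le_rfl), hwu.wavg_const] at h
  rw [surv]
  linarith

lemma surv_le_hitMean (hW : TimeScale W) (M : Fin (n + 1)) {u : ℝ} (hu : 0 < u) :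
    c.surv (W u) M (Fin.last n) ≤ 4 * (u + 1) / u ^ 2 + 2 * c.hitMean M (Fin.last n) / u := by
  have hw := hW.isWt u hu.le
  have h := hW.cheb u (u / 2) hu.le (by positivity)
  set H := c.hitMean M (Fin.last n)
  have hnn : ∀ m, 0 ≤ c.hitSurv M (Fin.last n) m := fun m =>
    (c.isSurv_hitSurv M).nonneg c.subSt m _
  have hH0 : 0 ≤ H := tsum_nonneg hnn
  have hq : ∀ m, c.hitSurv M (Fin.last n) m ≤ farInd u (u / 2) m + 2 * H / u := fun m => by
    have hHu : 0 ≤ 2 * H / u := by positivity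
    by_cases hf : u / 2 ≤ |(m : ℝ) - u|
    · have := (c.isSurv_hitSurv M).le_one c.subSt m (Fin.last n)
      rw [farInd, if_pos hf]; linarith
    · rw [farInd, if_neg hf, zero_add, le_div_iff₀ hu]
      have hm : u / 2 ≤ m := by
        have := (_root_.abs_lt.1 (not_le.1 hf)).1
        linarith
      have h1 : (m : ℝ) * c.hitSurv M (Fin.last n) m ≤ H := by
        calc (m : ℝ) * c.hitSurv M (Fin.last n) m
            = ∑ k ∈ Finset.range m, c.hitSurv M (Fin.last n) m := by simp
          _ ≤ ∑ k ∈ Finset.range m, c.hitSurv M (Fin.last n) k :=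
              Finset.sum_le_sum fun k hk => (c.isSurv_hitSurv M).anti c.subSt _
                (Finset.mem_range.1 hk).le
          _ ≤ H := (c.summable_surv (Fin.le_last M)).sum_le_tsum _ fun k _ => hnn k
      nlinarith [hnn m]
  have h2 : c.surv (W u) M (Fin.last n) ≤ wavg (W u) fun m => farInd u (u / 2) m + 2 * H / u :=
    hw.wavg_mono (C' := 1 + |2 * H / u|) (c.hitSurv_abs M _)
      (fun m => (abs_add_le _ _).trans (add_le_add (abs_farInd_le _ _ m) le_rfl)) hq
  rw [hw.wavg_add (abs_farInd_le _ _) (fun _ => le_rfl), hw.wavg_const] at h2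
  have e : (u + 1) / (u / 2) ^ 2 = 4 * (u + 1) / u ^ 2 := by field_simp; ring
  linarith

lemma surv_after_mh (hW : TimeScale W) (M : Fin (n + 1)) {s a : ℝ} (hs : 0 ≤ s) (ha : 0 < a)
    (h : c.mh M (Fin.last n) + 2 * a ≤ s) :
    c.surv (W s) M (Fin.last n) ≤ (s + 1) / a ^ 2 + c.vh M (Fin.last n) / a ^ 2 := by
  have hw := hW.isWt s hs
  have hc := hW.cheb s a hs ha
  set V := c.vh M (Fin.last n) / a ^ 2 with hV
  have hV0 : 0 ≤ V := div_nonneg (c.vh_nonneg M _) (sq_nonneg a)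
  have h2 : c.surv (W s) M (Fin.last n) ≤ wavg (W s) fun m => farInd s a m + V :=
    hw.wavg_mono (C' := 1 + |V|) (c.hitSurv_abs M _)
      (fun m => (abs_add_le _ _).trans (add_le_add (abs_farInd_le _ _ m) le_rfl)) fun m => by
      by_cases hf : a ≤ |(m : ℝ) - s|
      · have := (c.isSurv_hitSurv M).le_one c.subSt m (Fin.last n)
        rw [farInd, if_pos hf]; linarith
      · rw [farInd, if_neg hf, zero_add, hV, le_div_iff₀ (by positivity)]
        have := (_root_.abs_lt.1 (not_le.1 hf)).1
        have h3 := c.surv_upper M ha.le m (s := c.mh M (Fin.last n)) (by linarith)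
          (Fin.le_last M)
        simpa [dev] using h3
  rw [hw.wavg_add (abs_farInd_le _ _) (fun _ => le_rfl), hw.wavg_const] at h2
  linarith

lemma surv_before_mh (hW : TimeScale W) (M : Fin (n + 1)) {s a : ℝ} (hs : 0 ≤ s) (ha : 0 < a)
    (h : s + 2 * a ≤ c.mh M (Fin.last n)) :
    1 - c.surv (W s) M (Fin.last n) ≤ (s + 1) / a ^ 2 + c.vh M (Fin.last n) / a ^ 2 := by
  have hw := hW.isWt s hs
  have hc := hW.cheb s a hs ha
  set V := c.vh M (Fin.last n) / a ^ 2 with hV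
  have hV0 : 0 ≤ V := div_nonneg (c.vh_nonneg M _) (sq_nonneg a)
  have h2 : wavg (W s) (fun m => 1 - c.hitSurv M (Fin.last n) m) ≤
      wavg (W s) fun m => farInd s a m + V :=
    hw.wavg_mono (C := 1 + 1) (C' := 1 + |V|)
      (fun m => (abs_sub _ _).trans (add_le_add (by simp) (c.hitSurv_abs M _ m)))
      (fun m => (abs_add_le _ _).trans (add_le_add (abs_farInd_le _ _ m) le_rfl)) fun m => by
      by_cases hf : a ≤ |(m : ℝ) - s|
      · have := (c.isSurv_hitSurv M).nonneg c.subSt m (Fin.last n)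
        rw [farInd, if_pos hf]; linarith
      · rw [farInd, if_neg hf, zero_add, hV, le_div_iff₀ (by positivity), mul_comm]
        have := (_root_.abs_lt.1 (not_le.1 hf)).2
        have h3 := c.surv_lower M ha.le m (s := c.mh M (Fin.last n)) (by linarith)
          (Fin.le_last M)
        simpa [dev] using h3
  rw [hw.wavg_add (abs_farInd_le _ _) (fun _ => le_rfl), hw.wavg_const,
    hw.wavg_sub (fun _ => le_rfl) (c.hitSurv_abs M _), hw.wavg_const] at h2
  rw [surv]
  linarith

lemma surv_mul_le (hW : TimeScale W) {a M : Fin (n + 1)} (ha : a ≤ M) {s w : ℝ} (hs : 0 ≤ s)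
    (hw : 0 ≤ w) (hsw : 2 ≤ s + w) :
    c.surv (W s) a 0 * c.surv (W w) M a ≤ c.surv (W (s + w - 2)) M 0 := by
  have hws := hW.isWt s hs
  have hww := hW.isWt w hw
  obtain ⟨r, hr, hr2, _, e⟩ := hW.conv s w hs hw
  refine le_trans ?_ (c.surv_anti hW M 0 (by linarith) hr2)
  rw [← e, surv, surv, surv, hws.wavg_wconv hww (c.hitSurv_abs M 0), mul_comm, ← wavg_mul_left]
  refine hws.wavg_mono (C := 1) (fun i => ?_)
    (fun m => hww.abs_wavg_le fun j => c.hitSurv_abs M 0 (m + j)) fun i => ?_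
  · rw [abs_mul]
    exact mul_le_one₀ (hww.abs_wavg_le (c.hitSurv_abs M a)) (abs_nonneg _) (c.hitSurv_abs a 0 i)
  · rw [mul_comm, ← wavg_mul_left]
    refine hww.wavg_mono (C := 1) (fun j => ?_) (fun j => c.hitSurv_abs M 0 (i + j)) fun j => ?_
    · rw [abs_mul]
      exact mul_le_one₀ (c.hitSurv_abs a 0 i) (abs_nonneg _) (c.hitSurv_abs M a j)
    · exact (c.isSurv_hitSurv M).mul_le c.subSt c.K_rowSum ht_inj c.ht_skip (c.isSurv_hitSurv a)
        (ht_le_iff.2 ha) i j (ht_le_iff.2 (Fin.zero_le a))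

/-- The stationary probability of starting below `M` and not having visited `M` yet. -/
def statSurv (w : ℕ → ℝ) (M : Fin (n + 1)) : ℝ :=
  c.ev fun y => if y < M then c.surv w M y else 0

lemma statSurv_le_one {w : ℕ → ℝ} (hw : IsWt w) (M : Fin (n + 1)) : c.statSurv w M ≤ 1 := by
  refine (c.ev_mono fun y => ?_).trans (c.ev_const 1).le
  split_ifs
  · exact c.surv_le_one hw M y
  · exact zero_le_one

lemma statSurv_anti (hW : TimeScale W) (M : Fin (n + 1)) {s s' : ℝ} (hs : 0 ≤ s) (h : s ≤ s') :
    c.statSurv (W s') M ≤ c.statSurv (W s) M := by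
  refine c.ev_mono fun y => ?_
  split_ifs
  · exact c.surv_anti hW M y hs h
  · exact le_rfl

lemma surv_zero_add_le (hW : TimeScale W) (M : Fin (n + 1)) {s u : ℝ} (hs : 0 ≤ s)
    (hu : 0 ≤ u) : c.surv (W (s + u)) M 0 ≤ c.tvw (W s) 0 + c.statSurv (W u) M := by
  have hws := hW.isWt s hs
  have hwu := hW.isWt u hu
  refine c.surv_add_le hW M 0 hs hu ?_
  set g : ℕ → Fin (n + 1) → ℝ := fun j y => if ht y < ht M then c.hitSurv M y j else 0 with hg
  have hgb : ∀ j y, |g j y| ≤ 1 := fun j y => by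
    simp only [hg]; split_ifs
    · exact c.hitSurv_abs M y j
    · simp
  set G : Fin (n + 1) → ℝ := fun y => wavg (W u) fun j => g j y with hG
  have hGe : G = fun y => if y < M then c.surv (W u) M y else 0 := by
    funext y
    simp only [hG, hg, ht_lt_iff]
    by_cases h : y < M
    · simp only [h, if_true]; rfl
    · simp only [h, if_false]; exact hwu.wavg_const 0
  have hG0 : ∀ y, 0 ≤ G y := fun y => by
    rw [hGe]; dsimp only; split_ifs
    · exact c.surv_nonneg hwu M y
    · exact le_rfl
  have hG1 : ∀ y, G y ≤ 1 := fun y => by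
    rw [hGe]; dsimp only; split_ifs
    · exact c.surv_le_one hwu M y
    · exact zero_le_one
  have h1 := c.le_tvw hws 0 hG0 hG1
  obtain ⟨C, hC⟩ := c.subSt.exists_pow_bound G
  have h2 : wavg (W s) (fun i => wavg (W u) fun j => c.hitSurv M 0 (i + j)) ≤
      avgOp c.K (W s) G 0 := by
    refine hws.wavg_mono (fun m => hwu.abs_wavg_le fun j => c.hitSurv_abs M 0 (m + j)) (hC 0)
      fun i => ?_
    rw [hG, mulVec_wavg (c.K ^ i) hwu hgb]
    refine hwu.wavg_mono (C' := 1) (fun j => c.hitSurv_abs M 0 (i + j))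
      (fun j => (c.subSt.pow i).abs_mulVec_le (hgb j) 0) fun j => ?_
    exact (c.isSurv_hitSurv M).add_le_pow_ind c.subSt ht_inj c.ht_skip i j
      (ht_le_iff.2 (Fin.zero_le M))
  rw [statSurv, ← hGe]
  linarith

lemma statSurv_add_le (hW : TimeScale W) (a M : Fin (n + 1)) {u w : ℝ} (hu : 0 ≤ u)
    (hw : 0 ≤ w) :
    c.statSurv (W (u + w)) M ≤ c.surv (W w) M a * c.statSurv (W u) M + (1 - c.piHigh a) := by
  have hwu := hW.isWt u hu
  have hww := hW.isWt w hw
  set g : Fin (n + 1) → ℝ := fun y => if ht y < ht a then 1 else 0 with hg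
  have g0 : ∀ y, 0 ≤ g y := fun y => by simp only [hg]; split_ifs <;> norm_num
  obtain ⟨C, hC⟩ := c.subSt.exists_pow_bound g
  have key : ∀ y, y < M → c.surv (W (u + w)) M y ≤
      c.surv (W w) M a * c.surv (W u) M y + avgOp c.K (W u) g y := fun y hy => by
    refine c.surv_add_le hW M y hu hw ?_
    have e : c.surv (W w) M a * c.surv (W u) M y + avgOp c.K (W u) g y =
        wavg (W u) fun i => c.surv (W w) M a * c.hitSurv M y i + ((c.K ^ i) *ᵥ g) y := by
      rw [hwu.wavg_add (C := 1) (fun i => ?_) (hC y), wavg_mul_left]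
      · rfl
      · rw [abs_mul]
        exact mul_le_one₀ (c.surv_abs hww M a) (abs_nonneg _) (c.hitSurv_abs M y i)
    rw [e]
    refine hwu.wavg_mono (C' := 1 + C)
      (fun m => hww.abs_wavg_le fun j => c.hitSurv_abs M y (m + j))
      (fun i => (abs_add_le _ _).trans (add_le_add ?_ (hC y i))) fun i => ?_
    · rw [abs_mul]
      exact mul_le_one₀ (c.surv_abs hww M a) (abs_nonneg _) (c.hitSurv_abs M y i)
    · have e2 : c.surv (W w) M a * c.hitSurv M y i + ((c.K ^ i) *ᵥ g) y =
          wavg (W w) fun j => c.hitSurv M y i * c.hitSurv M a j + ((c.K ^ i) *ᵥ g) y := by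
        rw [hww.wavg_add (C := 1) (fun j => ?_) (fun _ => le_rfl), wavg_mul_left, hww.wavg_const,
          mul_comm]
        · rfl
        · rw [abs_mul]
          exact mul_le_one₀ (c.hitSurv_abs M y i) (abs_nonneg _) (c.hitSurv_abs M a j)
      rw [e2]
      refine hww.wavg_mono (C' := 1 + C) (fun j => c.hitSurv_abs M y (i + j))
        (fun j => (abs_add_le _ _).trans (add_le_add ?_ (hC y i))) fun j => ?_
      · rw [abs_mul]
        exact mul_le_one₀ (c.hitSurv_abs M y i) (abs_nonneg _) (c.hitSurv_abs M a j)
      · have := (c.isSurv_hitSurv M).add_le c.subSt c.K_rowSum ht_inj c.ht_skip (a := a) i j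
          (ht_le_iff.2 hy.le)
        rwa [mul_comm] at this
  have hev : c.ev (avgOp c.K (W u) g) = 1 - c.piHigh a := by
    rw [c.ev_avgOp hwu, hg, c.ev_ind_lt]
  rw [← hev, statSurv, statSurv, ← c.ev_smul, ← c.ev_add]
  refine c.ev_mono fun y => ?_
  by_cases hy : y < M
  · simpa [hy] using key y hy
  · simpa [hy] using avgOp_nonneg c.subSt hwu g0 y

lemma rpow_le_tvw (hW : TimeScale W) (hA : c.Adapted W κ ρ) (hρ : 0 < ρ) (hρ1 : ρ ≤ 1)
    {s s' : ℝ} (hs : 0 ≤ s) (h : s ≤ s') :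
    ρ ^ s' ≤ 1 - c.tvw (W s) 0 + c.tvw (W s') 0 := by
  have hws := hW.isWt s hs
  have hws' := hW.isWt s' (hs.trans h)
  set e : Fin (n + 1) → ℝ := fun y => if y = 0 then 1 else 0 with he
  have e0 : ∀ y, 0 ≤ e y := fun y => by simp only [he]; split_ifs <;> norm_num
  have e1 : ∀ y, e y ≤ 1 := fun y => by simp only [he]; split_ifs <;> norm_num
  have hev : c.ev e = c.pi 0 := by simp [ev, he]
  have h1 := c.le_tvw hws' 0 e0 e1
  have h2 := hA.loop s' (hs.trans h)
  have h3 := hA.loop s hs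
  have h4 : ρ ^ s' ≤ ρ ^ s := Real.rpow_le_rpow_of_exponent_ge hρ hρ1 h
  have hD := c.tvw_nonneg (W s') 0
  suffices c.tvw (W s) 0 ≤ 1 - (ρ ^ s' - c.tvw (W s') 0) by linarith
  refine c.tvw_le hws fun f f0 f1 => ?_
  have h5 : avgOp c.K (W s) f 0 ≤ 1 - (1 - f 0) * avgOp c.K (W s) e 0 := by
    have : avgOp c.K (W s) (fun y => 1 - (1 - f 0) * e y) 0 =
        1 - (1 - f 0) * avgOp c.K (W s) e 0 := by
      have hh := avgOp_sub c.subSt hws (fun _ => (1 : ℝ)) (fun y => (1 - f 0) * e y) 0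
      rw [avgOp_const c.K_rowSum hws] at hh
      refine hh.trans ?_
      congr 1
      exact avgOp_smul c.K (W s) (1 - f 0) e 0
    rw [← this]
    refine avgOp_mono c.subSt hws (fun y => ?_) 0
    by_cases hy : y = 0
    · simp [he, hy]
    · simpa [he, hy] using f1 y
  have h6 : f 0 * c.pi 0 ≤ c.ev f := by
    rw [ev, mul_comm]
    exact Finset.single_le_sum (f := fun y => c.pi y * f y)
      (fun y _ => mul_nonneg (c.pi_pos y).le (f0 y)) (Finset.mem_univ 0)
  nlinarith [f0 0, f1 0, mul_le_mul_of_nonneg_left (show ρ ^ s' - c.tvw (W s') 0 ≤ c.pi 0 by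
    linarith) (f0 0), mul_le_mul_of_nonneg_left (show ρ ^ s' - c.tvw (W s') 0 ≤
    avgOp c.K (W s) e 0 by linarith) (sub_nonneg.2 (f1 0))]

end BDChain

lemma integrableOn_poi (m : ℕ) : IntegrableOn (fun t => poi t m) (Set.Ioi 0) := by
  have h := Real.GammaIntegral_convergent (s := (m : ℝ) + 1) (by positivity)
  simp only [add_sub_cancel_right, Real.rpow_natCast] at h
  exact h.div_const _

lemma integral_poi (m : ℕ) : ∫ t in Set.Ioi (0 : ℝ), poi t m = 1 := by
  have h := Real.Gamma_eq_integral (s := (m : ℝ) + 1) (by positivity)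
  rw [Real.Gamma_nat_eq_factorial] at h
  simp only [add_sub_cancel_right, Real.rpow_natCast] at h
  simp only [poi]
  rw [integral_div, ← h]
  exact div_self (by positivity)

namespace BDChain
variable {n : ℕ} (c : BDChain n)

lemma hitMeanC_eq {M x : Fin (n + 1)} (hx : M ≤ x) : c.hitMeanC M x = c.hitMean M x := by
  have hnn : ∀ m, 0 ≤ c.hitSurv M x m := fun m => (c.isSurv_hitSurv M).nonneg c.subSt m x
  have e : ∀ m, ∫ t in Set.Ioi (0 : ℝ), poi t m * c.hitSurv M x m = c.hitSurv M x m := fun m => by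
    rw [integral_mul_const, integral_poi, one_mul]
  have hs : Summable fun m => ∫ t in Set.Ioi (0 : ℝ), ‖poi t m * c.hitSurv M x m‖ := by
    refine (c.summable_surv hx).congr fun m => (e m).symm.trans ?_
    refine setIntegral_congr_fun measurableSet_Ioi fun t ht => ?_
    exact (Real.norm_of_nonneg (mul_nonneg ((isWt_poi (le_of_lt ht)).1 m) (hnn m))).symm
  have h := hasSum_integral_of_summable_integral_norm
    (fun m => (integrableOn_poi m).mul_const (c.hitSurv M x m)) hs
  simp only [e] at h
  exact h.tsum_eq.symm

/-- The maximal total variation distance at a random time. -/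
def tvwMax (w : ℕ → ℝ) : ℝ := ⨆ x, c.tvw w x

lemma tvw_le_tvwMax (w : ℕ → ℝ) (x : Fin (n + 1)) : c.tvw w x ≤ c.tvwMax w :=
  le_ciSup (Set.finite_range _).bddAbove x

lemma tvwMax_le {w : ℕ → ℝ} {B : ℝ} (h : ∀ x, c.tvw w x ≤ B) : c.tvwMax w ≤ B := ciSup_le h

lemma tvwMax_anti {W : ℝ → ℕ → ℝ} (hW : TimeScale W) {s s' : ℝ} (hs : 0 ≤ s) (h : s ≤ s') :
    c.tvwMax (W s') ≤ c.tvwMax (W s) :=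
  c.tvwMax_le fun x => (c.tvw_anti hW x hs h).trans (c.tvw_le_tvwMax _ x)

lemma dTV_eq (x : Fin (n + 1)) (m : ℕ) : c.dTV x m = c.tvw (Pi.single m 1) x := by
  simp only [dTV, tvw, wavg_single]

lemma dTVMax_eq (m : ℕ) : c.dTVMax m = c.tvwMax (Pi.single m 1) := by
  simp only [dTVMax, tvwMax, dTV_eq]

end BDChain

/-- The distance profiles `d` drop abruptly from one to zero around the times `t`. -/
def AbruptAt (d : ℕ → ℝ → ℝ) (t : ℕ → ℝ) : Prop :=
  ∀ η ∈ Set.Ioo (0 : ℝ) 1, ∀ ε ∈ Set.Ioo (0 : ℝ) 1,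
    ∀ᶠ n in atTop, ε < d n ((1 - η) * t n) ∧ d n ((1 + η) * t n) ≤ ε

lemma abruptAt_of_bounds {d : ℕ → ℝ → ℝ} {T : ℝ → ℕ → ℝ} {t : ℕ → ℝ} (ht : ∀ n, 0 < t n)
    (h : ∀ n ε s, 0 ≤ s → s < T ε n → ε < d n s)
    (h' : ∀ n ε s, 0 < T ε n → T ε n < s → d n s ≤ ε) (hT : cutoffWith T t) : AbruptAt d t := by
  intro η hη ε hε
  have hlim := hT ε hε
  filter_upwards [hlim.eventually (lt_mem_nhds (show 1 - η < 1 by linarith [hη.1])),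
    hlim.eventually (gt_mem_nhds (show 1 < 1 + η by linarith [hη.1]))] with n h1 h2
  have h1 := (lt_div_iff₀ (ht n)).1 h1
  have h2 := (div_lt_iff₀ (ht n)).1 h2
  have hpos : 0 < (1 - η) * t n := mul_pos (sub_pos.2 hη.2) (ht n)
  exact ⟨h n ε _ hpos.le h1, h' n ε _ (hpos.trans h1) h2⟩

lemma cutoffWith_of_bounds {d : ℕ → ℝ → ℝ} {T : ℝ → ℕ → ℝ} {t : ℕ → ℝ} (ht : ∀ n, 0 < t n)
    (h : ∀ n ε s s', 0 ≤ s → s ≤ s' → ε < d n s → d n s' ≤ ε → s ≤ T ε n ∧ T ε n ≤ s')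
    (hd : AbruptAt d t) : cutoffWith T t := by
  intro ε hε
  rw [Metric.tendsto_nhds]
  intro δ hδ
  set η := min (δ / 2) (1 / 2) with hη
  have hη0 : 0 < η := by positivity
  have hη1 : η ≤ 1 / 2 := min_le_right _ _
  have hηδ : η ≤ δ / 2 := min_le_left _ _
  filter_upwards [hd η ⟨hη0, by linarith⟩ ε hε] with n hn
  have htn := ht n
  obtain ⟨h1, h2⟩ := h n ε _ _ (mul_nonneg (by linarith) htn.le)
    (mul_le_mul_of_nonneg_right (by linarith) htn.le) hn.1 hn.2
  rw [Real.dist_eq, _root_.abs_lt]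
  constructor
  · have := (le_div_iff₀ htn).2 h1; linarith
  · have := (div_le_iff₀ htn).2 h2; linarith

lemma cutoffWith_mixC_iff {d : ℕ → ℝ → ℝ} (hd : ∀ n s s', 0 ≤ s → s ≤ s' → d n s' ≤ d n s)
    {t : ℕ → ℝ} (ht : ∀ n, 0 < t n) :
    cutoffWith (fun ε n => mixC (d n) ε) t ↔ AbruptAt d t := by
  have hb : ∀ n ε, BddBelow {s : ℝ | 0 ≤ s ∧ d n s ≤ ε} := fun n ε => ⟨0, fun s hs => hs.1⟩
  constructor
  · refine abruptAt_of_bounds ht (fun n ε s hs h => ?_) fun n ε s h0 h => ?_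
    · by_contra hc
      exact absurd (csInf_le (hb n ε) ⟨hs, not_lt.1 hc⟩) (not_le.2 h)
    · have hne : {s : ℝ | 0 ≤ s ∧ d n s ≤ ε}.Nonempty := by
        by_contra hc
        rw [Set.not_nonempty_iff_eq_empty] at hc
        simp [mixC, hc] at h0
      obtain ⟨r, hr, hrs⟩ := exists_lt_of_csInf_lt hne h
      exact (hd n r s hr.1 hrs.le).trans hr.2
  · refine cutoffWith_of_bounds ht fun n ε s s' hs hss h h' => ⟨?_, ?_⟩
    · refine le_csInf ⟨s', hs.trans hss, h'⟩ fun r hr => ?_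
      by_contra hc
      exact absurd ((hd n r s hr.1 (not_le.1 hc).le).trans hr.2) (not_le.2 h)
    · exact csInf_le (hb n ε) ⟨hs.trans hss, h'⟩

lemma cutoffWith_mixD_iff {d : ℕ → ℕ → ℝ} (hd : ∀ n, Antitone (d n)) {t : ℕ → ℝ}
    (ht : ∀ n, 0 < t n) :
    cutoffWith (fun ε n => (mixD (d n) ε : ℝ)) t ↔ AbruptAt (fun n s => d n ⌊s⌋₊) t := by
  constructor
  · refine abruptAt_of_bounds ht (fun n ε s hs h => ?_) fun n ε s h0 h => ?_
    · by_contra hc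
      have : mixD (d n) ε ≤ ⌊s⌋₊ := Nat.sInf_le (not_lt.1 hc)
      exact absurd ((Nat.cast_le.2 this).trans (Nat.floor_le hs)) (not_le.2 h)
    · have hne : {m : ℕ | d n m ≤ ε}.Nonempty := by
        by_contra hc
        rw [Set.not_nonempty_iff_eq_empty] at hc
        simp [mixD, hc] at h0
      exact (hd n (Nat.le_floor h.le)).trans (Nat.sInf_mem hne)
  · refine cutoffWith_of_bounds ht fun n ε s s' hs hss h h' => ⟨?_, ?_⟩
    · by_contra hc
      have hm : d n (mixD (d n) ε) ≤ ε := Nat.sInf_mem (s := {m : ℕ | d n m ≤ ε}) ⟨_, h'⟩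
      exact absurd ((hd n (Nat.le_floor (not_le.1 hc).le)).trans hm) (not_le.2 h)
    · exact (Nat.cast_le.2 (Nat.sInf_le (s := {m : ℕ | d n m ≤ ε}) h')).trans
        (Nat.floor_le (hs.trans hss))

namespace BDChain
variable {n : ℕ} (c : BDChain n)

lemma exists_quantile {p : ℝ} (hp0 : 0 ≤ p) (hp : p ≤ 1) :
    ∃ a, p ≤ c.piLow a ∧ 1 - p ≤ c.piHigh a ∧ ∀ M, p ≤ c.piLow M → a ≤ M := by
  classical
  have hlast : c.piLow (Fin.last n) = 1 := by simp [piLow, Fin.le_last, c.pi_sum]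
  obtain ⟨a, ha, hmin⟩ := (Finset.univ.filter fun M => p ≤ c.piLow M).exists_minimal
    ⟨Fin.last n, by simp [hlast, hp]⟩
  have ha' : p ≤ c.piLow a := by simpa using ha
  have hmin' : ∀ M, p ≤ c.piLow M → a ≤ M := fun M hM => by
    rcases le_total a M with h | h
    · exact h
    · exact hmin (by simpa using hM) h
  refine ⟨a, ha', ?_, hmin'⟩
  by_contra hc
  have h1 := c.ev_ind_lt a
  have hpev : c.ev (fun y => if ht y < ht a then 1 else 0) > p := by linarith
  by_cases h0 : (a : ℕ) = 0
  · have : c.ev (fun y => if ht y < ht a then (1 : ℝ) else 0) = 0 := by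
      simp only [ht_lt_iff, ev]
      refine Finset.sum_eq_zero fun y _ => ?_
      rw [if_neg (by rw [Fin.lt_def]; omega), mul_zero]
    linarith
  · let b : Fin (n + 1) := ⟨a - 1, by omega⟩
    have hb : c.piLow b = c.ev (fun y => if ht y < ht a then 1 else 0) := by
      simp only [ht_lt_iff, ev, piLow]
      refine Finset.sum_congr rfl fun y _ => ?_
      have : y ≤ b ↔ y < a := by
        rw [Fin.le_def, Fin.lt_def]; change (y : ℕ) ≤ a - 1 ↔ _; omega
      simp [this]
    have := hmin' b (by rw [hb]; exact hpev.le)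
    rw [Fin.le_def] at this
    change (a : ℕ) ≤ a - 1 at this
    omega

end BDChain

lemma eventually_inv_sqrt_le {t : ℕ → ℝ} (h : Tendsto t atTop atTop) {κ a δ : ℝ} (hκ : 0 < κ)
    (ha : 0 < a) (hδ : 0 < δ) : ∀ᶠ n in atTop, 1 / √(κ * (a * t n)) ≤ δ := by
  have h1 : Tendsto (fun n => 1 / √(κ * (a * t n))) atTop (nhds 0) := by
    simp only [one_div]
    exact tendsto_inv_atTop_zero.comp (Real.tendsto_sqrt_atTop.comp
      ((h.const_mul_atTop ha).const_mul_atTop hκ))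
  filter_upwards [h1.eventually (gt_mem_nhds hδ)] with n hn using hn.le

lemma eventually_affine_div_sq_le {t : ℕ → ℝ} (h : Tendsto t atTop atTop) {a b δ : ℝ}
    (hb : 0 < b) (hδ : 0 < δ) :
    ∀ᶠ n in atTop, ∀ s, t n ≤ s → (a * s + 1) / (b * s) ^ 2 ≤ δ := by
  filter_upwards [h.eventually_ge_atTop (max 1 ((a + 1) / (b ^ 2 * δ)))] with n hn s hs
  have h1 : 1 ≤ s := (le_max_left _ _).trans (hn.trans hs)
  have h2 : (a + 1) / (b ^ 2 * δ) ≤ s := (le_max_right _ _).trans (hn.trans hs)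
  rw [div_le_iff₀ (by positivity)] at h2 ⊢
  calc a * s + 1 ≤ (a + 1) * s := by linarith
    _ ≤ (s * (b ^ 2 * δ)) * s := mul_le_mul_of_nonneg_right h2 (by linarith)
    _ = _ := by ring

namespace AbruptAt
variable {d : ℕ → ℝ → ℝ} {t : ℕ → ℝ}

lemma upper (h : AbruptAt d t) {η ε : ℝ} (h0 : 0 < η) (h1 : η < 1) (hε : 0 < ε) :
    ∀ᶠ n in atTop, d n ((1 + η) * t n) ≤ ε := by
  filter_upwards [h η ⟨h0, h1⟩ (min ε (1 / 2))
    ⟨by positivity, (min_le_right _ _).trans_lt (by norm_num)⟩] with n hn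
  exact hn.2.trans (min_le_left _ _)

lemma lower (h : AbruptAt d t) {η ε : ℝ} (h0 : 0 < η) (h1 : η < 1) (hε : 0 < ε) :
    ∀ᶠ n in atTop, 1 - ε < d n ((1 - η) * t n) := by
  have hm : 0 < min ε (1 / 2) := by positivity
  have hm2 : min ε (1 / 2) ≤ 1 / 2 := min_le_right _ _
  filter_upwards [h η ⟨h0, h1⟩ (1 - min ε (1 / 2)) ⟨by linarith, by linarith⟩] with n hn
  linarith [hn.1, min_le_left ε (1 / 2)]

end AbruptAt

/-- A family of chains whose distance to stationarity from the left end point drops abruptly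
around the times `t`. -/
structure LeftAbrupt (W : ℝ → ℕ → ℝ) (κ ρ : ℝ) (F : (n : ℕ) → BDChain n) (t : ℕ → ℝ) :
    Prop where
  scale : TimeScale W
  adapted : ∀ n, (F n).Adapted W κ ρ
  κ_pos : 0 < κ
  ρ_pos : 0 < ρ
  ρ_le_one : ρ ≤ 1
  t_pos : ∀ n, 0 < t n
  abrupt : AbruptAt (fun n s => (F n).tvw (W s) 0) t

/-- The states `M n` split the stationary mass into two parts of size at least `p`. -/
def Central (F : (n : ℕ) → BDChain n) (p : ℝ) (M : (n : ℕ) → Fin (n + 1)) : Prop :=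
  ∀ n, p ≤ (F n).piLow (M n) ∧ p ≤ (F n).piHigh (M n)

namespace LeftAbrupt
variable {W : ℝ → ℕ → ℝ} {κ ρ : ℝ} {F : (n : ℕ) → BDChain n} {t : ℕ → ℝ}

lemma tendsto_atTop (H : LeftAbrupt W κ ρ F t) : Tendsto t atTop atTop := by
  refine Filter.tendsto_atTop.2 fun B => ?_
  set ε : ℝ := min (1 / 2) (ρ ^ (3 / 2 * B) / 4) with hε
  have hpow : 0 < ρ ^ (3 / 2 * B) := Real.rpow_pos_of_pos H.ρ_pos _
  have hε0 : 0 < ε := by positivity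
  filter_upwards [H.abrupt.upper (η := 1 / 2) (by norm_num) (by norm_num) hε0,
    H.abrupt.lower (η := 1 / 2) (by norm_num) (by norm_num) hε0] with n h1 h2
  by_contra hc
  have ht := H.t_pos n
  have h3 := (F n).rpow_le_tvw H.scale (H.adapted n) H.ρ_pos H.ρ_le_one
    (s := (1 - 1 / 2) * t n) (s' := (1 + 1 / 2) * t n) (by positivity) (by linarith)
  have h4 : ρ ^ (3 / 2 * B) ≤ ρ ^ ((1 + 1 / 2) * t n) :=
    Real.rpow_le_rpow_of_exponent_ge H.ρ_pos H.ρ_le_one (by linarith [not_le.1 hc])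
  have h5 : ε ≤ ρ ^ (3 / 2 * B) / 4 := min_le_right _ _
  linarith

lemma surv_before (H : LeftAbrupt W κ ρ F t) {p : ℝ} (hp : 0 < p) {M : (n : ℕ) → Fin (n + 1)}
    (hM : ∀ n, p ≤ (F n).piLow (M n)) {η ε : ℝ} (h0 : 0 < η) (h1 : η < 1) (hε : 0 < ε) :
    ∀ᶠ n in atTop, 1 - ε ≤ (F n).surv (W ((1 - η) * t n)) (M n) 0 := by
  have hδ : 0 < ε * p / 2 := by positivity
  filter_upwards [H.abrupt.lower (η := η / 2) (by linarith) (by linarith) hδ,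
    eventually_inv_sqrt_le H.tendsto_atTop H.κ_pos (a := η / 2) (by linarith) hδ] with n h2 h3
  have ht := H.t_pos n
  have hs : 0 ≤ (1 - η) * t n := mul_nonneg (by linarith) ht.le
  have h4 := (F n).tvw_zero_le H.scale (H.adapted n) (M n) hs (v := η / 2 * t n) (by positivity)
  rw [show (1 - η) * t n + η / 2 * t n = (1 - η / 2) * t n by ring] at h4
  have h5 := (F n).surv_le_one (H.scale.isWt _ hs) (M n) 0
  have h6 : (1 - (F n).surv (W ((1 - η) * t n)) (M n) 0) * p ≤ ε * p := by
    have := mul_le_mul_of_nonneg_left (hM n) (sub_nonneg.2 h5)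
    linarith
  linarith [le_of_mul_le_mul_right h6 hp]

lemma surv_from_quantile (H : LeftAbrupt W κ ρ F t) {p q : ℝ} (hp : 0 < p) (hq : 0 < q)
    {a M : (n : ℕ) → Fin (n + 1)} (ha : ∀ n, q ≤ (F n).piLow (a n)) (haM : ∀ n, a n ≤ M n)
    (hM : ∀ n, p ≤ (F n).piHigh (M n)) {ζ : ℝ} (h0 : 0 < ζ) (h1 : ζ < 1) :
    ∀ᶠ n in atTop, (F n).surv (W (ζ * t n)) (M n) (a n) ≤ 1 - p / 2 := by
  have hδ : 0 < p / 4 := by positivity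
  filter_upwards [H.abrupt.upper (η := ζ / 2) (by linarith) (by linarith) hδ,
    H.surv_before hq ha (η := ζ / 4) (by linarith) (by linarith) hδ,
    H.tendsto_atTop.eventually_ge_atTop (8 / ζ)] with n h2 h3 h4
  rw [div_le_iff₀ h0] at h4
  have ht := H.t_pos n
  have hs : 0 ≤ (1 - ζ / 4) * t n := mul_nonneg (by linarith) ht.le
  have hw : 0 ≤ ζ * t n := by positivity
  have hs2 : 0 ≤ (1 + ζ / 2) * t n := by positivity
  have h5 := (F n).surv_mul_le H.scale (haM n) hs hw (by nlinarith)
  have h6 := (F n).surv_anti H.scale (M n) 0 hs2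
    (show (1 + ζ / 2) * t n ≤ (1 - ζ / 4) * t n + ζ * t n - 2 by nlinarith)
  have h7 := (F n).surv_zero_le (H.scale.isWt _ hs2) (M n)
  have h8 := (F n).surv_nonneg (H.scale.isWt _ hw) (M n) (a n)
  have h9 := (F n).surv_le_one (H.scale.isWt _ hw) (M n) (a n)
  have h10 := mul_le_mul_of_nonneg_right h3 h8
  have h11 := mul_le_mul_of_nonneg_left h9 hδ.le
  linarith [hM n]

lemma statSurv_small (H : LeftAbrupt W κ ρ F t) {p : ℝ} (hp : 0 < p)
    {M : (n : ℕ) → Fin (n + 1)} (hM : Central F p M) {η ε : ℝ} (h0 : 0 < η) (h1 : η < 1)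
    (hε : 0 < ε) : ∀ᶠ n in atTop, (F n).statSurv (W (η * t n)) (M n) ≤ ε := by
  have hp1 : p ≤ 1 := (hM 0).1.trans ((F 0).piLow_le_one _)
  have hβ0 : 0 ≤ 1 - p / 2 := by linarith
  obtain ⟨k, hk⟩ := exists_pow_lt_of_lt_one (half_pos hε) (show 1 - p / 2 < 1 by linarith)
  set q := min p (p * ε / 4) with hq
  have hq0 : 0 < q := by positivity
  have hqp : q ≤ p := min_le_left _ _
  have hqε : q ≤ p * ε / 4 := min_le_right _ _
  set ζ := η / (k + 1) with hζ
  have hζ0 : 0 < ζ := by positivity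
  have hζη : ζ ≤ η := div_le_self h0.le (by linarith [(Nat.cast_nonneg k : (0 : ℝ) ≤ k)])
  choose a ha1 ha2 ha3 using fun n => (F n).exists_quantile hq0.le (hqp.trans hp1)
  have haM : ∀ n, a n ≤ M n := fun n => ha3 n _ (hqp.trans (hM n).1)
  filter_upwards [H.surv_from_quantile hp hq0 ha1 haM (fun n => (hM n).2) hζ0
    (hζη.trans_lt h1)] with n hn
  have ht := H.t_pos n
  have hw : 0 ≤ ζ * t n := by positivity
  have key : ∀ j : ℕ, (F n).statSurv (W (j * (ζ * t n))) (M n) ≤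
      (1 - p / 2) ^ j + 2 * q / p := fun j => by
    induction j with
    | zero =>
      have h2 := (F n).statSurv_le_one (H.scale.isWt _ (by positivity :
        0 ≤ ((0 : ℕ) : ℝ) * (ζ * t n))) (M n)
      have : 0 ≤ 2 * q / p := by positivity
      rw [pow_zero]
      exact h2.trans (by linarith)
    | succ j ih =>
      have h3 := (F n).statSurv_add_le H.scale (a n) (M n)
        (u := j * (ζ * t n)) (by positivity) hw
      rw [show (((j + 1 : ℕ) : ℝ) * (ζ * t n)) = j * (ζ * t n) + ζ * t n by push_cast; ring]
      have h4 : 0 ≤ (1 - p / 2) ^ j + 2 * q / p := by positivity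
      have h5 := mul_le_mul_of_nonneg_left ih
        ((F n).surv_nonneg (H.scale.isWt _ hw) (M n) (a n))
      have h6 := mul_le_mul_of_nonneg_right hn h4
      have h7 : (1 - p / 2) * ((1 - p / 2) ^ j + 2 * q / p) + q =
          (1 - p / 2) ^ (j + 1) + 2 * q / p := by
        field_simp
        ring
      linarith [ha2 n]
  have h8 := (key k).trans (add_le_add hk.le (show 2 * q / p ≤ ε / 2 by
    rw [div_le_iff₀ hp]; linarith))
  refine ((F n).statSurv_anti H.scale (M n) (by positivity : 0 ≤ (k : ℝ) * (ζ * t n)) ?_).trans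
    (h8.trans (by linarith))
  have h9 : (k + 1 : ℝ) * ζ = η := by rw [hζ]; field_simp
  nlinarith

lemma surv_after (H : LeftAbrupt W κ ρ F t) {p : ℝ} (hp : 0 < p)
    {M : (n : ℕ) → Fin (n + 1)} (hM : Central F p M) {η ε : ℝ} (h0 : 0 < η) (h1 : η < 1)
    (hε : 0 < ε) : ∀ᶠ n in atTop, (F n).surv (W ((1 + η) * t n)) (M n) 0 ≤ ε := by
  filter_upwards [H.abrupt.upper (η := η / 2) (by linarith) (by linarith) (half_pos hε),
    H.statSurv_small hp hM (η := η / 2) (by linarith) (by linarith) (half_pos hε)] with n h2 h3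
  have ht := H.t_pos n
  have h4 := (F n).surv_zero_add_le H.scale (M n) (s := (1 + η / 2) * t n) (u := η / 2 * t n)
    (by positivity) (by positivity)
  rw [show (1 + η / 2) * t n + η / 2 * t n = (1 + η) * t n by ring] at h4
  linarith

lemma tvwMax_small (H : LeftAbrupt W κ ρ F t) {p : ℝ} (hp : 0 < p)
    {M : (n : ℕ) → Fin (n + 1)} (hM : Central F p M) {u : ℕ → ℝ} (hu : ∀ n, 0 ≤ u n)
    (hS : ∀ ε > 0, ∀ᶠ n in atTop, (F n).surv (W (u n)) (M n) (Fin.last n) ≤ ε)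
    {η ε : ℝ} (h0 : 0 < η) (h1 : η < 1) (hε : 0 < ε) :
    ∀ᶠ n in atTop, (F n).tvwMax (W ((1 + η) * t n + u n)) ≤ ε := by
  have hp1 : p ≤ 1 := (hM 0).1.trans ((F 0).piLow_le_one _)
  set δ := min (1 / 2) (p * ε / 12) with hδ
  have hδ0 : 0 < δ := by positivity
  have hδ1 : δ ≤ 1 / 2 := min_le_left _ _
  have hδε : δ ≤ p * ε / 12 := min_le_right _ _
  have hδε' : δ ≤ ε / 12 := by nlinarith
  choose b hb1 hb2 _ using fun n =>
    (F n).exists_quantile (p := 1 - δ) (by linarith) (by linarith)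
  set M' : (n : ℕ) → Fin (n + 1) := fun n => max (M n) (b n) with hM'
  have hlow : ∀ n, 1 - δ ≤ (F n).piLow (M' n) := fun n =>
    (hb1 n).trans ((F n).piLow_mono (le_max_right _ _))
  have hcen : Central F (min p δ) M' := fun n => by
    refine ⟨?_, ?_⟩
    · exact (min_le_right _ _).trans (le_trans (by linarith) (hlow n))
    · rcases max_choice (M n) (b n) with h | h
      · simp only [hM', h]; exact (min_le_left _ _).trans (hM n).2
      · simp only [hM', h]; exact (min_le_right _ _).trans (by linarith [hb2 n])
  have hq0 : 0 < min p δ := by positivity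
  filter_upwards [hS (ε / 4) (by positivity),
    H.abrupt.upper (η := η / 2) (by linarith) (by linarith) hδ0,
    H.surv_after hq0 hcen (η := η / 2) (by linarith) (by linarith) hδ0,
    eventually_inv_sqrt_le H.tendsto_atTop H.κ_pos (a := η / 2) (by linarith) hδ0]
    with n h2 h3 h4 h5
  have ht := H.t_pos n
  have hs : 0 ≤ (1 + η) * t n := by positivity
  have hdiv : (1 - (F n).piLow (M' n)) / (F n).piHigh (M n) ≤ ε / 12 := by
    rw [div_le_iff₀ ((F n).piHigh_pos _)]
    nlinarith [hlow n, (hM n).2]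
  have hmid : ∀ x ≤ M n, (F n).tvw (W ((1 + η) * t n)) x ≤ 3 * ε / 4 := fun x hx => by
    have h6 := (F n).tvw_mid_le H.scale (H.adapted n) hx (le_max_left (M n) (b n))
      (s := (1 + η / 2) * t n) (v := η / 2 * t n) (by positivity) (by positivity)
    rw [show (1 + η / 2) * t n + η / 2 * t n = (1 + η) * t n by ring] at h6
    linarith
  refine (F n).tvwMax_le fun x => ?_
  rcases le_total x (M n) with hx | hx
  · exact ((F n).tvw_anti H.scale x hs (by linarith [hu n])).trans
      ((hmid x hx).trans (by linarith))
  · have h7 := (F n).tvw_le_surv_add H.scale (M n) x hs (hu n)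
    have h8 := (F n).surv_le_last (H.scale.isWt _ (hu n)) hx
    linarith [hmid (M n) le_rfl]

end LeftAbrupt

namespace BDChain
variable {n : ℕ} (c : BDChain n)

lemma Gap.mh_close {l p : ℝ} (h : c.Gap l) (hl : 0 < l) (hp : 0 < p) {a b : Fin (n + 1)}
    (ha : p ≤ c.piLow a ∧ p ≤ c.piHigh a) (hb : p ≤ c.piLow b ∧ p ≤ c.piHigh b) :
    |c.mh a (Fin.last n) - c.mh b (Fin.last n)| ≤ 1 / (l * p ^ 2) := by
  wlog hab : a ≤ b generalizing a b
  · rw [abs_sub_comm]; exact this hb ha (le_of_not_ge hab)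
  have h1 : c.mh a (Fin.last n) = c.mh a b + c.mh b (Fin.last n) :=
    c.pot_add _ hab (Fin.le_last b)
  rw [h1, add_sub_cancel_right, abs_of_nonneg (c.mh_nonneg a b), le_div_iff₀ (by positivity)]
  have h2 := h.mh_le c hl a b
  have h3 : p ^ 2 ≤ c.piLow a * c.piHigh b := by
    rw [sq]; exact mul_le_mul ha.1 hb.2 hp.le (hp.le.trans ha.1)
  have h4 := mul_le_mul_of_nonneg_left h3 (mul_nonneg hl.le (c.mh_nonneg a b))
  linarith

end BDChain

namespace LeftAbrupt
variable {W : ℝ → ℕ → ℝ} {κ ρ : ℝ} {F : (n : ℕ) → BDChain n} {t : ℕ → ℝ}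

lemma surv_last_small (H : LeftAbrupt W κ ρ F t) {T : ℕ → ℝ} (hT : ∀ n, 0 < T n)
    (hlim : Tendsto T atTop atTop) {M : (n : ℕ) → Fin (n + 1)}
    (hM : Tendsto (fun n => (F n).hitMean (M n) (Fin.last n) / T n) atTop (nhds 0))
    {ζ ε : ℝ} (hζ : 0 < ζ) (hε : 0 < ε) :
    ∀ᶠ n in atTop, (F n).surv (W (ζ * T n)) (M n) (Fin.last n) ≤ ε := by
  filter_upwards [eventually_affine_div_sq_le hlim (a := ζ) hζ (show 0 < ε / 8 by positivity),
    hM.eventually (gt_mem_nhds (show 0 < ζ * ε / 4 by positivity))] with n h1 h2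
  have hu : 0 < ζ * T n := mul_pos hζ (hT n)
  have h3 := (F n).surv_le_hitMean H.scale (M n) hu
  have h4 := h1 (T n) le_rfl
  have h5 : 2 * (F n).hitMean (M n) (Fin.last n) / (ζ * T n) ≤ ε / 2 := by
    rw [div_lt_iff₀ (hT n)] at h2
    rw [div_le_iff₀ hu]
    linarith
  rw [mul_div_assoc] at h3
  linarith

lemma abruptAt_tvwMax (H : LeftAbrupt W κ ρ F t) {p : ℝ} (hp : 0 < p)
    {M : (n : ℕ) → Fin (n + 1)} (hM : Central F p M)
    (hlim : Tendsto (fun n => (F n).hitMean (M n) (Fin.last n) / t n) atTop (nhds 0)) :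
    AbruptAt (fun n s => (F n).tvwMax (W s)) t := by
  intro η hη ε hε
  have hη0 := hη.1
  have hη1 := hη.2
  have h2 : ∀ n, 0 ≤ η / 2 * t n := fun n => mul_nonneg (by linarith) (H.t_pos n).le
  filter_upwards [H.abrupt η hη ε hε, H.tvwMax_small hp hM h2
    (fun ε' hε' => H.surv_last_small H.t_pos H.tendsto_atTop hlim (by linarith) hε')
    (η := η / 2) (by linarith) (by linarith) hε.1] with n h3 h4
  rw [show (1 + η / 2) * t n + η / 2 * t n = (1 + η) * t n by ring] at h4
  exact ⟨h3.1.trans_le ((F n).tvw_le_tvwMax _ 0), h4⟩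

variable {T : ℕ → ℝ}

lemma tendsto_atTop_of_max (H : LeftAbrupt W κ ρ F t) (hT : ∀ n, 0 < T n)
    (hc : AbruptAt (fun n s => (F n).tvwMax (W s)) T) : Tendsto T atTop atTop := by
  have h3 : Tendsto (fun n => 1 / 3 * t n) atTop atTop :=
    H.tendsto_atTop.const_mul_atTop (by norm_num)
  refine tendsto_atTop_mono' atTop ?_ h3
  filter_upwards [H.abrupt.lower (η := 1 / 2) (ε := 1 / 2) (by norm_num) (by norm_num)
    (by norm_num), hc.upper (η := 1 / 2) (ε := 1 / 2) (by norm_num) (by norm_num)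
    (by norm_num)] with n h1 h2
  by_contra hcon
  have h4 := (F n).tvw_anti H.scale 0 (s := (1 + 1 / 2) * T n) (s' := (1 - 1 / 2) * t n)
    (mul_nonneg (by norm_num) (hT n).le) (by linarith [not_le.1 hcon])
  have h5 := (F n).tvw_le_tvwMax (W ((1 + 1 / 2) * T n)) 0
  linarith

lemma eventually_gap (H : LeftAbrupt W κ ρ F t) (hT : ∀ n, 0 < T n)
    (hc : AbruptAt (fun n s => (F n).tvwMax (W s)) T) {B : ℝ} :
    ∀ᶠ n in atTop, (F n).Gap (B / T n) := by
  set ε := Real.exp (-(4 * B)) / 2 with hε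
  have hε0 : 0 < ε := by positivity
  filter_upwards [hc.upper (η := 1 / 2) (ε := ε / 2) (by norm_num) (by norm_num) (by positivity),
    (H.tendsto_atTop_of_max hT hc).eventually_ge_atTop (2 / ε)] with n h1 h2
  have hTn := hT n
  rw [div_le_iff₀ hε0] at h2
  have h3 : ∀ x, (F n).tvw (poi (4 * T n)) x ≤ ε := fun x => by
    have h4 := (H.adapted n).poi_le (4 * T n) (by positivity) x
    have h5 := (F n).tvw_anti H.scale x (s := (1 + 1 / 2) * T n) (s' := 4 * T n / 2)
      (by positivity) (by linarith)
    have h6 := (F n).tvw_le_tvwMax (W ((1 + 1 / 2) * T n)) x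
    have h7 : 4 / (4 * T n) ≤ ε / 2 := by
      rw [div_le_iff₀ (by positivity)]; linarith
    linarith
  have h8 : Real.log (1 / (2 * ε)) / (4 * T n) = B / T n := by
    rw [hε, mul_div_cancel₀ _ two_ne_zero, one_div, ← Real.exp_neg, Real.log_exp, neg_neg,
      mul_div_mul_left _ _ (by norm_num)]
  rw [← h8]
  exact fun g hg => (F n).poincare (by positivity) hε0 h3 hg

lemma surv_last_concentrated (H : LeftAbrupt W κ ρ F t) (hT : ∀ n, 0 < T n)
    (hc : AbruptAt (fun n s => (F n).tvwMax (W s)) T) {p : ℝ} (hp : 0 < p)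
    {a M : (n : ℕ) → Fin (n + 1)} (ha : Central F p a) (hM : Central F p M) {θ η δ : ℝ}
    (hθ : 0 < θ) (h0 : 0 < η) (h1 : η < 1) (hδ : 0 < δ) :
    ∀ᶠ n in atTop, θ * T n ≤ (F n).mh (M n) (Fin.last n) →
      (F n).surv (W ((1 + η) * (F n).mh (M n) (Fin.last n))) (a n) (Fin.last n) ≤ δ ∧
      1 - δ ≤ (F n).surv (W ((1 - η) * (F n).mh (M n) (Fin.last n))) (a n) (Fin.last n) := by
  have hTlim := H.tendsto_atTop_of_max hT hc
  set B := max (4 / (θ * p ^ 2 * η)) (512 / (θ * p * η ^ 2 * δ)) with hB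
  have hB0 : 0 < B := by positivity
  have hB1 : 4 / (θ * p ^ 2 * η) ≤ B := le_max_left _ _
  have hB2 : 512 / (θ * p * η ^ 2 * δ) ≤ B := le_max_right _ _
  rw [div_le_iff₀ (by positivity)] at hB1 hB2
  filter_upwards [H.eventually_gap hT hc (B := B),
    eventually_affine_div_sq_le (hTlim.const_mul_atTop hθ) (a := 1 + η) (b := η / 8)
      (by positivity) (half_pos hδ)] with n hG hq hm
  set m := (F n).mh (M n) (Fin.last n) with hmdef
  have hTn := hT n
  have hm0 : 0 < m := (mul_pos hθ hTn).trans_le hm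
  have hl : 0 < B / T n := by positivity
  have hclose : |(F n).mh (a n) (Fin.last n) - m| ≤ η * m / 4 := by
    refine (hG.mh_close (F n) hl hp (ha n) (hM n)).trans ?_
    rw [div_le_iff₀ (by positivity)]
    have h2 : η * m / 4 * (B / T n * p ^ 2) = B * (p ^ 2 * η) / 4 * (m / T n) := by
      field_simp
    have h3 : θ ≤ m / T n := by rwa [le_div_iff₀ hTn]
    rw [h2]
    have h4 := mul_le_mul_of_nonneg_left h3 (show 0 ≤ B * (p ^ 2 * η) / 4 by positivity)
    linarith
  obtain ⟨hc1, hc2⟩ := _root_.abs_le.1 hclose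
  have hv : (F n).vh (a n) (Fin.last n) / (η / 8 * m) ^ 2 ≤ δ / 2 := by
    rw [div_le_iff₀ (by positivity)]
    have h2 := hG.vh_le (F n) hl (a n) (Fin.last n)
    have hmh := (F n).mh_nonneg (a n) (Fin.last n)
    have h3 : 2 / (B / T n * (F n).piLow (a n)) ≤ 2 / (B / T n * p) :=
      div_le_div_of_nonneg_left (by norm_num) (by positivity)
        (mul_le_mul_of_nonneg_left (ha n).1 hl.le)
    have h4 : 2 / (B / T n * p) ≤ 2 * m / (θ * B * p) := by
      rw [div_le_div_iff₀ (by positivity) (by positivity)]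
      have : 2 * m * (B / T n * p) = 2 * B * p * (m / T n) := by field_simp
      rw [this]
      have h3 : θ ≤ m / T n := by rwa [le_div_iff₀ hTn]
      have h4 := mul_le_mul_of_nonneg_left h3 (show 0 ≤ 2 * B * p by positivity)
      linarith
    have h5 : (F n).mh (a n) (Fin.last n) ≤ 2 * m := by nlinarith
    calc (F n).vh (a n) (Fin.last n) ≤ 2 * m / (θ * B * p) * (2 * m) :=
          h2.trans (mul_le_mul (h3.trans h4) h5 hmh (by positivity))
      _ = 4 * m ^ 2 / (θ * B * p) := by ring
      _ ≤ δ / 2 * (η / 8 * m) ^ 2 := by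
          rw [div_le_iff₀ (by positivity)]
          have h6 := mul_le_mul_of_nonneg_left hB2 (show 0 ≤ m ^ 2 / 128 by positivity)
          linarith
  have hq' := hq m hm
  constructor
  · have h2 := (F n).surv_after_mh H.scale (a n) (s := (1 + η) * m) (a := η / 8 * m)
      (by positivity) (by positivity) (by linarith)
    linarith
  · have h2 := (F n).surv_before_mh H.scale (a n) (s := (1 - η) * m) (a := η / 8 * m)
      (mul_nonneg (by linarith) hm0.le) (by positivity) (by linarith)
    have h3 : ((1 - η) * m + 1) / (η / 8 * m) ^ 2 ≤ ((1 + η) * m + 1) / (η / 8 * m) ^ 2 := by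
      gcongr
      linarith
    linarith

lemma abruptAt_last (H : LeftAbrupt W κ ρ F t) (hT : ∀ n, 0 < T n)
    (hc : AbruptAt (fun n s => (F n).tvwMax (W s)) T) {p : ℝ} (hp : 0 < p)
    {M : (n : ℕ) → Fin (n + 1)} (hM : Central F p M) {θ : ℝ} (hθ : 0 < θ) {φ : ℕ → ℕ}
    (hφ : StrictMono φ)
    (hm : ∀ k, θ * T (φ k) ≤ (F (φ k)).mh (M (φ k)) (Fin.last (φ k))) :
    AbruptAt (fun k s => (F (φ k)).tvw (W s) (Fin.last (φ k)))
      fun k => (F (φ k)).mh (M (φ k)) (Fin.last (φ k)) := by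
  intro η hη ε hε
  have h0 := hη.1
  have h1 := hη.2
  have e0 := hε.1
  have e1 := hε.2
  have hTlim := H.tendsto_atTop_of_max hT hc
  choose a ha1 ha2 _ using fun n =>
    (F n).exists_quantile (p := ε / 4) (by linarith) (by linarith)
  choose b hb1 hb2 _ using fun n =>
    (F n).exists_quantile (p := 1 - (1 - ε) / 4) (by linarith) (by linarith)
  set q := min p (min (ε / 4) ((1 - ε) / 4)) with hq
  have hq0 : 0 < q := lt_min hp (lt_min (by linarith) (by linarith))
  have hqp : q ≤ p := min_le_left _ _
  have hqε : q ≤ ε / 4 := (min_le_right _ _).trans (min_le_left _ _)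
  have hqε' : q ≤ (1 - ε) / 4 := (min_le_right _ _).trans (min_le_right _ _)
  have hMq : Central F q M := fun n => ⟨hqp.trans (hM n).1, hqp.trans (hM n).2⟩
  have haq : Central F q a := fun n => ⟨hqε.trans (ha1 n), by linarith [ha2 n]⟩
  have hbq : Central F q b := fun n => ⟨by linarith [hb1 n], by linarith [hb2 n]⟩
  have hup := H.surv_last_concentrated hT hc hq0 haq hMq hθ (η := η / 2) (δ := ε / 4)
    (by linarith) (by linarith) (by linarith)
  have hlo := H.surv_last_concentrated hT hc hq0 hbq hMq hθ (η := η) (δ := (1 - ε) / 4)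
    h0 h1 (by linarith)
  have hsq := eventually_inv_sqrt_le (hTlim.const_mul_atTop hθ) H.κ_pos (a := η / 2)
    (δ := ε / 4) (by linarith) (by linarith)
  filter_upwards [hφ.tendsto_atTop.eventually hup, hφ.tendsto_atTop.eventually hlo,
    hφ.tendsto_atTop.eventually hsq] with k k1 k2 k3
  have k1 := (k1 (hm k)).1
  have k2 := (k2 (hm k)).2
  have hmk := hm k
  set m := (F (φ k)).mh (M (φ k)) (Fin.last (φ k)) with hmdef
  have hT0 : 0 < θ * T (φ k) := mul_pos hθ (hT _)
  have hm0 : 0 < m := hT0.trans_le hmk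
  constructor
  · have h3 := (F (φ k)).surv_last_le (H.scale.isWt ((1 - η) * m)
      (mul_nonneg (by linarith) hm0.le)) (b (φ k))
    linarith [hb1 (φ k)]
  · have h3 := (F (φ k)).tvw_last_le H.scale (H.adapted _) (a (φ k)) (s := (1 + η / 2) * m)
      (v := η / 2 * m) (by positivity) (by positivity)
    rw [show (1 + η / 2) * m + η / 2 * m = (1 + η) * m by ring] at h3
    have hκ := H.κ_pos
    have h4 : 1 / √(κ * (η / 2 * m)) ≤ 1 / √(κ * (η / 2 * (θ * T (φ k)))) := by
      have : 0 < √(κ * (η / 2 * (θ * T (φ k)))) := Real.sqrt_pos.2 (by positivity)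
      gcongr
    linarith [ha2 (φ k)]

lemma mh_small (H : LeftAbrupt W κ ρ F t) (hT : ∀ n, 0 < T n)
    (hc : AbruptAt (fun n s => (F n).tvwMax (W s)) T)
    (hR : ¬ ∃ φ : ℕ → ℕ, StrictMono φ ∧ ∃ s : ℕ → ℝ, (∀ k, 0 < s k) ∧
      AbruptAt (fun k s => (F (φ k)).tvw (W s) (Fin.last (φ k))) s)
    {p : ℝ} (hp : 0 < p) {M : (n : ℕ) → Fin (n + 1)} (hM : Central F p M) {θ : ℝ}
    (hθ : 0 < θ) : ∀ᶠ n in atTop, (F n).mh (M n) (Fin.last n) < θ * T n := by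
  by_contra hcon
  rw [Filter.not_eventually] at hcon
  obtain ⟨φ, hφ, hm⟩ := Filter.extraction_of_frequently_atTop hcon
  have hm' : ∀ k, θ * T (φ k) ≤ (F (φ k)).mh (M (φ k)) (Fin.last (φ k)) := fun k =>
    not_lt.1 (hm k)
  exact hR ⟨φ, hφ, _, fun k => (mul_pos hθ (hT _)).trans_le (hm' k),
    H.abruptAt_last hT hc hp hM hθ hφ hm'⟩

lemma hitMean_small (H : LeftAbrupt W κ ρ F t) (hT : ∀ n, 0 < T n)
    (hc : AbruptAt (fun n s => (F n).tvwMax (W s)) T)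
    (hR : ¬ ∃ φ : ℕ → ℕ, StrictMono φ ∧ ∃ s : ℕ → ℝ, (∀ k, 0 < s k) ∧
      AbruptAt (fun k s => (F (φ k)).tvw (W s) (Fin.last (φ k))) s)
    {p : ℝ} (hp : 0 < p) {M : (n : ℕ) → Fin (n + 1)} (hM : Central F p M) :
    Tendsto (fun n => (F n).hitMean (M n) (Fin.last n) / t n) atTop (nhds 0) := by
  have hH0 : ∀ n, 0 ≤ (F n).hitMean (M n) (Fin.last n) := fun n =>
    tsum_nonneg fun m => ((F n).isSurv_hitSurv (M n)).nonneg (F n).subSt m _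
  have hle : ∀ n, (F n).hitMean (M n) (Fin.last n) ≤ (F n).mh (M n) (Fin.last n) := fun n =>
    (F n).hitMean_le_mh (Fin.le_last (M n))
  have hlimT : Tendsto (fun n => (F n).hitMean (M n) (Fin.last n) / T n) atTop (nhds 0) := by
    rw [Metric.tendsto_nhds]
    intro θ hθ
    filter_upwards [H.mh_small hT hc hR hp hM hθ] with n hn
    rw [Real.dist_eq, sub_zero, abs_of_nonneg (div_nonneg (hH0 n) (hT n).le),
      div_lt_iff₀ (hT n)]
    exact (hle n).trans_lt hn
  have hTt : ∀ᶠ n in atTop, T n ≤ 3 / 2 * t n := by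
    filter_upwards [hc.lower (η := 1 / 8) (ε := 1 / 2) (by norm_num) (by norm_num)
      (by norm_num), H.tvwMax_small hp hM (u := fun n => 1 / 8 * T n)
      (fun n => mul_nonneg (by norm_num) (hT n).le)
      (fun ε hε => H.surv_last_small hT (H.tendsto_atTop_of_max hT hc) hlimT (by norm_num) hε)
      (η := 1 / 8) (ε := 1 / 2) (by norm_num) (by norm_num) (by norm_num)] with n h1 h2
    by_contra hcon
    have htn := H.t_pos n
    have hTn := hT n
    have h3 := (F n).tvwMax_anti H.scale (s := (1 + 1 / 8) * t n + 1 / 8 * T n)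
      (s' := (1 - 1 / 8) * T n) (by positivity) (by linarith [not_le.1 hcon])
    linarith
  have h32 := hlimT.const_mul (3 / 2)
  rw [mul_zero] at h32
  refine squeeze_zero' (Eventually.of_forall fun n => div_nonneg (hH0 n) (H.t_pos n).le) ?_ h32
  filter_upwards [hTt] with n hn
  have htn := H.t_pos n
  have hTn := hT n
  rw [div_le_iff₀ htn]
  have h4 : 3 / 2 * ((F n).hitMean (M n) (Fin.last n) / T n) * t n =
      (F n).hitMean (M n) (Fin.last n) * ((3 / 2 * t n) / T n) := by ring
  rw [h4]
  exact le_mul_of_one_le_right (hH0 n) ((one_le_div hTn).2 hn)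

/-- The comparison theorem for a general time scale. -/
theorem comparison (H : LeftAbrupt W κ ρ F t)
    (hR : ¬ ∃ φ : ℕ → ℕ, StrictMono φ ∧ ∃ s : ℕ → ℝ, (∀ k, 0 < s k) ∧
      AbruptAt (fun k s => (F (φ k)).tvw (W s) (Fin.last (φ k))) s) {P : Prop}
    (hP : P ↔ ∃ T : ℕ → ℝ, (∀ n, 0 < T n) ∧ AbruptAt (fun n s => (F n).tvwMax (W s)) T) :
    (P ↔ ∃ M : (n : ℕ) → Fin (n + 1),
        (∃ c > 0, ∀ n, c ≤ (F n).piLow (M n)) ∧ (∃ c > 0, ∀ n, c ≤ (F n).piHigh (M n)) ∧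
        Tendsto (fun n => (F n).hitMean (M n) (Fin.last n) / t n) atTop (nhds 0)) ∧
    (P ↔ ∀ M : (n : ℕ) → Fin (n + 1),
        (∃ c > 0, ∀ n, c ≤ (F n).piLow (M n)) → (∃ c > 0, ∀ n, c ≤ (F n).piHigh (M n)) →
        Tendsto (fun n => (F n).hitMean (M n) (Fin.last n) / t n) atTop (nhds 0)) ∧
    (P → AbruptAt (fun n s => (F n).tvwMax (W s)) t) := by
  have h13 : P → ∀ M : (n : ℕ) → Fin (n + 1),
      (∃ c > 0, ∀ n, c ≤ (F n).piLow (M n)) → (∃ c > 0, ∀ n, c ≤ (F n).piHigh (M n)) →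
      Tendsto (fun n => (F n).hitMean (M n) (Fin.last n) / t n) atTop (nhds 0) := by
    rintro h M ⟨p, hp, hlow⟩ ⟨q, hq, hhigh⟩
    obtain ⟨T, hT, hc⟩ := hP.1 h
    exact H.hitMean_small hT hc hR (p := min p q) (lt_min hp hq) fun n =>
      ⟨(min_le_left _ _).trans (hlow n), (min_le_right _ _).trans (hhigh n)⟩
  have h32 : (∀ M : (n : ℕ) → Fin (n + 1),
      (∃ c > 0, ∀ n, c ≤ (F n).piLow (M n)) → (∃ c > 0, ∀ n, c ≤ (F n).piHigh (M n)) →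
      Tendsto (fun n => (F n).hitMean (M n) (Fin.last n) / t n) atTop (nhds 0)) →
      ∃ M : (n : ℕ) → Fin (n + 1),
        (∃ c > 0, ∀ n, c ≤ (F n).piLow (M n)) ∧ (∃ c > 0, ∀ n, c ≤ (F n).piHigh (M n)) ∧
        Tendsto (fun n => (F n).hitMean (M n) (Fin.last n) / t n) atTop (nhds 0) := by
    intro h
    choose M h1 h2 _ using fun n =>
      (F n).exists_quantile (p := 1 / 2) (by norm_num) (by norm_num)
    have hlow : ∃ c > 0, ∀ n, c ≤ (F n).piLow (M n) := ⟨1 / 2, by norm_num, h1⟩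
    have hhigh : ∃ c > 0, ∀ n, c ≤ (F n).piHigh (M n) := ⟨1 - 1 / 2, by norm_num, h2⟩
    exact ⟨M, hlow, hhigh, h M hlow hhigh⟩
  have h2 : (∃ M : (n : ℕ) → Fin (n + 1),
        (∃ c > 0, ∀ n, c ≤ (F n).piLow (M n)) ∧ (∃ c > 0, ∀ n, c ≤ (F n).piHigh (M n)) ∧
        Tendsto (fun n => (F n).hitMean (M n) (Fin.last n) / t n) atTop (nhds 0)) →
      AbruptAt (fun n s => (F n).tvwMax (W s)) t := by
    rintro ⟨M, ⟨p, hp, hlow⟩, ⟨q, hq, hhigh⟩, hlim⟩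
    exact H.abruptAt_tvwMax (p := min p q) (lt_min hp hq) (fun n =>
      ⟨(min_le_left _ _).trans (hlow n), (min_le_right _ _).trans (hhigh n)⟩) hlim
  have h21 := fun h => hP.2 ⟨t, H.t_pos, h2 h⟩
  exact ⟨⟨fun h => h32 (h13 h), h21⟩, ⟨h13, fun h => h21 (h32 h)⟩, fun h => h2 (h32 (h13 h))⟩

end LeftAbrupt

namespace BDChain
variable {n : ℕ} (c : BDChain n)

lemma antitone_dTV (x : Fin (n + 1)) : Antitone (c.dTV x) := fun m m' h => by
  have := c.tvw_anti timeScale_detTime x (Nat.cast_nonneg m) (Nat.cast_le (α := ℝ).2 h)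
  simpa only [detTime, Nat.floor_natCast, ← c.dTV_eq] using this

lemma antitone_dTVMax : Antitone c.dTVMax := fun m m' h => by
  have := c.tvwMax_anti timeScale_detTime (Nat.cast_nonneg m) (Nat.cast_le (α := ℝ).2 h)
  simpa only [detTime, Nat.floor_natCast, ← c.dTVMax_eq] using this

end BDChain

/-- Theorem `t-comp`.  Suppose `F_c^L` has a total variation cutoff with
cutoff time `t_n` while no subsequence of `F_c^R` has one.  Then `F_c` has a maximum total
variation cutoff (with cutoff time `t_n`) iff `limsup E_n τ̃_{M_n}/t_n = 0` for some
(equivalently, every) sequence `M_n` with `inf_n π_n([0,M_n]) > 0` and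
`inf_n π_n([M_n,n]) > 0`; similarly in discrete time when `inf_{n,i} K_n(i,i) > 0`. -/
theorem birth_death_max_cutoff_comparison
    (F : (n : ℕ) → BDChain n) (t : ℕ → ℝ) (ht : ∀ n, 0 < t n) :
    -- continuous-time case
    (cutoffWith (fun ε n => mixC ((F n).dTVC 0) ε) t →
      (¬ ∃ φ : ℕ → ℕ, StrictMono φ ∧
        hasCutoff (fun ε m => mixC ((F (φ m)).dTVC (Fin.last (φ m))) ε)) →
      (hasCutoff (fun ε n => mixC ((F n).dTVMaxC) ε) ↔
          ∃ M : (n : ℕ) → Fin (n + 1),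
            (∃ c > 0, ∀ n, c ≤ (F n).piLow (M n)) ∧
            (∃ c > 0, ∀ n, c ≤ (F n).piHigh (M n)) ∧
            Filter.Tendsto (fun n => (F n).hitMeanC (M n) (Fin.last n) / t n)
              Filter.atTop (nhds 0)) ∧
      (hasCutoff (fun ε n => mixC ((F n).dTVMaxC) ε) ↔
          ∀ M : (n : ℕ) → Fin (n + 1),
            (∃ c > 0, ∀ n, c ≤ (F n).piLow (M n)) →
            (∃ c > 0, ∀ n, c ≤ (F n).piHigh (M n)) →
            Filter.Tendsto (fun n => (F n).hitMeanC (M n) (Fin.last n) / t n)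
              Filter.atTop (nhds 0)) ∧
      (hasCutoff (fun ε n => mixC ((F n).dTVMaxC) ε) →
          cutoffWith (fun ε n => mixC ((F n).dTVMaxC) ε) t)) ∧
    -- discrete-time case
    ((∃ δ > (0 : ℝ), ∀ n, ∀ i : Fin (n + 1), δ ≤ (F n).K i i) →
      cutoffWith (fun ε n => ((mixD ((F n).dTV 0) ε : ℕ) : ℝ)) t →
      (¬ ∃ φ : ℕ → ℕ, StrictMono φ ∧
        hasCutoff (fun ε m => ((mixD ((F (φ m)).dTV (Fin.last (φ m))) ε : ℕ) : ℝ))) →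
      (hasCutoff (fun ε n => ((mixD ((F n).dTVMax) ε : ℕ) : ℝ)) ↔
          ∃ M : (n : ℕ) → Fin (n + 1),
            (∃ c > 0, ∀ n, c ≤ (F n).piLow (M n)) ∧
            (∃ c > 0, ∀ n, c ≤ (F n).piHigh (M n)) ∧
            Filter.Tendsto (fun n => (F n).hitMean (M n) (Fin.last n) / t n)
              Filter.atTop (nhds 0)) ∧
      (hasCutoff (fun ε n => ((mixD ((F n).dTVMax) ε : ℕ) : ℝ)) ↔
          ∀ M : (n : ℕ) → Fin (n + 1),
            (∃ c > 0, ∀ n, c ≤ (F n).piLow (M n)) →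
            (∃ c > 0, ∀ n, c ≤ (F n).piHigh (M n)) →
            Filter.Tendsto (fun n => (F n).hitMean (M n) (Fin.last n) / t n)
              Filter.atTop (nhds 0)) ∧
      (hasCutoff (fun ε n => ((mixD ((F n).dTVMax) ε : ℕ) : ℝ)) →
          cutoffWith (fun ε n => ((mixD ((F n).dTVMax) ε : ℕ) : ℝ)) t)) := by
  refine ⟨fun hL hR => ?_, fun hδ hL hR => ?_⟩
  · have hx : ∀ n x, ∀ s s' : ℝ, 0 ≤ s → s ≤ s' → (F n).dTVC x s' ≤ (F n).dTVC x s :=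
      fun n x s s' hs h => (F n).tvw_anti timeScale_poi x hs h
    have hmax : ∀ n, ∀ s s' : ℝ, 0 ≤ s → s ≤ s' → (F n).dTVMaxC s' ≤ (F n).dTVMaxC s :=
      fun n s s' hs h => (F n).tvwMax_anti timeScale_poi hs h
    have H : LeftAbrupt poi 1 (Real.exp (-1)) F t :=
      { scale := timeScale_poi
        adapted := fun n => (F n).adapted_poi
        κ_pos := one_pos
        ρ_pos := Real.exp_pos _
        ρ_le_one := Real.exp_le_one_iff.2 (by norm_num)
        t_pos := ht
        abrupt := (cutoffWith_mixC_iff (fun n => hx n 0) ht).1 hL }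
    have key := H.comparison (P := hasCutoff (fun ε n => mixC ((F n).dTVMaxC) ε))
      (fun ⟨φ, hφ, s, hs, h⟩ => hR ⟨φ, hφ, s, hs,
        (cutoffWith_mixC_iff (d := fun k => (F (φ k)).dTVC (Fin.last (φ k)))
          (fun k => hx (φ k) _) hs).2 h⟩)
      (exists_congr fun T => and_congr_right fun hT => cutoffWith_mixC_iff hmax hT)
    simp only [fun n (M : Fin (n + 1)) => (F n).hitMeanC_eq (Fin.le_last M)]
    exact ⟨key.1, key.2.1, fun h => (cutoffWith_mixC_iff hmax ht).2 (key.2.2 h)⟩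
  · obtain ⟨δ, hδ, hK⟩ := hδ
    have hx : ∀ n x, Antitone ((F n).dTV x) := fun n x => (F n).antitone_dTV x
    have hmax : ∀ n, Antitone (F n).dTVMax := fun n => (F n).antitone_dTVMax
    have eM : (fun (n : ℕ) (s : ℝ) => (F n).dTVMax ⌊s⌋₊) = fun n s => (F n).tvwMax (detTime s) :=
      funext fun n => funext fun s => (F n).dTVMax_eq _
    have hδ' : 0 < min δ (1 / 2) := lt_min hδ (by norm_num)
    have H : LeftAbrupt detTime (min δ (1 / 2)) (min δ (1 / 2)) F t :=
      { scale := timeScale_detTime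
        adapted := fun n => (F n).adapted_detTime hδ' (min_le_right _ _) fun i =>
          (min_le_left _ _).trans (hK n i)
        κ_pos := hδ'
        ρ_pos := hδ'
        ρ_le_one := (min_le_right _ _).trans (by norm_num)
        t_pos := ht
        abrupt := by
          have h := (cutoffWith_mixD_iff (fun n => hx n 0) ht).1 hL
          simpa only [BDChain.dTV_eq, detTime] using h }
    have hM : ∀ {T : ℕ → ℝ}, (∀ n, 0 < T n) →
        (cutoffWith (fun ε n => ((mixD ((F n).dTVMax) ε : ℕ) : ℝ)) T ↔
          AbruptAt (fun n s => (F n).tvwMax (detTime s)) T) := fun {T} hT => by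
      rw [cutoffWith_mixD_iff hmax hT, eM]
    have key := H.comparison (P := hasCutoff (fun ε n => ((mixD ((F n).dTVMax) ε : ℕ) : ℝ)))
      (fun ⟨φ, hφ, s, hs, h⟩ => hR ⟨φ, hφ, s, hs,
        (cutoffWith_mixD_iff (d := fun k => (F (φ k)).dTV (Fin.last (φ k)))
          (fun k => hx (φ k) _) hs).2 (by simpa only [BDChain.dTV_eq, detTime] using h)⟩)
      (exists_congr fun T => and_congr_right fun hT => hM hT)
    exact ⟨key.1, key.2.1, fun h => (hM ht).2 (key.2.2 h)⟩

end
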